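/- Let S = R ∪ B be a bicolored point set in convex position with |R| = |B| ≥ 1 or |R| = |B| + 1 ≥ 2, and let p, q ∈ S be such that the configuration (S, p, q) is non-special. Then every optimum Hamiltonian alternating path on S with endpoints p and q is 1-plane. -/

import Mathlib

open scoped Classical

noncomputable section

/-- Points of the plane. -/
abbrev Pt := ℝ × ℝ

/-- Orientation determinant of the ordered triple `(a, b, c)`. -/
def det2 (a b c : Pt) : ℝ :=
  (b.1 - a.1) * (c.2 - a.2) - (b.2 - a.2) * (c.1 - a.1)

/-- Two closed segments cross: some point lies in the relative interior of both. -/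
def SegCross (e f : Pt × Pt) : Prop :=
  ∃ x : Pt, x ∈ openSegment ℝ e.1 e.2 ∧ x ∈ openSegment ℝ f.1 f.2

/-- Number of crossings (unordered pairs of crossing edges) among a list of edges. -/
def crossNum (es : List (Pt × Pt)) : ℕ :=
  ((Finset.range es.length ×ˢ Finset.range es.length).filter
    (fun ij => ij.1 < ij.2 ∧
      SegCross (es.getD ij.1 ((0, 0), (0, 0))) (es.getD ij.2 ((0, 0), (0, 0))))).card

/-- Number of other edges crossing the `i`-th edge of the list. -/
def edgeCrossCount (es : List (Pt × Pt)) (i : ℕ) : ℕ :=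
  ((Finset.range es.length).filter (fun j => j ≠ i ∧
      SegCross (es.getD i ((0, 0), (0, 0))) (es.getD j ((0, 0), (0, 0))))).card

/-- Every edge is crossed by at most one other edge. -/
def OnePlane (es : List (Pt × Pt)) : Prop :=
  ∀ i ∈ Finset.range es.length, edgeCrossCount es i ≤ 1

/-- The edges of a path given by its list of vertices. -/
def pathEdges (l : List Pt) : List (Pt × Pt) := l.zip l.tail

/-- The edges of a cycle given by its list of vertices (including the wrap-around edge). -/
def cycleEdges (l : List Pt) : List (Pt × Pt) := l.zip (l.rotate 1)

/-- An edge joining a point of `R` to a point of `B`. -/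
def Bichromatic (R B : Finset Pt) (e : Pt × Pt) : Prop :=
  (e.1 ∈ R ∧ e.2 ∈ B) ∨ (e.1 ∈ B ∧ e.2 ∈ R)

/-- A Hamiltonian alternating path on the bicolored point set `R ∪ B`
with endpoints `p` and `q`. -/
structure HamAltPath (R B : Finset Pt) (p q : Pt) where
  verts : List Pt
  nodup : verts.Nodup
  cover : verts.toFinset = R ∪ B
  head_eq : verts.head? = some p
  last_eq : verts.getLast? = some q
  alt : ∀ e ∈ pathEdges verts, Bichromatic R B e

/-- A Hamiltonian alternating cycle on the bicolored point set `R ∪ B`. -/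
structure HamAltCycle (R B : Finset Pt) where
  verts : List Pt
  nodup : verts.Nodup
  cover : verts.toFinset = R ∪ B
  alt : ∀ e ∈ cycleEdges verts, Bichromatic R B e

/-- A Hamiltonian alternating path with prescribed endpoints is optimum if it has the
minimum number of crossings among all such paths. -/
def OptimumPath (R B : Finset Pt) (p q : Pt) (P : HamAltPath R B p q) : Prop :=
  ∀ Q : HamAltPath R B p q, crossNum (pathEdges P.verts) ≤ crossNum (pathEdges Q.verts)

/-- No three points of `S` are collinear. -/
def GeneralPosition (S : Finset Pt) : Prop :=
  ∀ p ∈ S, ∀ q ∈ S, ∀ r ∈ S, p ≠ q → p ≠ r → q ≠ r → ¬ Collinear ℝ ({p, q, r} : Set Pt)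

/-- Every point of `S` is a vertex (extreme point) of its convex hull. -/
def ConvexPosition (S : Finset Pt) : Prop :=
  ∀ p ∈ S, p ∉ convexHull ℝ ((S.erase p : Finset Pt) : Set Pt)

/-- The points of `S` lying on the boundary of the convex hull of `S`
(i.e. the extreme points of `S`). -/
def hullPts (S : Finset Pt) : Finset Pt :=
  S.filter fun p => p ∉ convexHull ℝ ((S.erase p : Finset Pt) : Set Pt)

/-- Cyclic successor on `Fin m`. -/
def cycSucc {m : ℕ} (hm : 0 < m) (i : Fin m) : Fin m :=
  ⟨(i.val + 1) % m, Nat.mod_lt _ hm⟩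

/-- Cyclic predecessor on `Fin m`. -/
def cycPred {m : ℕ} (hm : 0 < m) (i : Fin m) : Fin m :=
  ⟨(i.val + (m - 1)) % m, Nat.mod_lt _ hm⟩

/-- `pt` lists points in convex position, in clockwise circular order:
every index-increasing triple is clockwise oriented. -/
def CWList {m : ℕ} (pt : Fin m → Pt) : Prop :=
  Function.Injective pt ∧
    ∀ i j k : Fin m, i < j → j < k → det2 (pt i) (pt j) (pt k) < 0

/-- `pt` is a clockwise listing of the points of `S` on the boundary of `CH(S)`. -/
def IsHullList (S : Finset Pt) {m : ℕ} (pt : Fin m → Pt) : Prop :=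
  CWList pt ∧ Finset.univ.image pt = hullPts S

/-- The number of runs of color `A` (with other color `C`) in the cyclic sequence `pt`:
a run starts at an `A`-point whose cyclic predecessor is a `C`-point; a completely
`A`-colored cycle forms a single run. -/
def runCount {m : ℕ} (hm : 0 < m) (A C : Finset Pt) (pt : Fin m → Pt) : ℕ :=
  if ∀ i : Fin m, pt i ∈ A then 1
  else (Finset.univ.filter fun i : Fin m => pt i ∈ A ∧ pt (cycPred hm i) ∈ C).card

/-- `q` is the counterclockwise radial order of the points of `T` around `r`. -/
def CCWOrder (r : Pt) {k : ℕ} (q : Fin k → Pt) (T : Finset Pt) : Prop :=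
  Function.Injective q ∧ Finset.univ.image q = T ∧
    ∀ i j : Fin k, i < j → 0 < det2 r (q i) (q j)

/-- `q` is the clockwise radial order of the points of `T` around `r`. -/
def CWOrder (r : Pt) {k : ℕ} (q : Fin k → Pt) (T : Finset Pt) : Prop :=
  Function.Injective q ∧ Finset.univ.image q = T ∧
    ∀ i j : Fin k, i < j → det2 r (q i) (q j) < 0

/-- Counting one extra point of color `A` (the center), the initial segment
`q 0, …, q j` contains equally many points of color `A` and of color `C`. -/
def BalancedAt (A C : Finset Pt) {k : ℕ} (q : Fin k → Pt) (j : Fin k) : Prop :=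
  1 + (Finset.univ.filter fun i : Fin k => i ≤ j ∧ q i ∈ A).card
    = (Finset.univ.filter fun i : Fin k => i ≤ j ∧ q i ∈ C).card

/-- `j` is the first balanced index of the sequence `q`. -/
def FirstBalanced (A C : Finset Pt) {k : ℕ} (q : Fin k → Pt) (j : Fin k) : Prop :=
  BalancedAt A C q j ∧ ∀ j' : Fin k, j' < j → ¬ BalancedAt A C q j'

/-- The triple `(R ∪ B, r, b)` is a special configuration (Definition 2.2):
(i) both neighbors of `r` on the hull boundary are red and both neighbors of `b` are
blue; (ii) in the counterclockwise and clockwise radial orders around `r`, the first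
balanced point is `b`; (iii) symmetrically around `b`, the first balanced point is `r`. -/
def SpecialConfig (R B : Finset Pt) (r b : Pt) : Prop :=
  r ∈ hullPts (R ∪ B) ∧ b ∈ hullPts (R ∪ B) ∧
  (∀ (m : ℕ) (hm : 0 < m) (pt : Fin m → Pt), IsHullList (R ∪ B) pt →
    ∀ i : Fin m,
      (pt i = r → pt (cycPred hm i) ∈ R ∧ pt (cycSucc hm i) ∈ R) ∧
      (pt i = b → pt (cycPred hm i) ∈ B ∧ pt (cycSucc hm i) ∈ B)) ∧
  (∀ (k : ℕ) (q : Fin k → Pt),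
      (CCWOrder r q ((R ∪ B).erase r) ∨ CWOrder r q ((R ∪ B).erase r)) →
      ∀ j : Fin k, FirstBalanced R B q j → q j = b) ∧
  (∀ (k : ℕ) (q : Fin k → Pt),
      (CCWOrder b q ((R ∪ B).erase b) ∨ CWOrder b q ((R ∪ B).erase b)) →
      ∀ j : Fin k, FirstBalanced B R q j → q j = r)

/-- The unordered pair `{a, b}` occurs as an edge of the list `es`. -/
def IsEdgeOf (es : List (Pt × Pt)) (a b : Pt) : Prop := (a, b) ∈ es ∨ (b, a) ∈ es

/-- The clockwise cyclic interval of indices from `a` to `b`, inclusive. -/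
def cycIdx {m : ℕ} (hm : 0 < m) (a b : Fin m) : Finset (Fin m) :=
  (Finset.range ((b.val + m - a.val) % m + 1)).image
    fun t => (⟨(a.val + t) % m, Nat.mod_lt _ hm⟩ : Fin m)

/-- `z` lies strictly between the two ends of `e`. -/
def insideB (e : ℕ × ℕ) (z : ℕ) : Bool :=
  (decide (e.1 < z) && decide (z < e.2)) || (decide (e.2 < z) && decide (z < e.1))

/-- `z` lies strictly outside of the interval spanned by `e`. -/
def outsideB (e : ℕ × ℕ) (z : ℕ) : Bool :=
  (decide (z < e.1) && decide (z < e.2)) || (decide (e.1 < z) && decide (e.2 < z))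

/-- The chords `e` and `f` interleave. -/
def crossB (e f : ℕ × ℕ) : Bool :=
  (insideB e f.1 && outsideB e f.2) || (outsideB e f.1 && insideB e f.2)

/-- Crossing indicator of two chords. -/
def xc (e f : ℕ × ℕ) : ℕ := (crossB e f).toNat

theorem crossB_iff (e f : ℕ × ℕ) : crossB e f = true ↔
    (((e.1 < f.1 ∧ f.1 < e.2) ∨ (e.2 < f.1 ∧ f.1 < e.1)) ∧
      ((f.2 < e.1 ∧ f.2 < e.2) ∨ (e.1 < f.2 ∧ e.2 < f.2))) ∨
    (((f.1 < e.1 ∧ f.1 < e.2) ∨ (e.1 < f.1 ∧ e.2 < f.1)) ∧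
      ((e.1 < f.2 ∧ f.2 < e.2) ∨ (e.2 < f.2 ∧ f.2 < e.1))) := by
  simp [crossB, insideB, outsideB]

theorem crossB_comm (e f : ℕ × ℕ) : crossB e f = crossB f e := by
  rw [Bool.eq_iff_iff, crossB_iff, crossB_iff]; omega

theorem crossB_swap (a b : ℕ) (f : ℕ × ℕ) : crossB (a, b) f = crossB (b, a) f := by
  rw [Bool.eq_iff_iff, crossB_iff, crossB_iff]; dsimp only; omega

theorem xc_comm (e f : ℕ × ℕ) : xc e f = xc f e := by rw [xc, xc, crossB_comm]

theorem xc_le_one (e f : ℕ × ℕ) : xc e f ≤ 1 := Bool.toNat_le _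

theorem xc_eq_one {e f : ℕ × ℕ} : xc e f = 1 ↔ crossB e f = true := by simp [xc]

theorem xc_eq_zero {e f : ℕ × ℕ} : xc e f = 0 ↔ crossB e f = false := by simp [xc]

/-- The normalized unordered pair. -/
def mkE (a b : ℕ) : ℕ × ℕ := (min a b, max a b)

theorem mkE_comm (a b : ℕ) : mkE a b = mkE b a := by simp [mkE, min_comm, max_comm]

theorem mkE_cases (a b : ℕ) : mkE a b = (a, b) ∨ mkE a b = (b, a) := by
  rcases le_total a b with h | h <;> simp [mkE, h]

@[simp] theorem crossB_mkE_left (a b : ℕ) (f : ℕ × ℕ) : crossB (mkE a b) f = crossB (a, b) f := by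
  rcases mkE_cases a b with h | h <;> rw [h]
  exact crossB_swap _ _ _

@[simp] theorem crossB_mkE_right (a b : ℕ) (f : ℕ × ℕ) : crossB f (mkE a b) = crossB f (a, b) := by
  rw [crossB_comm, crossB_mkE_left, crossB_comm]

@[simp] theorem xc_mkE_left (a b : ℕ) (f : ℕ × ℕ) : xc (mkE a b) f = xc (a, b) f := by simp [xc]

@[simp] theorem xc_mkE_right (a b : ℕ) (f : ℕ × ℕ) : xc f (mkE a b) = xc f (a, b) := by simp [xc]

/-- Number of chords of `A` crossed by `o`. -/
def crossWith (A : List (ℕ × ℕ)) (o : ℕ × ℕ) : ℕ := (A.map fun a => xc a o).sum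

/-- Number of crossings between the chords of `A` and those of `B`. -/
def crossBetween (A B : List (ℕ × ℕ)) : ℕ := (B.map fun o => crossWith A o).sum

/-- Number of crossing pairs in a list of chords. -/
def selfCross : List (ℕ × ℕ) → ℕ
  | [] => 0
  | e :: L => crossWith L e + selfCross L

@[simp] theorem crossWith_nil (o : ℕ × ℕ) : crossWith [] o = 0 := rfl

@[simp] theorem crossWith_cons (a : ℕ × ℕ) (A : List (ℕ × ℕ)) (o : ℕ × ℕ) :
    crossWith (a :: A) o = xc a o + crossWith A o := by simp [crossWith]

@[simp] theorem crossWith_append (A B : List (ℕ × ℕ)) (o : ℕ × ℕ) :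
    crossWith (A ++ B) o = crossWith A o + crossWith B o := by simp [crossWith]

@[simp] theorem crossBetween_nil (A : List (ℕ × ℕ)) : crossBetween A [] = 0 := rfl

@[simp] theorem crossBetween_cons (A B : List (ℕ × ℕ)) (o : ℕ × ℕ) :
    crossBetween A (o :: B) = crossWith A o + crossBetween A B := by simp [crossBetween]

@[simp] theorem crossBetween_nil_left (B : List (ℕ × ℕ)) : crossBetween [] B = 0 := by
  simp [crossBetween]

theorem crossBetween_cons_left (a : ℕ × ℕ) (A B : List (ℕ × ℕ)) :
    crossBetween (a :: A) B = crossWith B a + crossBetween A B := by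
  induction B with
  | nil => simp
  | cons o B ih =>
    simp only [crossBetween_cons, crossWith_cons, ih, xc_comm o a]; omega

theorem selfCross_append (A B : List (ℕ × ℕ)) :
    selfCross (A ++ B) = selfCross A + selfCross B + crossBetween A B := by
  induction A with
  | nil => simp [selfCross]
  | cons a A ih =>
    simp only [List.cons_append, selfCross, ih, crossWith_append, crossBetween_cons_left]; omega

theorem crossWith_perm {A B : List (ℕ × ℕ)} (h : A.Perm B) (o : ℕ × ℕ) :
    crossWith A o = crossWith B o := (h.map _).sum_eq

theorem selfCross_perm {A B : List (ℕ × ℕ)} (h : A.Perm B) : selfCross A = selfCross B := by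
  induction h with
  | nil => rfl
  | cons x h ih => simp only [selfCross, ih, crossWith_perm h]
  | swap x y l => simp only [selfCross, crossWith_cons, xc_comm x y]; omega
  | trans _ _ ih1 ih2 => exact ih1.trans ih2

theorem crossBetween_le {A A' O : List (ℕ × ℕ)}
    (h : ∀ o ∈ O, crossWith A' o ≤ crossWith A o) : crossBetween A' O ≤ crossBetween A O := by
  induction O with
  | nil => simp
  | cons o O ih =>
    simp only [crossBetween_cons]
    exact Nat.add_le_add (h o (by simp)) (ih fun o ho => h o (by simp [ho]))

/-- The (normalized) edges of a path. -/
def edgesOf : List ℕ → List (ℕ × ℕ)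
  | [] => []
  | [_] => []
  | a :: b :: t => mkE a b :: edgesOf (b :: t)

/-- The number of crossings of a path. -/
def cr (l : List ℕ) : ℕ := selfCross (edgesOf l)

/-- `m` is a nonempty list with first element `a` and last element `b`. -/
def Seg (m : List ℕ) (a b : ℕ) : Prop := m.head? = some a ∧ m.getLast? = some b

theorem Seg.append {m m' : List ℕ} {a b c d : ℕ} (h : Seg m a b) (h' : Seg m' c d) :
    Seg (m ++ m') a d := by
  constructor
  · simp [h.1]
  · simp [h'.2]

theorem Seg.reverse {m : List ℕ} {a b : ℕ} (h : Seg m a b) : Seg m.reverse b a := by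
  constructor
  · simp [h.2]
  · simp [h.1]

theorem Seg.singleton (a : ℕ) : Seg [a] a a := ⟨rfl, rfl⟩

theorem Seg.mem_left {m : List ℕ} {a b : ℕ} (h : Seg m a b) : a ∈ m := List.mem_of_head? h.1

theorem Seg.mem_right {m : List ℕ} {a b : ℕ} (h : Seg m a b) : b ∈ m := List.mem_of_getLast? h.2

theorem edgesOf_append {m m' : List ℕ} {a b c d : ℕ} (h : Seg m a b) (h' : Seg m' c d) :
    edgesOf (m ++ m') = edgesOf m ++ mkE b c :: edgesOf m' := by
  induction m generalizing a with
  | nil => simp [Seg] at h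
  | cons x t ih =>
    cases t with
    | nil =>
      obtain ⟨-, h2⟩ := h
      simp at h2
      cases m' with
      | nil => simp [Seg] at h'
      | cons y t' =>
        have : y = c := by simpa [Seg] using h'.1
        subst this; subst h2
        simp [edgesOf]
    | cons y t =>
      have : Seg (y :: t) y b := ⟨rfl, by simpa [Seg] using h.2⟩
      have := ih this
      simp only [List.cons_append, edgesOf] at this ⊢
      rw [this]

theorem edgesOf_reverse (m : List ℕ) : edgesOf m.reverse = (edgesOf m).reverse := by
  induction m with
  | nil => rfl
  | cons x t ih =>
    cases t with
    | nil => rfl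
    | cons y t =>
      have h0 : Seg (y :: t) y ((y :: t).getLast (by simp)) :=
        ⟨rfl, List.getLast?_eq_some_getLast _⟩
      rw [List.reverse_cons, edgesOf_append h0.reverse (Seg.singleton x), ih]
      simp [edgesOf, mkE_comm]

theorem mem_edgesOf {l : List ℕ} {o : ℕ × ℕ} (h : o ∈ edgesOf l) :
    ∃ i, ∃ h : i + 1 < l.length, o = mkE (l[i]) (l[i + 1]) := by
  induction l with
  | nil => simp [edgesOf] at h
  | cons x t ih =>
    cases t with
    | nil => simp [edgesOf] at h
    | cons y t =>
      simp only [edgesOf, List.mem_cons] at h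
      rcases h with h | h
      · exact ⟨0, by simp, by simpa using h⟩
      · obtain ⟨i, hi, h⟩ := ih h
        exact ⟨i + 1, by simpa using hi, by simpa using h⟩

/-- Consecutive vertices have different colors. -/
def Alt (col : ℕ → Bool) (l : List ℕ) : Prop := l.IsChain fun a b => col a ≠ col b

theorem Alt.append_iff {col : ℕ → Bool} {m m' : List ℕ} {a b c d : ℕ}
    (h : Seg m a b) (h' : Seg m' c d) :
    Alt col (m ++ m') ↔ Alt col m ∧ Alt col m' ∧ col b ≠ col c := by
  unfold Alt
  rw [List.isChain_append, h.2, h'.1]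
  simp

theorem Alt.reverse {col : ℕ → Bool} {m : List ℕ} (h : Alt col m) : Alt col m.reverse := by
  unfold Alt at *
  rw [List.isChain_reverse]
  exact h.imp fun a b hab => hab.symm

/-- A Hamiltonian alternating path on the labels `0, …, N - 1`. -/
def Valid (N : ℕ) (col : ℕ → Bool) (l : List ℕ) : Prop := l.Perm (List.range N) ∧ Alt col l

/-- An optimum Hamiltonian alternating path (with its own endpoints prescribed). -/
def Opt (N : ℕ) (col : ℕ → Bool) (l : List ℕ) : Prop :=
  Valid N col l ∧ ∀ l', Valid N col l' → l'.head? = l.head? → l'.getLast? = l.getLast? → cr l ≤ cr l'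

theorem Opt.lt {N : ℕ} {col : ℕ → Bool} {l : List ℕ} (h : Opt N col l) {a : ℕ} (ha : a ∈ l) :
    a < N := List.mem_range.1 (h.1.1.mem_iff.1 ha)

theorem Opt.nodup {N : ℕ} {col : ℕ → Bool} {l : List ℕ} (h : Opt N col l) : l.Nodup :=
  h.1.1.nodup_iff.2 List.nodup_range

theorem cr_reverse (l : List ℕ) : cr l.reverse = cr l := by
  unfold cr; rw [edgesOf_reverse]; exact selfCross_perm (List.reverse_perm _)

theorem Valid.reverse {N : ℕ} {col : ℕ → Bool} {l : List ℕ} (h : Valid N col l) :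
    Valid N col l.reverse := ⟨(List.reverse_perm _).trans h.1, h.2.reverse⟩

theorem Opt.reverse {N : ℕ} {col : ℕ → Bool} {l : List ℕ} (h : Opt N col l) :
    Opt N col l.reverse := by
  refine ⟨h.1.reverse, fun l' hv h1 h2 => ?_⟩
  rw [cr_reverse, ← cr_reverse l']
  apply h.2 _ hv.reverse
  · simpa using h2
  · simpa using h1

/-- Mutually inverse relabelings generated by a rotation and a reflection of the circular order. -/
inductive Dih (N : ℕ) : (ℕ → ℕ) → (ℕ → ℕ) → Prop
  | id : Dih N id id
  | rot {σ τ : ℕ → ℕ} : Dih N σ τ →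
      Dih N (fun a => if σ a = 0 then N - 1 else σ a - 1)
        (fun a => τ (if a + 1 = N then 0 else a + 1))
  | refl {σ τ : ℕ → ℕ} : Dih N σ τ →
      Dih N (fun a => if σ a = 0 then 0 else N - σ a) (fun a => τ (if a = 0 then 0 else N - a))

/-- A relabeling of `0, …, N - 1` preserving crossings. -/
structure Relabel (N : ℕ) (σ τ : ℕ → ℕ) : Prop where
  map_lt : ∀ a < N, σ a < N
  inv_lt : ∀ a < N, τ a < N
  left_inv : ∀ a < N, τ (σ a) = a
  right_inv : ∀ a < N, σ (τ a) = a
  cross : ∀ a < N, ∀ b < N, ∀ c < N, ∀ d < N,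
    crossB (σ a, σ b) (σ c, σ d) = crossB (a, b) (c, d)

set_option maxHeartbeats 1000000 in
theorem crossB_rot {N a b c d : ℕ} (ha : a < N) (hb : b < N) (hc : c < N) (hd : d < N) :
    crossB (if a = 0 then N - 1 else a - 1, if b = 0 then N - 1 else b - 1)
      (if c = 0 then N - 1 else c - 1, if d = 0 then N - 1 else d - 1) =
    crossB (a, b) (c, d) := by
  rw [Bool.eq_iff_iff, crossB_iff, crossB_iff]; dsimp only
  split_ifs <;> omega

theorem crossB_refl {N a b c d : ℕ} (ha : a < N) (hb : b < N) (hc : c < N) (hd : d < N) :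
    crossB (if a = 0 then 0 else N - a, if b = 0 then 0 else N - b)
      (if c = 0 then 0 else N - c, if d = 0 then 0 else N - d) =
    crossB (a, b) (c, d) := by
  rw [Bool.eq_iff_iff, crossB_iff, crossB_iff]; dsimp only
  split_ifs <;> omega

theorem Dih.relabel {N : ℕ} {σ τ : ℕ → ℕ} (h : Dih N σ τ) : Relabel N σ τ := by
  induction h with
  | id => exact ⟨fun _ h => h, fun _ h => h, fun _ _ => rfl, fun _ _ => rfl, fun _ _ _ _ _ _ _ _ => rfl⟩
  | @rot σ τ _ ih =>
    refine ⟨fun a ha => ?_, fun a ha => ?_, fun a ha => ?_, fun a ha => ?_,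
      fun a ha b hb c hc d hd => ?_⟩
    · have := ih.map_lt a ha; split_ifs <;> omega
    · apply ih.inv_lt; split_ifs <;> omega
    · have := ih.map_lt a ha
      have h2 := ih.left_inv a ha
      split_ifs <;> first | omega | skip
      · exact (congrArg τ (by omega)).trans h2
      · exact (congrArg τ (by omega)).trans h2
    · have h1 : (if a + 1 = N then 0 else a + 1) < N := by split_ifs <;> omega
      rw [ih.right_inv _ h1]
      by_cases h2 : a + 1 = N
      · simp [h2]; omega
      · simp [h2]
    · rw [crossB_rot (ih.map_lt a ha) (ih.map_lt b hb) (ih.map_lt c hc) (ih.map_lt d hd),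
        ih.cross a ha b hb c hc d hd]
  | @refl σ τ _ ih =>
    refine ⟨fun a ha => ?_, fun a ha => ?_, fun a ha => ?_, fun a ha => ?_,
      fun a ha b hb c hc d hd => ?_⟩
    · have := ih.map_lt a ha; split_ifs <;> omega
    · apply ih.inv_lt; split_ifs <;> omega
    · have := ih.map_lt a ha
      have h2 := ih.left_inv a ha
      split_ifs <;> first | omega | skip
      · exact (congrArg τ (by omega)).trans h2
      · exact (congrArg τ (by omega)).trans h2
    · have h1 : (if a = 0 then 0 else N - a) < N := by split_ifs <;> omega
      rw [ih.right_inv _ h1]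
      split_ifs <;> omega
    · rw [crossB_refl (ih.map_lt a ha) (ih.map_lt b hb) (ih.map_lt c hc) (ih.map_lt d hd),
        ih.cross a ha b hb c hc d hd]

theorem Dih.exists_rot {N : ℕ} {σ τ : ℕ → ℕ} (h : Dih N σ τ) (u : ℕ) (hu : u < N) :
    ∃ σ' τ', Dih N σ' τ' ∧ ∃ ρ : ℕ → ℕ, (∀ a, σ' a = ρ (σ a)) ∧ ρ u = 0 := by
  induction u generalizing σ τ with
  | zero => exact ⟨σ, τ, h, fun a => a, fun _ => rfl, rfl⟩
  | succ u ih =>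
    obtain ⟨σ', τ', h', ρ, h1, h2⟩ := ih h.rot (by omega)
    exact ⟨σ', τ', h', fun a => ρ (if a = 0 then N - 1 else a - 1), h1, by simpa using h2⟩

theorem Relabel.symm {N : ℕ} {σ τ : ℕ → ℕ} (h : Relabel N σ τ) : Relabel N τ σ := by
  refine ⟨h.inv_lt, h.map_lt, h.right_inv, h.left_inv, fun a ha b hb c hc d hd => ?_⟩
  rw [← h.cross _ (h.inv_lt a ha) _ (h.inv_lt b hb) _ (h.inv_lt c hc) _ (h.inv_lt d hd),
    h.right_inv a ha, h.right_inv b hb, h.right_inv c hc, h.right_inv d hd]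

theorem Seg.map {m : List ℕ} {a b : ℕ} (h : Seg m a b) (σ : ℕ → ℕ) :
    Seg (m.map σ) (σ a) (σ b) := by
  constructor
  · simp [h.1]
  · simp [h.2]

theorem edgesOf_map (m : List ℕ) (σ : ℕ → ℕ) :
    edgesOf (m.map σ) = (edgesOf m).map fun e => mkE (σ e.1) (σ e.2) := by
  induction m with
  | nil => rfl
  | cons x t ih =>
    cases t with
    | nil => rfl
    | cons y t =>
      simp only [List.map_cons, edgesOf] at ih ⊢
      rw [ih]
      congr 1
      rcases mkE_cases x y with h | h <;> rw [h]
      exact mkE_comm _ _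

theorem mem_edgesOf_fst_snd {l : List ℕ} {o : ℕ × ℕ} (h : o ∈ edgesOf l) : o.1 ∈ l ∧ o.2 ∈ l := by
  obtain ⟨i, hi, rfl⟩ := mem_edgesOf h
  rcases mkE_cases l[i] l[i+1] with h | h <;> rw [h] <;> simp

theorem Relabel.crossWith {N : ℕ} {σ τ : ℕ → ℕ} (h : Relabel N σ τ) {L : List (ℕ × ℕ)}
    (hL : ∀ o ∈ L, o.1 < N ∧ o.2 < N) {a b : ℕ} (ha : a < N) (hb : b < N) :
    crossWith (L.map fun e => mkE (σ e.1) (σ e.2)) (σ a, σ b) = crossWith L (a, b) := by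
  induction L with
  | nil => rfl
  | cons o L ih =>
    simp only [List.map_cons, crossWith_cons, xc_mkE_left]
    rw [ih fun o ho => hL o (by simp [ho])]
    have := hL o (by simp)
    rw [xc, h.cross _ this.1 _ this.2 _ ha _ hb, xc]

theorem Relabel.crossWith_edgesOf {N : ℕ} {σ τ : ℕ → ℕ} (h : Relabel N σ τ) {m : List ℕ}
    (hm : ∀ o ∈ m, o < N) {a b : ℕ} (ha : a < N) (hb : b < N) :
    _root_.crossWith (edgesOf (m.map σ)) (σ a, σ b) = _root_.crossWith (edgesOf m) (a, b) := by
  rw [edgesOf_map]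
  exact h.crossWith (fun o ho => ⟨hm _ (mem_edgesOf_fst_snd ho).1, hm _ (mem_edgesOf_fst_snd ho).2⟩)
    ha hb

theorem Relabel.selfCross {N : ℕ} {σ τ : ℕ → ℕ} (h : Relabel N σ τ) {L : List (ℕ × ℕ)}
    (hL : ∀ o ∈ L, o.1 < N ∧ o.2 < N) :
    selfCross (L.map fun e => mkE (σ e.1) (σ e.2)) = selfCross L := by
  induction L with
  | nil => rfl
  | cons o L ih =>
    have h1 := hL o (by simp)
    have hL' : ∀ o ∈ L, o.1 < N ∧ o.2 < N := fun o ho => hL o (by simp [ho])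
    simp only [List.map_cons, _root_.selfCross]
    rw [ih hL']
    rw [← h.crossWith hL' h1.1 h1.2]
    congr 1
    unfold _root_.crossWith
    simp

theorem Relabel.cr {N : ℕ} {σ τ : ℕ → ℕ} (h : Relabel N σ τ) {l : List ℕ}
    (hl : ∀ a ∈ l, a < N) : cr (l.map σ) = cr l := by
  unfold _root_.cr
  rw [edgesOf_map]
  exact h.selfCross fun o ho => ⟨hl _ (mem_edgesOf_fst_snd ho).1, hl _ (mem_edgesOf_fst_snd ho).2⟩

theorem Relabel.map_map {N : ℕ} {σ τ : ℕ → ℕ} (h : Relabel N σ τ) {l : List ℕ}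
    (hl : ∀ a ∈ l, a < N) : (l.map σ).map τ = l := by
  rw [List.map_map]
  conv_rhs => rw [← List.map_id l]
  exact List.map_congr_left fun a ha => h.left_inv a (hl a ha)

theorem Relabel.valid {N : ℕ} {σ τ : ℕ → ℕ} (h : Relabel N σ τ) {col : ℕ → Bool} {l : List ℕ}
    (hv : Valid N col l) : Valid N (fun a => col (τ a)) (l.map σ) := by
  have hl : ∀ a ∈ l, a < N := fun a ha => List.mem_range.1 (hv.1.mem_iff.1 ha)
  constructor
  · apply List.perm_of_nodup_nodup_toFinset_eq
    · apply List.Nodup.map_on _ (hv.1.nodup_iff.2 List.nodup_range)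
      intro a ha b hb hab
      rw [← h.left_inv a (hl a ha), hab, h.left_inv b (hl b hb)]
    · exact List.nodup_range
    · ext a
      simp only [List.mem_toFinset, List.mem_map, List.mem_range]
      constructor
      · rintro ⟨b, hb, rfl⟩; exact h.map_lt b (hl b hb)
      · intro ha
        exact ⟨τ a, hv.1.mem_iff.2 (List.mem_range.2 (h.inv_lt a ha)), h.right_inv a ha⟩
  · have h2 : Alt (fun a => col (τ a)) (l.map σ) ↔ Alt col ((l.map σ).map τ) := by
      unfold Alt; rw [List.isChain_map τ]
    rw [h2, h.map_map hl]
    exact hv.2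

theorem Relabel.opt {N : ℕ} {σ τ : ℕ → ℕ} (h : Relabel N σ τ) {col : ℕ → Bool} {l : List ℕ}
    (ho : Opt N col l) : Opt N (fun a => col (τ a)) (l.map σ) := by
  refine ⟨h.valid ho.1, fun l' hv h1 h2 => ?_⟩
  have hl : ∀ a ∈ l, a < N := fun a ha => ho.lt ha
  have hl' : ∀ a ∈ l', a < N := fun a ha => List.mem_range.1 (hv.1.mem_iff.1 ha)
  rw [h.cr hl, ← h.symm.cr hl']
  have hv' := h.symm.valid hv
  apply ho.2
  · refine ⟨hv'.1, ?_⟩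
    have := hv'.2
    unfold Alt at this ⊢
    refine this.imp_of_mem_imp ?_
    intro a b ha hb hab
    have ha' := List.mem_range.1 (hv'.1.mem_iff.1 ha)
    have hb' := List.mem_range.1 (hv'.1.mem_iff.1 hb)
    simpa only [h.left_inv a ha', h.left_inv b hb'] using hab
  · have := congrArg (Option.map τ) h1
    rw [← List.head?_map, ← List.head?_map, h.map_map hl] at this
    exact this
  · have := congrArg (Option.map τ) h2
    rw [← List.getLast?_map, ← List.getLast?_map, h.map_map hl] at this
    exact this

/-- `γ` locates `c` with respect to the first `n` values of `x`: odd values of `γ` correspond to the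
values of `x`, even ones to the gaps between them. -/
def Loc (n : ℕ) (x : ℕ → ℕ) (c γ : ℕ) : Prop :=
  ∀ j < n, (c < x j ↔ γ < 2 * j + 1) ∧ (x j < c ↔ 2 * j + 1 < γ)

theorem exists_loc {n : ℕ} {x : ℕ → ℕ} (hx : ∀ j < n, ∀ i < j, x i < x j) (c : ℕ) :
    ∃ γ < 2 * n + 1, Loc n x c γ := by
  induction n with
  | zero => exact ⟨0, by simp, by simp [Loc]⟩
  | succ n ih =>
    obtain ⟨γ, hγ, h⟩ := ih fun j hj i hi => hx j (by omega) i hi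
    have key : ∀ j < n, x j < x n := fun j hj => hx n (by omega) j hj
    rcases lt_trichotomy c (x n) with hc | hc | hc
    · refine ⟨γ, by omega, fun j hj => ?_⟩
      rcases Nat.lt_succ_iff_lt_or_eq.1 hj with hj | rfl
      · exact h j hj
      · constructor <;> constructor <;> intro <;> omega
    · refine ⟨2 * n + 1, by omega, fun j hj => ?_⟩
      rcases Nat.lt_succ_iff_lt_or_eq.1 hj with hj | rfl
      · have := key j hj
        constructor <;> constructor <;> intro <;> omega
      · constructor <;> constructor <;> intro <;> omega
    · refine ⟨2 * n + 2, by omega, fun j hj => ?_⟩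
      rcases Nat.lt_succ_iff_lt_or_eq.1 hj with hj | rfl
      · have := key j hj
        constructor <;> constructor <;> intro <;> omega
      · constructor <;> constructor <;> intro <;> omega

theorem crossB_loc {n : ℕ} {x : ℕ → ℕ} {c d γ δ i j : ℕ} (hc : Loc n x c γ) (hd : Loc n x d δ)
    (hi : i < n) (hj : j < n) :
    crossB (x i, x j) (c, d) = crossB (2 * i + 1, 2 * j + 1) (γ, δ) := by
  have h1 := hc i hi
  have h2 := hc j hj
  have h3 := hd i hi
  have h4 := hd j hj
  unfold crossB insideB outsideB
  dsimp only
  simp only [h1, h2, h3, h4]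

/-- The chord between two members of `xs` given by their positions. -/
def chordAt (xs : List ℕ) (e : ℕ × ℕ) : ℕ × ℕ := mkE (xs.getD e.1 0) (xs.getD e.2 0)

/-- The location code of a chord given by positions. -/
def locChord (e : ℕ × ℕ) : ℕ × ℕ := (2 * e.1 + 1, 2 * e.2 + 1)

theorem crossWith_chordAt {xs : List ℕ} {L : List (ℕ × ℕ)}
    (hL : ∀ e ∈ L, e.1 < xs.length ∧ e.2 < xs.length) {c d γ δ : ℕ}
    (hc : Loc xs.length (fun j => xs.getD j 0) c γ) (hd : Loc xs.length (fun j => xs.getD j 0) d δ) :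
    crossWith (L.map (chordAt xs)) (c, d) = crossWith (L.map locChord) (γ, δ) := by
  induction L with
  | nil => rfl
  | cons e L ih =>
    simp only [List.map_cons, crossWith_cons]
    rw [ih fun e he => hL e (by simp [he])]
    have := hL e (by simp)
    congr 1
    rw [chordAt, xc_mkE_left, xc, xc, locChord, ← crossB_loc hc hd this.1 this.2]

theorem sorted_getD {xs : List ℕ} (h : xs.Pairwise (· < ·)) :
    ∀ j < xs.length, ∀ i < j, (fun j => xs.getD j 0) i < (fun j => xs.getD j 0) j := by
  intro j hj i hi
  have := List.pairwise_iff_getElem.1 h i j (by omega) hj hi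
  simpa [List.getD_eq_getElem?_getD, hj, show i < xs.length by omega] using this

theorem loc_self {xs : List ℕ} (h : xs.Pairwise (· < ·)) {i : ℕ} (hi : i < xs.length) :
    Loc xs.length (fun j => xs.getD j 0) (xs.getD i 0) (2 * i + 1) := by
  have h := sorted_getD h
  intro j hj
  rcases lt_trichotomy i j with hij | rfl | hij
  · have := h j hj i hij
    dsimp only at this ⊢
    omega
  · simp
  · have := h i hi j hij
    dsimp only at this ⊢
    omega

theorem selfCross_chordAt {xs : List ℕ} (h : xs.Pairwise (· < ·)) {L : List (ℕ × ℕ)}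
    (hL : ∀ e ∈ L, e.1 < xs.length ∧ e.2 < xs.length) :
    selfCross (L.map (chordAt xs)) = selfCross (L.map locChord) := by
  induction L with
  | nil => rfl
  | cons e L ih =>
    have hL' : ∀ e ∈ L, e.1 < xs.length ∧ e.2 < xs.length := fun e he => hL e (by simp [he])
    have he := hL e (by simp)
    simp only [List.map_cons, selfCross]
    rw [ih hL']
    congr 1
    rw [locChord, ← crossWith_chordAt hL' (loc_self h he.1) (loc_self h he.2), chordAt]
    unfold crossWith
    simp

/-- Replacing the chords `old` by `new` does not decrease the number of crossings. -/
def NoImp (old new O : List (ℕ × ℕ)) : Prop := selfCross (old ++ O) ≤ selfCross (new ++ O)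

theorem NoImp.elim {A A' O : List (ℕ × ℕ)} (h : NoImp A A' O) (hI : selfCross A' < selfCross A)
    (hO : ∀ o ∈ O, crossWith A' o ≤ crossWith A o) : False := by
  unfold NoImp at h
  rw [selfCross_append, selfCross_append] at h
  have := crossBetween_le hO
  omega

theorem NoImp.perm {A A' B B' O O' : List (ℕ × ℕ)} (h : NoImp A A' O)
    (h1 : (A ++ O).Perm (B ++ O')) (h2 : (A' ++ O).Perm (B' ++ O')) : NoImp B B' O' := by
  unfold NoImp
  rw [← selfCross_perm h1, ← selfCross_perm h2]; exact h

/-- The finite check that replacing `old` by `new` reduces the number of crossings among themselves,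
and does not increase the number of crossings with chords other than those excluded by `bad`. -/
def checkMove (n : ℕ) (old new : List (ℕ × ℕ)) (bad : ℕ → ℕ → Bool) : Bool :=
  (old.all fun e => decide (e.1 < n) && decide (e.2 < n)) &&
  (new.all fun e => decide (e.1 < n) && decide (e.2 < n)) &&
  decide (selfCross (new.map locChord) < selfCross (old.map locChord)) &&
  (List.range (2 * n + 1)).all fun γ => (List.range (2 * n + 1)).all fun δ =>
    bad γ δ || decide (crossWith (new.map locChord) (γ, δ) ≤ crossWith (old.map locChord) (γ, δ))

theorem NoImp.contra {xs : List ℕ} {old new O : List (ℕ × ℕ)} (bad : ℕ → ℕ → Bool)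
    (h : NoImp (old.map (chordAt xs)) (new.map (chordAt xs)) O) (hxs : xs.Pairwise (· < ·))
    {n : ℕ} (hn : xs.length = n) (hcheck : checkMove n old new bad = true)
    (hbad : ∀ o ∈ O, ∀ γ δ, Loc xs.length (fun j => xs.getD j 0) o.1 γ →
      Loc xs.length (fun j => xs.getD j 0) o.2 δ → bad γ δ = false) : False := by
  subst hn
  simp only [checkMove, Bool.and_eq_true, List.all_eq_true, decide_eq_true_eq, List.mem_range,
    Bool.or_eq_true] at hcheck
  obtain ⟨⟨⟨h1, h2⟩, h3⟩, h4⟩ := hcheck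
  refine h.elim ?_ fun o ho => ?_
  · rwa [selfCross_chordAt hxs h1, selfCross_chordAt hxs h2]
  · obtain ⟨γ, hγ, hγ'⟩ := exists_loc (sorted_getD hxs) o.1
    obtain ⟨δ, hδ, hδ'⟩ := exists_loc (sorted_getD hxs) o.2
    rw [show o = (o.1, o.2) from rfl, crossWith_chordAt h1 hγ' hδ', crossWith_chordAt h2 hγ' hδ']
    rcases h4 γ hγ δ hδ with h5 | h5
    · rw [hbad o ho γ δ hγ' hδ'] at h5; cases h5
    · exact h5

theorem NoImp.contra_all {xs : List ℕ} {old new O : List (ℕ × ℕ)}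
    (h : NoImp (old.map (chordAt xs)) (new.map (chordAt xs)) O) (hxs : xs.Pairwise (· < ·))
    {n : ℕ} (hn : xs.length = n) (hcheck : checkMove n old new (fun _ _ => false) = true) : False :=
  h.contra _ hxs hn hcheck fun _ _ _ _ _ _ => rfl

theorem Opt.noImp {N : ℕ} {col : ℕ → Bool} {l l' : List ℕ} {p q : ℕ} (h : Opt N col l)
    (hl : Seg l p q) (hl' : Seg l' p q) (hp : l'.Perm l) (ha : Alt col l')
    {A A' O : List (ℕ × ℕ)} (hA : (edgesOf l).Perm (A ++ O)) (hA' : (edgesOf l').Perm (A' ++ O)) :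
    NoImp A A' O := by
  have h1 := h.2 l' ⟨hp.trans h.1.1, ha⟩ (by rw [hl.1, hl'.1]) (by rw [hl.2, hl'.2])
  unfold cr at h1
  rwa [selfCross_perm hA, selfCross_perm hA'] at h1

theorem Opt.two_opt {N : ℕ} {col : ℕ → Bool} {s1 s2 s3 : List ℕ} {p a b c d q : ℕ}
    (h : Opt N col (s1 ++ s2 ++ s3)) (h1 : Seg s1 p a) (h2 : Seg s2 b c) (h3 : Seg s3 d q)
    (hac : col a ≠ col c) (hbd : col b ≠ col d) :
    NoImp [mkE a b, mkE c d] [mkE a c, mkE b d] (edgesOf s1 ++ edgesOf s2 ++ edgesOf s3) := by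
  have hA := h.1.2
  rw [Alt.append_iff (h1.append h2) h3, Alt.append_iff h1 h2] at hA
  refine h.noImp (l' := s1 ++ s2.reverse ++ s3) ((h1.append h2).append h3)
    ((h1.append h2.reverse).append h3) ?_ ?_ ?_ ?_
  · exact List.perm_append_right_iff _ |>.2 (List.perm_append_left_iff _ |>.2 (List.reverse_perm _))
  · rw [Alt.append_iff (h1.append h2.reverse) h3, Alt.append_iff h1 h2.reverse]
    exact ⟨⟨hA.1.1, hA.1.2.1.reverse, hac⟩, hA.2.1, hbd⟩
  · rw [edgesOf_append (h1.append h2) h3, edgesOf_append h1 h2]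
    refine List.perm_iff_count.2 fun e => ?_
    simp only [List.count_append, List.count_cons, List.count_nil]
    ring
  · rw [edgesOf_append (h1.append h2.reverse) h3, edgesOf_append h1 h2.reverse, edgesOf_reverse]
    refine List.perm_iff_count.2 fun e => ?_
    simp only [List.count_append, List.count_cons, List.count_nil, List.count_reverse]
    ring

theorem Opt.not_cross_of_ne {N : ℕ} {col : ℕ → Bool} {s1 s2 s3 : List ℕ} {p a b c d q : ℕ}
    (h : Opt N col (s1 ++ s2 ++ s3)) (h1 : Seg s1 p a) (h2 : Seg s2 b c) (h3 : Seg s3 d q)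
    (hac : col a ≠ col c) : crossB (a, b) (c, d) = false := by
  by_contra hcr
  rw [Bool.not_eq_false, crossB_iff] at hcr
  have hA := h.1.2
  rw [Alt.append_iff (h1.append h2) h3, Alt.append_iff h1 h2] at hA
  have hbd : col b ≠ col d := by
    have e1 := hA.1.2.2
    have e2 := hA.2.2
    revert e1 e2 hac
    cases col a <;> cases col b <;> cases col c <;> cases col d <;> simp
  have hN := h.two_opt h1 h2 h3 hac hbd
  dsimp only at hcr
  have : (a < c ∧ c < b ∧ b < d) ∨ (c < a ∧ a < d ∧ d < b) ∨ (a < d ∧ d < b ∧ b < c) ∨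
    (d < a ∧ a < c ∧ c < b) ∨ (b < c ∧ c < a ∧ a < d) ∨ (c < b ∧ b < d ∧ d < a) ∨
    (b < d ∧ d < a ∧ a < c) ∨ (d < b ∧ b < c ∧ c < a) := by
    rcases hcr with ⟨h1 | h1, h2 | h2⟩ | ⟨h1 | h1, h2 | h2⟩ <;> omega
  rcases this with h | h | h | h | h | h | h | h
  · exact NoImp.contra_all (xs := [a, c, b, d]) (old := [(0, 2), (1, 3)]) (new := [(0, 1), (2, 3)])
      hN (by simp; omega) (n := 4) rfl (by decide +kernel)
  · exact NoImp.contra_all (xs := [c, a, d, b]) (old := [(1, 3), (0, 2)]) (new := [(1, 0), (3, 2)])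
      hN (by simp; omega) (n := 4) rfl (by decide +kernel)
  · exact NoImp.contra_all (xs := [a, d, b, c]) (old := [(0, 2), (3, 1)]) (new := [(0, 3), (2, 1)])
      hN (by simp; omega) (n := 4) rfl (by decide +kernel)
  · exact NoImp.contra_all (xs := [d, a, c, b]) (old := [(1, 3), (2, 0)]) (new := [(1, 2), (3, 0)])
      hN (by simp; omega) (n := 4) rfl (by decide +kernel)
  · exact NoImp.contra_all (xs := [b, c, a, d]) (old := [(2, 0), (1, 3)]) (new := [(2, 1), (0, 3)])
      hN (by simp; omega) (n := 4) rfl (by decide +kernel)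
  · exact NoImp.contra_all (xs := [c, b, d, a]) (old := [(3, 1), (0, 2)]) (new := [(3, 0), (1, 2)])
      hN (by simp; omega) (n := 4) rfl (by decide +kernel)
  · exact NoImp.contra_all (xs := [b, d, a, c]) (old := [(2, 0), (3, 1)]) (new := [(2, 3), (0, 1)])
      hN (by simp; omega) (n := 4) rfl (by decide +kernel)
  · exact NoImp.contra_all (xs := [d, b, c, a]) (old := [(3, 1), (2, 0)]) (new := [(3, 2), (1, 0)])
      hN (by simp; omega) (n := 4) rfl (by decide +kernel)

theorem Opt.or_opt {N : ℕ} {col : ℕ → Bool} {s1 s2 s3 s4 : List ℕ} {p a1 b1 a2 b2 a3 b3 q : ℕ}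
    (h : Opt N col (s1 ++ s2 ++ s3 ++ s4)) (h1 : Seg s1 p a1) (h2 : Seg s2 b1 a2)
    (h3 : Seg s3 b2 a3) (h4 : Seg s4 b3 q) (h12 : col a1 = col a2) (h13 : col a1 = col a3) :
    NoImp [mkE a1 b1, mkE a2 b2, mkE a3 b3] [mkE a1 b2, mkE a2 b3, mkE a3 b1]
      (edgesOf s1 ++ edgesOf s2 ++ edgesOf s3 ++ edgesOf s4) := by
  have hA := h.1.2
  have h1' := (h1.append h2).append h3
  have h2' := (h1.append h3).append h2
  rw [Alt.append_iff h1' h4, Alt.append_iff (h1.append h2) h3, Alt.append_iff h1 h2] at hA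
  obtain ⟨⟨⟨hA1, hA2, e1⟩, hA3, e2⟩, hA4, e3⟩ := hA
  refine h.noImp (l' := s1 ++ s3 ++ s2 ++ s4) (h1'.append h4) (h2'.append h4) ?_ ?_ ?_ ?_
  · refine List.perm_iff_count.2 fun e => ?_
    simp only [List.count_append]
    ring
  · rw [Alt.append_iff h2' h4, Alt.append_iff (h1.append h3) h2, Alt.append_iff h1 h3]
    exact ⟨⟨⟨hA1, hA3, by rwa [h12]⟩, hA2, by rwa [← h13]⟩, hA4, by rwa [← h12, h13]⟩
  · rw [edgesOf_append h1' h4, edgesOf_append (h1.append h2) h3, edgesOf_append h1 h2]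
    refine List.perm_iff_count.2 fun e => ?_
    simp only [List.count_append, List.count_cons, List.count_nil]
    ring
  · rw [edgesOf_append h2' h4, edgesOf_append (h1.append h3) h2, edgesOf_append h1 h3]
    refine List.perm_iff_count.2 fun e => ?_
    simp only [List.count_append, List.count_cons, List.count_nil]
    ring

/-- The exchange of the ends of three edges of the same type, in cyclic path order. -/
def Tri (O : List (ℕ × ℕ)) (a1 b1 a2 b2 a3 b3 : ℕ) : Prop :=
  NoImp [mkE a1 b1, mkE a2 b2, mkE a3 b3] [mkE a1 b2, mkE a2 b3, mkE a3 b1] O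

theorem Tri.rotate {O : List (ℕ × ℕ)} {a1 b1 a2 b2 a3 b3 : ℕ} (h : Tri O a1 b1 a2 b2 a3 b3) :
    Tri O a2 b2 a3 b3 a1 b1 :=
  NoImp.perm h ((List.perm_append_comm (l₁ := [_]) (l₂ := [_, _])).append_right _)
    ((List.perm_append_comm (l₁ := [_]) (l₂ := [_, _])).append_right _)

theorem Tri.ne {O : List (ℕ × ℕ)} {k a2 b2 a3 b3 : ℕ} (h : Tri O 0 k a2 b2 a3 b3)
    (h2 : 0 < min a2 b2 ∧ min a2 b2 < k ∧ k < max a2 b2)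
    (h3 : 0 < min a3 b3 ∧ min a3 b3 < k ∧ k < max a3 b3) (hd : a2 ≠ b3) : b2 ≠ a3 := by
  rintro rfl
  rcases le_total a2 b2 with hab | hab <;> rcases le_total b2 b3 with hab' | hab' <;>
    simp only [hab, hab', min_eq_left, min_eq_right, max_eq_left, max_eq_right] at h2 h3
  · omega
  · rcases lt_or_gt_of_ne hd with e1 | e1
    · exact NoImp.contra_all (xs := [0, a2, b3, k, b2]) (old := [(0, 3), (1, 4), (4, 2)])
        (new := [(0, 4), (1, 2), (4, 3)]) h (by simp; omega) (n := 5) rfl (by decide +kernel)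
    · exact NoImp.contra_all (xs := [0, b3, a2, k, b2]) (old := [(0, 3), (2, 4), (4, 1)])
        (new := [(0, 4), (2, 1), (4, 3)]) h (by simp; omega) (n := 5) rfl (by decide +kernel)
  · rcases lt_or_gt_of_ne hd with e1 | e1
    · exact NoImp.contra_all (xs := [0, b2, k, a2, b3]) (old := [(0, 2), (3, 1), (1, 4)])
        (new := [(0, 1), (3, 4), (1, 2)]) h (by simp; omega) (n := 5) rfl (by decide +kernel)
    · exact NoImp.contra_all (xs := [0, b2, k, b3, a2]) (old := [(0, 2), (4, 1), (1, 3)])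
        (new := [(0, 1), (4, 3), (1, 2)]) h (by simp; omega) (n := 5) rfl (by decide +kernel)
  · omega

theorem Tri.nested {O : List (ℕ × ℕ)} {k a2 b2 a3 b3 : ℕ} (h : Tri O 0 k a2 b2 a3 b3)
    (h2 : 0 < min a2 b2 ∧ min a2 b2 < k ∧ k < max a2 b2)
    (h3 : 0 < min a3 b3 ∧ min a3 b3 < k ∧ k < max a3 b3)
    (hd : a2 ≠ a3 ∧ a2 ≠ b3 ∧ b2 ≠ b3) :
    min a3 b3 < min a2 b2 ∧ max a2 b2 < max a3 b3 := by
  replace hd : a2 ≠ a3 ∧ a2 ≠ b3 ∧ b2 ≠ a3 ∧ b2 ≠ b3 :=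
    ⟨hd.1, hd.2.1, h.ne h2 h3 hd.2.1, hd.2.2⟩
  by_contra hn
  rcases le_total a2 b2 with hab | hab <;> rcases le_total a3 b3 with hab' | hab' <;>
    simp only [hab, hab', min_eq_left, min_eq_right, max_eq_left, max_eq_right] at h2 h3 hn
  · rcases lt_or_gt_of_ne hd.1 with e1 | e1 <;> rcases lt_or_gt_of_ne hd.2.2.2 with e2 | e2
    · exact NoImp.contra_all (xs := [0, a2, a3, k, b2, b3]) (old := [(0, 3), (1, 4), (2, 5)])
        (new := [(0, 4), (1, 5), (2, 3)]) h (by simp; omega) (n := 6) rfl (by decide +kernel)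
    · exact NoImp.contra_all (xs := [0, a2, a3, k, b3, b2]) (old := [(0, 3), (1, 5), (2, 4)])
        (new := [(0, 5), (1, 4), (2, 3)]) h (by simp; omega) (n := 6) rfl (by decide +kernel)
    · omega
    · exact NoImp.contra_all (xs := [0, a3, a2, k, b3, b2]) (old := [(0, 3), (2, 5), (1, 4)])
        (new := [(0, 5), (2, 4), (1, 3)]) h (by simp; omega) (n := 6) rfl (by decide +kernel)
  · rcases lt_or_gt_of_ne hd.2.1 with e1 | e1 <;> rcases lt_or_gt_of_ne hd.2.2.1 with e2 | e2
    · exact NoImp.contra_all (xs := [0, a2, b3, k, b2, a3]) (old := [(0, 3), (1, 4), (5, 2)])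
        (new := [(0, 4), (1, 2), (5, 3)]) h (by simp; omega) (n := 6) rfl (by decide +kernel)
    · exact NoImp.contra_all (xs := [0, a2, b3, k, a3, b2]) (old := [(0, 3), (1, 5), (4, 2)])
        (new := [(0, 5), (1, 2), (4, 3)]) h (by simp; omega) (n := 6) rfl (by decide +kernel)
    · omega
    · exact NoImp.contra_all (xs := [0, b3, a2, k, a3, b2]) (old := [(0, 3), (2, 5), (4, 1)])
        (new := [(0, 5), (2, 1), (4, 3)]) h (by simp; omega) (n := 6) rfl (by decide +kernel)
  · rcases lt_or_gt_of_ne hd.2.2.1 with e1 | e1 <;> rcases lt_or_gt_of_ne hd.2.1 with e2 | e2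
    · exact NoImp.contra_all (xs := [0, b2, a3, k, a2, b3]) (old := [(0, 3), (4, 1), (2, 5)])
        (new := [(0, 1), (4, 5), (2, 3)]) h (by simp; omega) (n := 6) rfl (by decide +kernel)
    · exact NoImp.contra_all (xs := [0, b2, a3, k, b3, a2]) (old := [(0, 3), (5, 1), (2, 4)])
        (new := [(0, 1), (5, 4), (2, 3)]) h (by simp; omega) (n := 6) rfl (by decide +kernel)
    · omega
    · exact NoImp.contra_all (xs := [0, a3, b2, k, b3, a2]) (old := [(0, 3), (5, 2), (1, 4)])
        (new := [(0, 2), (5, 4), (1, 3)]) h (by simp; omega) (n := 6) rfl (by decide +kernel)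
  · rcases lt_or_gt_of_ne hd.2.2.2 with e1 | e1 <;> rcases lt_or_gt_of_ne hd.1 with e2 | e2
    · exact NoImp.contra_all (xs := [0, b2, b3, k, a2, a3]) (old := [(0, 3), (4, 1), (5, 2)])
        (new := [(0, 1), (4, 2), (5, 3)]) h (by simp; omega) (n := 6) rfl (by decide +kernel)
    · exact NoImp.contra_all (xs := [0, b2, b3, k, a3, a2]) (old := [(0, 3), (5, 1), (4, 2)])
        (new := [(0, 1), (5, 2), (4, 3)]) h (by simp; omega) (n := 6) rfl (by decide +kernel)
    · omega
    · exact NoImp.contra_all (xs := [0, b3, b2, k, a3, a2]) (old := [(0, 3), (5, 2), (4, 1)])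
        (new := [(0, 2), (5, 1), (4, 3)]) h (by simp; omega) (n := 6) rfl (by decide +kernel)

theorem Tri.exists_between {O : List (ℕ × ℕ)} {k a2 b2 a3 b3 : ℕ} (h : Tri O 0 k a2 b2 a3 b3)
    (h2 : 0 < min a2 b2 ∧ min a2 b2 < k ∧ k < max a2 b2)
    (h3 : 0 < min a3 b3 ∧ min a3 b3 < k ∧ k < max a3 b3)
    (hd : a2 ≠ a3 ∧ a2 ≠ b3 ∧ b2 ≠ b3) (hdir : (a2 < b2) ↔ (b3 < a3)) :
    ∃ o ∈ O, min a3 b3 ≤ min o.1 o.2 ∧ min o.1 o.2 ≤ min a2 b2 ∧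
      max a2 b2 ≤ max o.1 o.2 ∧ max o.1 o.2 ≤ max a3 b3 := by
  have hn := h.nested h2 h3 hd
  by_contra hcon
  push Not at hcon
  rcases le_total a2 b2 with hab | hab <;> rcases le_total a3 b3 with hab' | hab' <;>
    simp only [hab, hab', min_eq_left, min_eq_right, max_eq_left, max_eq_right] at h2 h3 hn hcon
  · omega
  · refine NoImp.contra (xs := [0, b3, a2, k, b2, a3]) (old := [(0, 3), (2, 4), (5, 1)])
        (new := [(0, 4), (2, 1), (5, 3)])
        (fun γ δ => (decide (3 ≤ γ) && decide (γ ≤ 5) && decide (9 ≤ δ) && decide (δ ≤ 11)) ||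
          (decide (3 ≤ δ) && decide (δ ≤ 5) && decide (9 ≤ γ) && decide (γ ≤ 11))) h
          (by simp; omega) (n := 6) rfl (by decide +kernel) ?_
    intro o ho γ δ hγ hδ
    have := hcon o ho
    have e1 := hγ 1 (by simp)
    have e2 := hγ 2 (by simp)
    have e4 := hγ 4 (by simp)
    have e5 := hγ 5 (by simp)
    have f1 := hδ 1 (by simp)
    have f2 := hδ 2 (by simp)
    have f4 := hδ 4 (by simp)
    have f5 := hδ 5 (by simp)
    simp at e1 e2 e4 e5 f1 f2 f4 f5
    rw [← Bool.not_eq_true]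
    simp only [Bool.or_eq_true, Bool.and_eq_true, decide_eq_true_eq]
    omega
  · refine NoImp.contra (xs := [0, a3, b2, k, a2, b3]) (old := [(0, 3), (4, 2), (1, 5)])
        (new := [(0, 2), (4, 5), (1, 3)])
        (fun γ δ => (decide (3 ≤ γ) && decide (γ ≤ 5) && decide (9 ≤ δ) && decide (δ ≤ 11)) ||
          (decide (3 ≤ δ) && decide (δ ≤ 5) && decide (9 ≤ γ) && decide (γ ≤ 11))) h
          (by simp; omega) (n := 6) rfl (by decide +kernel) ?_
    intro o ho γ δ hγ hδ
    have := hcon o ho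
    have e1 := hγ 1 (by simp)
    have e2 := hγ 2 (by simp)
    have e4 := hγ 4 (by simp)
    have e5 := hγ 5 (by simp)
    have f1 := hδ 1 (by simp)
    have f2 := hδ 2 (by simp)
    have f4 := hδ 4 (by simp)
    have f5 := hδ 5 (by simp)
    simp at e1 e2 e4 e5 f1 f2 f4 f5
    rw [← Bool.not_eq_true]
    simp only [Bool.or_eq_true, Bool.and_eq_true, decide_eq_true_eq]
    omega
  · omega

theorem exists_first_edge {P : ℕ × ℕ → Prop} {m : List ℕ} {a b : ℕ} (hm : Seg m a b)
    (h : ∃ e ∈ edgesOf m, P e) :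
    ∃ t1 t2 c d, m = t1 ++ t2 ∧ Seg t1 a c ∧ Seg t2 d b ∧ P (mkE c d) ∧ ∀ e ∈ edgesOf t1, ¬ P e := by
  induction m generalizing a with
  | nil => simp [edgesOf] at h
  | cons x t ih =>
    cases t with
    | nil => simp [edgesOf] at h
    | cons y t =>
      have hx : x = a := by simpa [Seg] using hm.1
      subst hx
      have hm' : Seg (y :: t) y b := ⟨rfl, by simpa [Seg] using hm.2⟩
      by_cases hP : P (mkE x y)
      · exact ⟨[x], y :: t, x, y, rfl, Seg.singleton x, hm', hP, by simp [edgesOf]⟩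
      · have : ∃ e ∈ edgesOf (y :: t), P e := by
          obtain ⟨e, he, hPe⟩ := h
          simp only [edgesOf, List.mem_cons] at he
          rcases he with rfl | he
          · exact absurd hPe hP
          · exact ⟨e, he, hPe⟩
        obtain ⟨t1, t2, c, d, h1, h2, h3, h4, h5⟩ := ih hm' this
        cases t1 with
        | nil => simp [Seg] at h2
        | cons z t1 =>
          have hz : z = y := by simpa [Seg] using h2.1
          subst hz
          refine ⟨x :: z :: t1, t2, c, d, by rw [h1]; rfl, ⟨rfl, by simpa [Seg] using h2.2⟩, h3, h4, ?_⟩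
          intro e he
          simp only [edgesOf, List.mem_cons] at he
          rcases he with rfl | he
          · exact hP
          · exact h5 e (by simpa [edgesOf] using he)

theorem exists_split_edge {m : List ℕ} {a b : ℕ} (hm : Seg m a b) {o : ℕ × ℕ} (h : o ∈ edgesOf m) :
    ∃ t1 t2 c d, m = t1 ++ t2 ∧ Seg t1 a c ∧ Seg t2 d b ∧ o = mkE c d := by
  obtain ⟨t1, t2, c, d, h1, h2, h3, h4, -⟩ := exists_first_edge (P := fun e => e = o) hm ⟨o, h, rfl⟩
  exact ⟨t1, t2, c, d, h1, h2, h3, h4.symm⟩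

theorem crossWith_eq_zero {L : List (ℕ × ℕ)} {o : ℕ × ℕ} :
    crossWith L o = 0 ↔ ∀ e ∈ L, crossB e o = false := by
  induction L with
  | nil => simp
  | cons e L ih => simp [ih, xc]

theorem crossWith_pos {L : List (ℕ × ℕ)} {o : ℕ × ℕ} (h : 0 < crossWith L o) :
    ∃ e ∈ L, crossB e o = true := by
  by_contra hn
  push Not at hn
  have := (crossWith_eq_zero (L := L) (o := o)).2 fun e he => by simpa using hn e he
  omega

theorem ne_of_mem_append {s t : List ℕ} (h : (s ++ t).Nodup) {a b : ℕ} (ha : a ∈ s) (hb : b ∈ t) :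
    a ≠ b := by
  rintro rfl
  exact (List.nodup_append.1 h).2.2 a ha a hb rfl

theorem cross_zero {k : ℕ} {a b : ℕ} (hk : 0 < k) (_ : a ≠ 0) (_ : b ≠ 0) :
    crossB (mkE a b) (0, k) = true ↔ 0 < min a b ∧ min a b < k ∧ k < max a b := by
  rw [crossB_mkE_left, crossB_iff]
  dsimp only
  omega

theorem side_eq {m : List ℕ} {x y : ℕ} (h : ∀ e ∈ edgesOf m, crossB e (x, y) = false) (hx : x ∉ m)
    (hy : y ∉ m) {a b : ℕ} (hm : Seg m a b) : ∀ z ∈ m, insideB (x, y) z = insideB (x, y) a := by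
  induction m generalizing a with
  | nil => simp
  | cons c t ih =>
    have hc : c = a := by simpa [Seg] using hm.1
    subst hc
    cases t with
    | nil => simp
    | cons d t =>
      have ih' := ih (a := d) (fun e he => h e (by simp [edgesOf, he])) (fun h => hx (by simp [h]))
        (fun h => hy (by simp [h])) ⟨rfl, by simpa [Seg] using hm.2⟩
      have h1 := h (mkE c d) (by simp [edgesOf])
      have hd : insideB (x, y) d = insideB (x, y) c := by
        rw [← Bool.not_eq_true, crossB_mkE_left, crossB_comm, crossB_iff] at h1
        simp only [List.mem_cons, not_or] at hx hy
        rw [Bool.eq_iff_iff]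
        simp only [insideB, Bool.or_eq_true, Bool.and_eq_true, decide_eq_true_eq]
        dsimp only at h1
        omega
      intro z hz
      rw [List.mem_cons] at hz
      rcases hz with rfl | hz
      · rfl
      · rw [ih' z hz, hd]

theorem Opt.color_eq {N : ℕ} {col : ℕ → Bool} {s1 s2 s3 : List ℕ} {p a b c d q : ℕ}
    (h : Opt N col (s1 ++ s2 ++ s3)) (h1 : Seg s1 p a) (h2 : Seg s2 b c) (h3 : Seg s3 d q)
    (hc : crossB (a, b) (c, d) = true) : col a = col c := by
  by_contra hne
  rw [h.not_cross_of_ne h1 h2 h3 hne] at hc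
  cases hc

theorem Opt.tri {N : ℕ} {col : ℕ → Bool} {s1 s2 s3 s4 : List ℕ} {p a1 b1 a2 b2 a3 b3 q : ℕ}
    (h : Opt N col (s1 ++ s2 ++ s3 ++ s4)) (h1 : Seg s1 p a1) (h2 : Seg s2 b1 a2)
    (h3 : Seg s3 b2 a3) (h4 : Seg s4 b3 q) (h12 : col a1 = col a2) (h13 : col a1 = col a3) :
    Tri (edgesOf s1 ++ edgesOf s2 ++ edgesOf s3 ++ edgesOf s4) a1 b1 a2 b2 a3 b3 :=
  h.or_opt h1 h2 h3 h4 h12 h13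

theorem Opt.crossers_after_zero {N : ℕ} {col : ℕ → Bool} {s1 s2 : List ℕ} {p k q : ℕ}
    (h : Opt N col (s1 ++ s2)) (h1 : Seg s1 p 0) (h2 : Seg s2 k q) :
    crossWith (edgesOf s2) (0, k) ≤ 1 := by
  by_contra hcon
  push Not at hcon
  have hk : 0 < k := Nat.pos_of_ne_zero fun hk =>
    ne_of_mem_append h.nodup h1.mem_right h2.mem_left hk.symm
  obtain ⟨t1, t', a2, b2, rfl, ht1, ht', hP2, hN1⟩ := exists_first_edge
    (P := fun e => crossB e (0, k) = true) h2 (crossWith_pos (by omega))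
  have hz1 : crossWith (edgesOf t1) (0, k) = 0 :=
    crossWith_eq_zero.2 fun e he => by simpa using hN1 e he
  rw [edgesOf_append ht1 ht', crossWith_append, crossWith_cons, hz1] at hcon
  have := xc_le_one (mkE a2 b2) (0, k)
  obtain ⟨t2, t3, a3, b3, rfl, ht2, ht3, hP3, hN2⟩ := exists_first_edge
    (P := fun e => crossB e (0, k) = true) ht' (crossWith_pos (by omega))
  have hnd := h.nodup
  have n0 : ∀ z ∈ t1 ++ (t2 ++ t3), (0 : ℕ) ≠ z := fun z hz => ne_of_mem_append hnd h1.mem_right hz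
  have nk : ∀ z ∈ t2 ++ t3, k ≠ z := fun z hz =>
    ne_of_mem_append (List.nodup_append.1 hnd).2.1 ht1.mem_left hz
  have n1 : ∀ y ∈ t1, ∀ z ∈ t2 ++ t3, y ≠ z := fun y hy z hz =>
    ne_of_mem_append (List.nodup_append.1 hnd).2.1 hy hz
  have n2 : ∀ y ∈ t2, ∀ z ∈ t3, y ≠ z := fun y hy z hz =>
    ne_of_mem_append (List.nodup_append.1 (List.nodup_append.1 hnd).2.1).2.1 hy hz
  have ma2 := ht1.mem_right
  have mb2 := ht2.mem_left
  have ma3 := ht2.mem_right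
  have mb3 := ht3.mem_left
  have za2 := (n0 a2 (by simp [ma2])).symm
  have zb2 := (n0 b2 (by simp [mb2])).symm
  have za3 := (n0 a3 (by simp [ma3])).symm
  have zb3 := (n0 b3 (by simp [mb3])).symm
  rw [cross_zero hk za2 zb2] at hP2
  rw [cross_zero hk za3 zb3] at hP3
  have hd : a2 ≠ a3 ∧ a2 ≠ b3 ∧ b2 ≠ b3 :=
    ⟨n1 _ ma2 _ (by simp [ma3]), n1 _ ma2 _ (by simp [mb3]), n2 _ mb2 _ mb3⟩
  have hside := side_eq (fun e he => by simpa using hN2 e he)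
    (fun h => n0 0 (by simp [h]) rfl) (fun h => nk k (by simp [h]) rfl) ht2 a3 ma3
  have hdir : a2 < b2 ↔ b3 < a3 := by
    have e1 := nk b2 (by simp [mb2])
    have e2 := nk a3 (by simp [ma3])
    rw [Bool.eq_iff_iff] at hside
    simp only [insideB, Bool.or_eq_true, Bool.and_eq_true, decide_eq_true_eq] at hside
    omega
  have c02 : crossB (0, k) (a2, b2) = true := by
    rw [crossB_comm, ← crossB_mkE_left, cross_zero hk za2 zb2]; exact hP2
  have c03 : crossB (0, k) (a3, b3) = true := by
    rw [crossB_comm, ← crossB_mkE_left, cross_zero hk za3 zb3]; exact hP3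
  have col2 : col 0 = col a2 :=
    Opt.color_eq (s1 := s1) (s2 := t1) (s3 := t2 ++ t3) (by simpa using h) h1 ht1 (ht2.append ht3) c02
  have col3 : col 0 = col a3 :=
    Opt.color_eq (s1 := s1) (s2 := t1 ++ t2) (s3 := t3) (by simpa using h) h1 (ht1.append ht2) ht3 c03
  have hT : Tri (edgesOf s1 ++ edgesOf t1 ++ edgesOf t2 ++ edgesOf t3) 0 k a2 b2 a3 b3 :=
    Opt.tri (by simpa using h) h1 ht1 ht2 ht3 col2 col3
  obtain ⟨o, hoO, ho1, ho2, ho3, ho4⟩ := hT.exists_between hP2 hP3 hd hdir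
  have hok : crossB o (0, k) = true := by
    rw [crossB_iff]
    have e1 := hP2.2.1
    have e2 := hP3.1
    omega
  simp only [List.mem_append] at hoO
  rcases hoO with ((hoO | hoO) | hoO) | hoO
  · obtain ⟨r1, r2, c, d, rfl, hr1, hr2, rfl⟩ := exists_split_edge h1 hoO
    have zc : c ≠ 0 := by
      have hnd' : ((r1 ++ r2)).Nodup := (List.nodup_append.1 hnd).1
      exact ne_of_mem_append hnd' hr1.mem_right hr2.mem_right
    have zd : d ≠ 0 := by
      rintro rfl
      rw [crossB_mkE_left, crossB_iff] at hok; dsimp only at hok; omega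
    have nd : ∀ y ∈ r1 ++ r2, ∀ z ∈ t1 ++ (t2 ++ t3), y ≠ z := fun y hy z hz =>
      ne_of_mem_append hnd hy hz
    have hc0 : crossB (c, d) (0, k) = true := by rwa [crossB_mkE_left] at hok
    have colc : col c = col 0 :=
      Opt.color_eq (s1 := r1) (s2 := r2) (s3 := t1 ++ t2 ++ t3) (by simpa using h) hr1 hr2
        ((ht1.append ht2).append ht3) hc0
    have T3 := (Opt.tri (s1 := r1) (s2 := r2) (s3 := t1 ++ t2) (s4 := t3) (by simpa using h) hr1 hr2
      (ht1.append ht2) ht3 colc (colc.trans col3)).rotate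
    rw [cross_zero hk zc zd] at hok
    have hn := T3.nested hP3 hok ⟨(nd c (by simp [hr1.mem_right]) a3 (by simp [ma3])).symm,
      (nd d (by simp [hr2.mem_left]) a3 (by simp [ma3])).symm,
      (nd d (by simp [hr2.mem_left]) b3 (by simp [mb3])).symm⟩
    rcases mkE_cases c d with e | e <;> rw [e] at ho1 <;> dsimp only at ho1 <;> omega
  · exact hN1 o hoO hok
  · exact hN2 o hoO hok
  · obtain ⟨r1, r2, c, d, rfl, hr1, hr2, rfl⟩ := exists_split_edge ht3 hoO
    have mc := hr1.mem_right
    have md := hr2.mem_left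
    have zc : c ≠ 0 := (n0 c (by simp [mc])).symm
    have zd : d ≠ 0 := (n0 d (by simp [md])).symm
    have hc0 : crossB (0, k) (c, d) = true := by rwa [crossB_mkE_left, crossB_comm] at hok
    have colc : col 0 = col c :=
      Opt.color_eq (s1 := s1) (s2 := t1 ++ t2 ++ r1) (s3 := r2) (by simpa using h) h1
        ((ht1.append ht2).append hr1) hr2 hc0
    have T3 := Opt.tri (s1 := s1) (s2 := t1 ++ t2) (s3 := r1) (s4 := r2) (by simpa using h) h1
      (ht1.append ht2) hr1 hr2 col3 colc
    rw [cross_zero hk zc zd] at hok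
    have hnr : (r1 ++ r2).Nodup :=
      (List.nodup_append.1 (List.nodup_append.1 (List.nodup_append.1 hnd).2.1).2.1).2.1
    have hn := T3.nested hP3 hok ⟨n2 _ ma3 _ (by simp [mc]), n2 _ ma3 _ (by simp [md]),
      ne_of_mem_append hnr hr1.mem_left md⟩
    rcases mkE_cases c d with e | e <;> rw [e] at ho1 <;> dsimp only at ho1 <;> omega

theorem Opt.crossers_after {N : ℕ} {col : ℕ → Bool} {s1 s2 : List ℕ} {p u v q : ℕ}
    (h : Opt N col (s1 ++ s2)) (h1 : Seg s1 p u) (h2 : Seg s2 v q) :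
    crossWith (edgesOf s2) (u, v) ≤ 1 := by
  have hu : u < N := h.lt (by simp [h1.mem_right])
  have hv : v < N := h.lt (by simp [h2.mem_left])
  obtain ⟨σ, τ, hD, ρ, hρ, hρ0⟩ := Dih.exists_rot (Dih.id (N := N)) u hu
  have hσ : σ u = 0 := (hρ u).trans hρ0
  have hR := hD.relabel
  have h' := hR.opt h
  rw [List.map_append] at h'
  have h1' := h1.map σ
  rw [hσ] at h1'
  have := h'.crossers_after_zero h1' (h2.map σ)
  rw [← hσ, hR.crossWith_edgesOf (fun o ho => h.lt (by simp [ho])) hu hv] at this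
  exact this

theorem Opt.crossers_before {N : ℕ} {col : ℕ → Bool} {s1 s2 : List ℕ} {p u v q : ℕ}
    (h : Opt N col (s1 ++ s2)) (h1 : Seg s1 p u) (h2 : Seg s2 v q) :
    crossWith (edgesOf s1) (u, v) ≤ 1 := by
  have h' := h.reverse
  rw [List.reverse_append] at h'
  have := h'.crossers_after h2.reverse h1.reverse
  rw [edgesOf_reverse, crossWith_perm (List.reverse_perm _)] at this
  have e : crossWith (edgesOf s1) (u, v) = crossWith (edgesOf s1) (v, u) := by
    unfold crossWith
    congr 2
    funext a
    rw [xc_comm, xc_comm a, xc, xc, crossB_swap]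
  rwa [e]

/-- Around the edge from `0` to `k`, there is exactly one crossing edge before it in the path, and
exactly one after it. -/
structure Around (N : ℕ) (col : ℕ → Bool) (t1 t2 t3 t4 : List ℕ) (p a b k c d q : ℕ) : Prop where
  opt : Opt N col (t1 ++ t2 ++ t3 ++ t4)
  s1 : Seg t1 p a
  s2 : Seg t2 b 0
  s3 : Seg t3 k c
  s4 : Seg t4 d q
  z1 : ∀ e ∈ edgesOf t1, crossB e (0, k) = false
  z2 : ∀ e ∈ edgesOf t2, crossB e (0, k) = false
  z3 : ∀ e ∈ edgesOf t3, crossB e (0, k) = false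
  z4 : ∀ e ∈ edgesOf t4, crossB e (0, k) = false
  colf : col 0 = col a
  colg : col 0 = col c

/-- The normalized situation around a doubly crossed edge. -/
structure Hexagon (N : ℕ) (col : ℕ → Bool) (t1 t2 t3 t4 : List ℕ) (p a b k c d q : ℕ) : Prop
    extends Around N col t1 t2 t3 t4 p a b k c d q where
  pos : 0 < a
  hac : a < c
  hck : c < k
  hkd : k < d
  hdb : d < b

theorem crossWith_swap (L : List (ℕ × ℕ)) (u v : ℕ) : crossWith L (u, v) = crossWith L (v, u) := by
  unfold crossWith
  congr 2
  funext a
  rw [xc_comm, xc_comm a, xc, xc, crossB_swap]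

theorem Opt.exists_around {N : ℕ} {col : ℕ → Bool} {s1 s2 : List ℕ} {p k q : ℕ}
    (h : Opt N col (s1 ++ s2)) (h1 : Seg s1 p 0) (h2 : Seg s2 k q)
    (h3 : 2 ≤ crossWith (edgesOf (s1 ++ s2)) (0, k)) :
    ∃ t1 t2 t3 t4 a b c d, s1 = t1 ++ t2 ∧ s2 = t3 ++ t4 ∧ Around N col t1 t2 t3 t4 p a b k c d q ∧
      min a b < min c d ∧ max c d < max a b ∧ 0 < min a b ∧ min c d < k ∧ k < max c d ∧
      (a < b ↔ c < d) := by
  have ha := h.crossers_after h1 h2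
  have hb := h.crossers_before h1 h2
  have hk : 0 < k := Nat.pos_of_ne_zero fun hk =>
    ne_of_mem_append h.nodup h1.mem_right h2.mem_left hk.symm
  have h00 : xc (mkE 0 k) (0, k) = 0 := by
    rw [xc_eq_zero, crossB_mkE_left, ← Bool.not_eq_true, crossB_iff]; dsimp only; omega
  rw [edgesOf_append h1 h2, crossWith_append, crossWith_cons, h00] at h3
  have hnd := h.nodup
  obtain ⟨t1, t2, a, b, rfl, ht1, ht2, hPf, hN1⟩ := exists_first_edge
    (P := fun e => crossB e (0, k) = true) h1 (crossWith_pos (by omega))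
  obtain ⟨t3, t4, c, d, rfl, ht3, ht4, hPg, hN3⟩ := exists_first_edge
    (P := fun e => crossB e (0, k) = true) h2 (crossWith_pos (by omega))
  have hz2 : ∀ e ∈ edgesOf t2, crossB e (0, k) = false := by
    rw [← crossWith_eq_zero]
    rw [edgesOf_append ht1 ht2, crossWith_append, crossWith_cons, xc_eq_one.2 hPf] at hb
    omega
  have hz4 : ∀ e ∈ edgesOf t4, crossB e (0, k) = false := by
    rw [← crossWith_eq_zero]
    rw [edgesOf_append ht3 ht4, crossWith_append, crossWith_cons, xc_eq_one.2 hPg] at ha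
    omega
  have hnd12 := (List.nodup_append.1 hnd).1
  have nd : ∀ y ∈ t1 ++ t2, ∀ z ∈ t3 ++ t4, y ≠ z := fun y hy z hz => ne_of_mem_append hnd hy hz
  have ma := ht1.mem_right
  have mb := ht2.mem_left
  have m0 := ht2.mem_right
  have mc := ht3.mem_right
  have md := ht4.mem_left
  have za : a ≠ 0 := ne_of_mem_append hnd12 ma m0
  have zc : c ≠ 0 := (nd 0 (by simp [m0]) c (by simp [mc])).symm
  have zd : d ≠ 0 := (nd 0 (by simp [m0]) d (by simp [md])).symm
  have zb : b ≠ 0 := by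
    rintro rfl
    rw [crossB_mkE_left, crossB_iff] at hPf; dsimp only at hPf; omega
  have cf : crossB (a, b) (0, k) = true := by rwa [crossB_mkE_left] at hPf
  have cg : crossB (0, k) (c, d) = true := by rwa [crossB_mkE_left, crossB_comm] at hPg
  have colf : col a = col 0 := Opt.color_eq (s1 := t1) (s2 := t2) (s3 := t3 ++ t4) h ht1 ht2
    (ht3.append ht4) cf
  have colg : col 0 = col c := Opt.color_eq (s1 := t1 ++ t2) (s2 := t3) (s3 := t4) (by simpa using h)
    (ht1.append ht2) ht3 ht4 cg
  have h' : Opt N col (t1 ++ t2 ++ t3 ++ t4) := by simpa using h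
  have hT := (Opt.tri h' ht1 ht2 ht3 ht4 colf (colf.trans colg)).rotate
  rw [cross_zero hk za zb] at hPf
  rw [cross_zero hk zc zd] at hPg
  have hne : c ≠ a ∧ c ≠ b ∧ d ≠ b := ⟨(nd a (by simp [ma]) c (by simp [mc])).symm,
    (nd b (by simp [mb]) c (by simp [mc])).symm, (nd b (by simp [mb]) d (by simp [md])).symm⟩
  have hn := hT.nested hPg hPf hne
  refine ⟨t1, t2, t3, t4, a, b, c, d, rfl, rfl, ⟨h', ht1, ht2, ht3, ht4, fun e he => by
    simpa using hN1 e he, hz2, fun e he => by simpa using hN3 e he, hz4, colf.symm, colg⟩,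
    hn.1, hn.2, hPf.1, hPg.2.1, hPg.2.2, ?_⟩
  by_contra hdir
  obtain ⟨o, hoO, ho1, ho2, ho3, ho4⟩ := hT.exists_between hPg hPf hne
    (by have := hne; have : a ≠ b := fun e => by subst e; omega
        have : c ≠ d := fun e => by subst e; omega
        omega)
  have hok : crossB o (0, k) = true := by
    rw [crossB_iff]
    have e1 := hPg.2.1
    have e2 := hPf.1
    omega
  simp only [List.mem_append] at hoO
  rcases hoO with ((hoO | hoO) | hoO) | hoO
  · exact hN1 o hoO hok
  · rw [hz2 o hoO] at hok; cases hok
  · exact hN3 o hoO hok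
  · rw [hz4 o hoO] at hok; cases hok

theorem Opt.exists_hexagon {N : ℕ} {col : ℕ → Bool} {s1 s2 : List ℕ} {p u v q : ℕ}
    (h : Opt N col (s1 ++ s2)) (h1 : Seg s1 p u) (h2 : Seg s2 v q)
    (h3 : 2 ≤ crossWith (edgesOf (s1 ++ s2)) (u, v)) :
    ∃ σ τ t1 t2 t3 t4 p' a b k c d q', Dih N σ τ ∧ s1.map σ = t1 ++ t2 ∧ s2.map σ = t3 ++ t4 ∧
      Hexagon N (fun x => col (τ x)) t1 t2 t3 t4 p' a b k c d q' := by
  have hu : u < N := h.lt (by simp [h1.mem_right])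
  have hv : v < N := h.lt (by simp [h2.mem_left])
  obtain ⟨σ, τ, hD, ρ, hρ, hρ0⟩ := Dih.exists_rot (Dih.id (N := N)) u hu
  have hσ : σ u = 0 := (hρ u).trans hρ0
  have hR := hD.relabel
  have h' := hR.opt h
  rw [← hR.crossWith_edgesOf (fun o ho => h.lt ho) hu hv, List.map_append, hσ] at h3
  rw [List.map_append] at h'
  have h1' := h1.map σ
  rw [hσ] at h1'
  obtain ⟨t1, t2, t3, t4, a, b, c, d, e1, e2, hA, i1, i2, i3, i4, i5, i6⟩ :=
    h'.exists_around h1' (h2.map σ) h3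
  have ma : a < N := h'.lt (by simp [e1, hA.s1.mem_right])
  have mb : b < N := h'.lt (by simp [e1, hA.s2.mem_left])
  have mc : c < N := h'.lt (by simp [e2, hA.s3.mem_right])
  have md : d < N := h'.lt (by simp [e2, hA.s4.mem_left])
  have mk : σ v < N := hR.map_lt v hv
  by_cases hab : a < b
  · have hcd := i6.1 hab
    exact ⟨σ, τ, t1, t2, t3, t4, _, a, b, σ v, c, d, _, hD, e1, e2,
      hA, by omega, by omega, by omega, by omega, by omega⟩
  · have hcd : ¬ c < d := fun hcd => hab (i6.2 hcd)
    obtain ⟨f, hf0, hfp, hff, hDr, hz⟩ : ∃ f : ℕ → ℕ, f 0 = 0 ∧ (∀ x, 0 < x → f x = N - x) ∧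
        (∀ x, 0 < x → x < N → f (f x) = x) ∧ Dih N (fun x => f (σ x)) (fun x => τ (f x)) ∧
        ∀ t : List ℕ, (∀ x ∈ t, x < N) → (∀ e ∈ edgesOf t, crossB e (0, σ v) = false) →
        (∀ e ∈ edgesOf (t.map f), crossB e (0, f (σ v)) = false) := by
      have hRf := (Dih.id (N := N)).refl.relabel
      refine ⟨fun a => if a = 0 then 0 else N - a, rfl, fun x hx => if_neg (by omega), ?_, hD.refl, ?_⟩
      · intro x h0 hx
        simp only
        rw [if_neg (show ¬ x = 0 by omega), if_neg (show ¬ N - x = 0 by omega)]; omega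
      · intro t ht hz
        rw [← crossWith_eq_zero] at hz ⊢
        have := hRf.crossWith_edgesOf (a := 0) (b := σ v) ht (by omega) mk
        exact this.trans hz
    have hO := hDr.relabel.opt h
    have m1 : s1.map (fun a => f (σ a)) = t1.map f ++ t2.map f := by
      rw [show (fun a => f (σ a)) = f ∘ σ from rfl, ← List.map_map, e1, List.map_append]
    have m2 : s2.map (fun a => f (σ a)) = t3.map f ++ t4.map f := by
      rw [show (fun a => f (σ a)) = f ∘ σ from rfl, ← List.map_map, e2, List.map_append]
    have hlt : ∀ x ∈ t1 ++ t2 ++ t3 ++ t4, x < N := fun x hx => hA.opt.lt hx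
    have k0 : 0 < σ v := by omega
    have g2 := hA.s2.map f
    rw [hf0] at g2
    have ea := hfp a (by omega)
    have eb := hfp b (by omega)
    have ec := hfp c (by omega)
    have ed := hfp d (by omega)
    have ek := hfp _ k0
    refine ⟨_, _, t1.map f, t2.map f, t3.map f, t4.map f, _, f a, f b, f (σ v), f c, f d, _, hDr, m1, m2,
      ⟨?_, hA.s1.map f, g2, hA.s3.map f, hA.s4.map f,
      hz _ (fun x hx => hlt x (by simp [hx])) hA.z1, hz _ (fun x hx => hlt x (by simp [hx])) hA.z2,
      hz _ (fun x hx => hlt x (by simp [hx])) hA.z3, hz _ (fun x hx => hlt x (by simp [hx])) hA.z4,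
      ?_, ?_⟩, ?_, ?_, ?_, ?_, ?_⟩
    · rw [← m1, List.append_assoc, ← m2, ← List.map_append]; exact hO
    · show col (τ (f 0)) = col (τ (f (f a)))
      rw [hf0, hff a (by omega) ma]; exact hA.colf
    · show col (τ (f 0)) = col (τ (f (f c)))
      rw [hf0, hff c (by omega) mc]; exact hA.colg
    all_goals omega

theorem Seg.eq_singleton_or_concat {m : List ℕ} {a b : ℕ} (h : Seg m a b) :
    m = [b] ∨ ∃ m' y, m = m' ++ [b] ∧ Seg m' a y := by
  rcases List.eq_nil_or_concat m with rfl | ⟨m', z, rfl⟩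
  · simp [Seg] at h
  · rw [List.concat_eq_append] at h ⊢
    have hz : z = b := by simpa [Seg] using h.2
    subst hz
    rcases List.eq_nil_or_concat m' with rfl | ⟨m'', y, rfl⟩
    · left; rfl
    · rw [List.concat_eq_append] at h ⊢
      exact Or.inr ⟨m'' ++ [y], y, rfl, by simpa [Seg] using h.1, by simp⟩

theorem Seg.eq_singleton_or_cons {m : List ℕ} {a b : ℕ} (h : Seg m a b) :
    m = [a] ∨ ∃ m' y, m = a :: m' ∧ Seg m' y b := by
  rcases h.reverse.eq_singleton_or_concat with h1 | ⟨m', y, h1, h2⟩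
  · left
    rw [← List.reverse_reverse m, h1]; rfl
  · right
    refine ⟨m'.reverse, y, ?_, h2.reverse⟩
    rw [← List.reverse_reverse m, h1]; simp

theorem crossB_of_loc_false {xs : List ℕ} {o : ℕ × ℕ} {γ δ i j x y : ℕ}
    (hγ : Loc xs.length (fun j => xs.getD j 0) o.1 γ) (hδ : Loc xs.length (fun j => xs.getD j 0) o.2 δ)
    (hi : i < xs.length) (hj : j < xs.length) (hx : xs.getD i 0 = x) (hy : xs.getD j 0 = y)
    (h : crossB o (x, y) = false) : crossB (2 * i + 1, 2 * j + 1) (γ, δ) = false := by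
  rw [← crossB_loc hγ hδ hi hj, crossB_comm]
  rw [hx, hy]; exact h

theorem Hexagon.color {N : ℕ} {col : ℕ → Bool} {t1 t2 t3 t4 : List ℕ} {p a b k c d q : ℕ}
    (H : Hexagon N col t1 t2 t3 t4 p a b k c d q) :
    col a = col 0 ∧ col c = col 0 ∧ col k ≠ col 0 ∧ col b ≠ col 0 ∧ col d ≠ col 0 := by
  have hA := H.opt.1.2
  rw [Alt.append_iff ((H.s1.append H.s2).append H.s3) H.s4, Alt.append_iff (H.s1.append H.s2) H.s3,
    Alt.append_iff H.s1 H.s2] at hA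
  obtain ⟨⟨⟨-, -, e1⟩, -, e2⟩, -, e3⟩ := hA
  exact ⟨H.colf.symm, H.colg.symm, e2.symm, by rw [H.colf]; exact e1.symm, by rw [H.colg]; exact e3.symm⟩

set_option maxHeartbeats 1000000 in
theorem Hexagon.crossWith_next_le {N : ℕ} {col : ℕ → Bool} {t1 t2 t3 t4 : List ℕ} {p a b k c d q : ℕ}
    (H : Hexagon N col t1 t2 t3 t4 p a b k c d q) :
    crossWith (edgesOf (t1 ++ t2 ++ t3 ++ t4)) (c, d) ≤ 1 := by
  obtain ⟨ca, cc, ck, cb, cd⟩ := H.color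
  obtain ⟨⟨ho, h1, h2, h3, h4, z1, z2, z3, z4, -, -⟩, i1, i2, i3, i4, i5⟩ := H
  by_contra hcon
  have x1 : xc (mkE 0 k) (c, d) = 1 := by
    rw [xc_mkE_left, xc_eq_one, crossB_iff]; dsimp only; omega
  have x2 : xc (mkE c d) (c, d) = 0 := by
    rw [xc_mkE_left, xc_eq_zero, ← Bool.not_eq_true, crossB_iff]; dsimp only; omega
  have gb := Opt.crossers_before (s1 := t1 ++ t2 ++ t3) (s2 := t4) ho ((h1.append h2).append h3) h4
  have ga := Opt.crossers_after (s1 := t1 ++ t2 ++ t3) (s2 := t4) ho ((h1.append h2).append h3) h4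
  have fa := Opt.crossers_after (s1 := t1) (s2 := t2 ++ t3 ++ t4) (by simpa using ho) h1
    ((h2.append h3).append h4)
  rw [edgesOf_append ((h1.append h2).append h3) h4, crossWith_append, crossWith_cons, x2] at hcon
  obtain ⟨r1, r2, u, w, rfl, hr1, hr2, hP, -⟩ := exists_first_edge
    (P := fun e => crossB e (c, d) = true) h4 (crossWith_pos (by omega))
  have hA := ho.1.2
  rw [Alt.append_iff ((h1.append h2).append h3) h4, Alt.append_iff (h1.append h2) h3,
    Alt.append_iff h1 h2, Alt.append_iff hr1 hr2] at hA
  obtain ⟨⟨⟨A1, A2, -⟩, A3, -⟩, ⟨A4, A5, cuw⟩, -⟩ := hA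
  have cgh : crossB (c, d) (u, w) = true := by rwa [crossB_mkE_left, crossB_comm] at hP
  have cu : col u = col 0 := by
    rw [← cc]
    exact (Opt.color_eq (s1 := t1 ++ t2 ++ t3) (s2 := r1) (s3 := r2) (by simpa using ho)
      ((h1.append h2).append h3) hr1 hr2 cgh).symm
  have cw : col w ≠ col 0 := by rw [← cu]; exact cuw.symm
  have hb := Opt.crossers_before (s1 := t1 ++ t2 ++ t3 ++ r1) (s2 := r2) (by simpa using ho)
    (((h1.append h2).append h3).append hr1) hr2
  have zh : crossB (u, w) (0, k) = false := by
    rw [← crossB_mkE_left]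
    exact z4 _ (by rw [edgesOf_append hr1 hr2]; simp)
  have x3 : xc (mkE u w) (c, d) = 1 := xc_eq_one.2 hP
  have x4 : xc (mkE c d) (u, w) = 1 := by rw [xc_mkE_left, xc_eq_one]; exact cgh
  have x5 : xc (mkE 0 k) (a, b) = 1 := by
    rw [xc_mkE_left, xc_eq_one, crossB_iff]; dsimp only; omega
  rw [edgesOf_append (h1.append h2) h3] at gb
  rw [edgesOf_append hr1 hr2] at ga
  rw [edgesOf_append (h2.append h3) h4, edgesOf_append h2 h3, edgesOf_append hr1 hr2] at fa
  rw [edgesOf_append ((h1.append h2).append h3) hr1] at hb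
  simp only [crossWith_append, crossWith_cons, x1, x3, x4, x5] at gb ga fa hb
  have yh : xc (u, w) (a, b) = 0 := by rw [← xc_mkE_left]; omega
  have hd2 := ho.nodup
  have ne1 : ∀ y ∈ t1 ++ t2 ++ t3 ++ r1, ∀ z ∈ r2, y ≠ z := fun y hy z hz =>
    ne_of_mem_append (by simpa using hd2) hy hz
  have ne2 : ∀ y ∈ t1 ++ t2 ++ t3, ∀ z ∈ r1 ++ r2, y ≠ z := fun y hy z hz =>
    ne_of_mem_append hd2 hy hz
  have m1 := h1.mem_right
  have m2 := h2.mem_left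
  have m3 := h2.mem_right
  have m4 := h3.mem_left
  have m5 := hr2.mem_left
  have m6 := hr1.mem_right
  have w0 := ne1 0 (by simp [m3]) w m5
  have wk := ne1 k (by simp [m4]) w m5
  have wa := ne1 a (by simp [m1]) w m5
  have wb := ne1 b (by simp [m2]) w m5
  have u0 := ne2 0 (by simp [m3]) u (by simp [m6])
  have uk := ne2 k (by simp [m4]) u (by simp [m6])
  have ua := ne2 a (by simp [m1]) u (by simp [m6])
  have ub := ne2 b (by simp [m2]) u (by simp [m6])
  have hpos : (k < w ∧ w < d ∧ d < u ∧ u < b) ∨ (k < u ∧ u < d ∧ d < w ∧ w < b) ∨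
      (a < w ∧ w < c ∧ c < u ∧ u < k) ∨ (a < u ∧ u < c ∧ c < w ∧ w < k) := by
    rw [xc_eq_zero] at yh
    rw [← Bool.not_eq_true, crossB_iff] at yh zh
    rw [crossB_iff] at cgh
    dsimp only at yh zh cgh
    omega
  have p1 : (edgesOf (t1 ++ t2 ++ t3 ++ (r1 ++ r2))).Perm ([mkE a b, mkE 0 k, mkE c d, mkE u w] ++
      (edgesOf t1 ++ edgesOf t2 ++ edgesOf t3 ++ edgesOf r1 ++ edgesOf r2)) := by
    rw [edgesOf_append ((h1.append h2).append h3) h4, edgesOf_append (h1.append h2) h3,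
      edgesOf_append h1 h2, edgesOf_append hr1 hr2]
    refine List.perm_iff_count.2 fun e => ?_
    simp only [List.count_append, List.count_cons, List.count_nil]
    ring
  have hz : ∀ o ∈ edgesOf t1 ++ edgesOf t2 ++ edgesOf t3 ++ edgesOf r1 ++ edgesOf r2,
      crossB o (0, k) = false ∧ crossB o (c, d) = false ∧
      (crossB o (a, b) = false ∨ crossB o (u, w) = false) := by
    have key : ∀ (L : List (ℕ × ℕ)) (e : ℕ × ℕ), crossWith L e = 0 → ∀ o ∈ L, crossB o e = false :=
      fun L e h => crossWith_eq_zero.1 h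
    intro o ho
    simp only [List.mem_append] at ho
    have z4' : ∀ o, o ∈ edgesOf r1 ∨ o ∈ edgesOf r2 → crossB o (0, k) = false := fun o h =>
      z4 o (by rw [edgesOf_append hr1 hr2]; rcases h with h | h <;> simp [h])
    rcases ho with (((ho | ho) | ho) | ho) | ho
    · exact ⟨z1 o ho, key (edgesOf (t1 ++ t2)) _ (by omega) o (by
        rw [edgesOf_append h1 h2]; simp [ho]), Or.inr (key (edgesOf (t1 ++ t2 ++ t3)) _ (by omega) o (by
        rw [edgesOf_append (h1.append h2) h3, edgesOf_append h1 h2]; simp [ho]))⟩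
    · exact ⟨z2 o ho, key (edgesOf (t1 ++ t2)) _ (by omega) o (by
        rw [edgesOf_append h1 h2]; simp [ho]), Or.inl (key _ _ (by omega) o ho)⟩
    · exact ⟨z3 o ho, key _ _ (by omega) o ho, Or.inl (key _ _ (by omega) o ho)⟩
    · exact ⟨z4' o (Or.inl ho), key _ _ (by omega) o ho, Or.inl (key _ _ (by omega) o ho)⟩
    · exact ⟨z4' o (Or.inr ho), key _ _ (by omega) o ho, Or.inl (key _ _ (by omega) o ho)⟩
  have hT : NoImp [mkE a b, mkE 0 k, mkE c d, mkE u w] [mkE a b, mkE 0 d, mkE u k, mkE c w]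
      (edgesOf t1 ++ edgesOf t2 ++ edgesOf t3 ++ edgesOf r1 ++ edgesOf r2) := by
    have g1 := (h1.append h2).append hr1
    have g := (g1.append h3).append hr2
    refine ho.noImp (((h1.append h2).append h3).append h4) g ?_ ?_ p1 ?_
    · refine List.perm_iff_count.2 fun e => ?_
      simp only [List.count_append]
      ring
    · rw [Alt.append_iff (g1.append h3) hr2, Alt.append_iff g1 h3, Alt.append_iff (h1.append h2) hr1,
        Alt.append_iff h1 h2]
      exact ⟨⟨⟨⟨A1, A2, by rw [ca]; exact cb.symm⟩, A4, cd.symm⟩, A3, by rw [cu]; exact ck.symm⟩, A5,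
        by rw [cc]; exact cw.symm⟩
    · rw [edgesOf_append (g1.append h3) hr2, edgesOf_append g1 h3, edgesOf_append (h1.append h2) hr1,
        edgesOf_append h1 h2]
      refine List.perm_iff_count.2 fun e => ?_
      simp only [List.count_append, List.count_cons, List.count_nil]
      ring
  rcases hpos with h | h | h | h
  · have hT' : NoImp [mkE a b, mkE 0 k, mkE c d, mkE u w] [mkE a k, mkE c d, mkE u b, mkE 0 w]
        (edgesOf t1 ++ edgesOf t2 ++ edgesOf t3 ++ edgesOf r1 ++ edgesOf r2) := by
      have g1 := (h1.append h3).append hr1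
      have g := (g1.append h2).append hr2
      refine ho.noImp (((h1.append h2).append h3).append h4) g ?_ ?_ p1 ?_
      · refine List.perm_iff_count.2 fun e => ?_
        simp only [List.count_append]
        ring
      · rw [Alt.append_iff (g1.append h2) hr2, Alt.append_iff g1 h2, Alt.append_iff (h1.append h3) hr1,
          Alt.append_iff h1 h3]
        exact ⟨⟨⟨⟨A1, A3, by rw [ca]; exact ck.symm⟩, A4, by rw [cc]; exact cd.symm⟩, A2,
          by rw [cu]; exact cb.symm⟩, A5, cw.symm⟩
      · rw [edgesOf_append (g1.append h2) hr2, edgesOf_append g1 h2, edgesOf_append (h1.append h3) hr1,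
          edgesOf_append h1 h3]
        refine List.perm_iff_count.2 fun e => ?_
        simp only [List.count_append, List.count_cons, List.count_nil]
        ring
    refine NoImp.contra (xs := [0, a, c, k, w, d, u, b]) (old := [(1, 7), (0, 3), (2, 5), (6, 4)])
      (new := [(1, 3), (2, 5), (6, 7), (0, 4)])
      (fun γ δ => (γ == 0) || (δ == 0) || crossB (1, 7) (γ, δ) || crossB (5, 11) (γ, δ) ||
        (crossB (3, 15) (γ, δ) && crossB (13, 9) (γ, δ))) hT' (by simp; omega)
      (n := 8) rfl (by decide +kernel) ?_
    intro o ho γ δ hγ hδ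
    obtain ⟨y1, y2, y3⟩ := hz o ho
    have n1 := (hγ 0 (by simp)).1
    have n2 := (hδ 0 (by simp)).1
    simp at n1 n2
    have b1 := crossB_of_loc_false (i := 0) (j := 3) hγ hδ (by simp) (by simp) rfl rfl y1
    have b2 := crossB_of_loc_false (i := 2) (j := 5) hγ hδ (by simp) (by simp) rfl rfl y2
    rw [b1, b2]
    rcases y3 with y3 | y3
    · rw [crossB_of_loc_false (i := 1) (j := 7) hγ hδ (by simp) (by simp) rfl rfl y3]
      simp; omega
    · rw [crossB_of_loc_false (i := 6) (j := 4) hγ hδ (by simp) (by simp) rfl rfl y3]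
      simp; omega
  · refine NoImp.contra (xs := [0, a, c, k, u, d, w, b]) (old := [(1, 7), (0, 3), (2, 5), (4, 6)])
      (new := [(1, 7), (0, 5), (4, 3), (2, 6)])
      (fun γ δ => (γ == 0) || (δ == 0) || crossB (1, 7) (γ, δ) || crossB (5, 11) (γ, δ))
      hT (by simp; omega) (n := 8) rfl (by decide +kernel) ?_
    intro o ho γ δ hγ hδ
    obtain ⟨y1, y2, -⟩ := hz o ho
    have n1 := (hγ 0 (by simp)).1
    have n2 := (hδ 0 (by simp)).1
    simp at n1 n2
    have b1 := crossB_of_loc_false (i := 0) (j := 3) hγ hδ (by simp) (by simp) rfl rfl y1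
    have b2 := crossB_of_loc_false (i := 2) (j := 5) hγ hδ (by simp) (by simp) rfl rfl y2
    rw [b1, b2]
    simp; omega
  · refine NoImp.contra (xs := [0, a, w, c, u, k, d, b]) (old := [(1, 7), (0, 5), (3, 6), (4, 2)])
      (new := [(1, 7), (0, 6), (4, 5), (3, 2)])
      (fun γ δ => (γ == 0) || (δ == 0) || crossB (1, 11) (γ, δ) || crossB (7, 13) (γ, δ))
      hT (by simp; omega) (n := 8) rfl (by decide +kernel) ?_
    intro o ho γ δ hγ hδ
    obtain ⟨y1, y2, -⟩ := hz o ho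
    have n1 := (hγ 0 (by simp)).1
    have n2 := (hδ 0 (by simp)).1
    simp at n1 n2
    have b1 := crossB_of_loc_false (i := 0) (j := 5) hγ hδ (by simp) (by simp) rfl rfl y1
    have b2 := crossB_of_loc_false (i := 3) (j := 6) hγ hδ (by simp) (by simp) rfl rfl y2
    rw [b1, b2]
    simp; omega
  · refine NoImp.contra (xs := [0, a, u, c, w, k, d, b]) (old := [(1, 7), (0, 5), (3, 6), (2, 4)])
      (new := [(1, 7), (0, 6), (2, 5), (3, 4)])
      (fun γ δ => (γ == 0) || (δ == 0) || crossB (1, 11) (γ, δ) || crossB (7, 13) (γ, δ))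
      hT (by simp; omega) (n := 8) rfl (by decide +kernel) ?_
    intro o ho γ δ hγ hδ
    obtain ⟨y1, y2, -⟩ := hz o ho
    have n1 := (hγ 0 (by simp)).1
    have n2 := (hδ 0 (by simp)).1
    simp at n1 n2
    have b1 := crossB_of_loc_false (i := 0) (j := 5) hγ hδ (by simp) (by simp) rfl rfl y1
    have b2 := crossB_of_loc_false (i := 3) (j := 6) hγ hδ (by simp) (by simp) rfl rfl y2
    rw [b1, b2]
    simp; omega

theorem Seg.unique {m : List ℕ} {a b c d : ℕ} (h : Seg m a b) (h' : Seg m c d) : a = c ∧ b = d :=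
  ⟨Option.some.inj (h.1.symm.trans h'.1), Option.some.inj (h.2.symm.trans h'.2)⟩

theorem Hexagon.crossWith_prev_le {N : ℕ} {col : ℕ → Bool} {t1 t2 t3 t4 : List ℕ} {p a b k c d q : ℕ}
    (H : Hexagon N col t1 t2 t3 t4 p a b k c d q) :
    crossWith (edgesOf (t1 ++ t2 ++ t3 ++ t4)) (a, b) ≤ 1 := by
  by_contra hcon
  have ho : Opt N col (t1 ++ (t2 ++ t3 ++ t4)) := by simpa using H.opt
  obtain ⟨σ, τ, r1, r2, r3, r4, p', a', b', k', c', d', q', hD, e1, e2, H'⟩ :=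
    ho.exists_hexagon H.s1 ((H.s2.append H.s3).append H.s4)
      (by rw [← List.append_assoc, ← List.append_assoc]; omega)
  have hR := hD.relabel
  have u1 := ((H.s1.map σ).unique (e1 ▸ H'.s1.append H'.s2)).2
  have u2 := ((((H.s2.append H.s3).append H.s4).map σ).unique (e2 ▸ H'.s3.append H'.s4)).1
  have ma := ho.lt (a := a) (by simp [H.s1.mem_right])
  have mb := ho.lt (a := b) (by simp [H.s2.mem_left])
  have m0 := ho.lt (a := 0) (by simp [H.s2.mem_right])
  have mk := ho.lt (a := k) (by simp [H.s3.mem_left])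
  have i1 := H.pos
  have i2 := H.hac
  have i3 := H.hck
  have i4 := H.hkd
  have i5 := H.hdb
  have hcr : crossB (mkE (σ 0) (σ k)) (0, k') = true := by
    have h := hR.cross 0 m0 k mk a ma b mb
    rw [u1, u2] at h
    rw [crossB_mkE_left, h, crossB_iff]
    dsimp only; omega
  have hmem : mkE (σ 0) (σ k) ∈ edgesOf (r3 ++ r4) := by
    rw [← e2, List.append_assoc, List.map_append,
      edgesOf_append (H.s2.map σ) ((H.s3.append H.s4).map σ)]
    simp
  rw [edgesOf_append H'.s3 H'.s4, List.mem_append, List.mem_cons] at hmem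
  have heq : mkE (σ 0) (σ k) = mkE c' d' := by
    rcases hmem with h | h | h
    · rw [H'.z3 _ h] at hcr; cases hcr
    · exact h
    · rw [H'.z4 _ h] at hcr; cases hcr
  have h1 := H'.crossWith_next_le
  have h2 : crossWith (edgesOf (r1 ++ r2 ++ r3 ++ r4)) (σ 0, σ k) =
      crossWith (edgesOf (t1 ++ (t2 ++ t3 ++ t4))) (0, k) := by
    rw [← hR.crossWith_edgesOf (fun o h => ho.lt h) m0 mk, List.map_append, e1, e2]
    simp
  have h3 : crossWith (edgesOf (r1 ++ r2 ++ r3 ++ r4)) (σ 0, σ k) =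
      crossWith (edgesOf (r1 ++ r2 ++ r3 ++ r4)) (c', d') := by
    rcases mkE_cases (σ 0) (σ k) with e | e <;> rcases mkE_cases c' d' with f | f <;>
      rw [e, f] at heq
    · rw [heq]
    · rw [heq, crossWith_swap]
    · rw [← heq, crossWith_swap]
    · rw [crossWith_swap, heq, crossWith_swap]
  have x1 : xc (mkE a b) (0, k) = 1 := by
    rw [xc_mkE_left, xc_eq_one, crossB_iff]; dsimp only; omega
  have x2 : xc (mkE c d) (0, k) = 1 := by
    rw [xc_mkE_left, xc_eq_one, crossB_iff]; dsimp only; omega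
  rw [edgesOf_append H.s1 ((H.s2.append H.s3).append H.s4), edgesOf_append (H.s2.append H.s3) H.s4] at h2
  simp only [crossWith_append, crossWith_cons, x1, x2] at h2
  omega

theorem Hexagon.not_cross_next {N : ℕ} {col : ℕ → Bool} {t1 t2 t3 t4 : List ℕ} {p a b k c d q : ℕ}
    (H : Hexagon N col t1 t2 t3 t4 p a b k c d q) :
    ∀ o ∈ edgesOf t1 ++ edgesOf t2 ++ edgesOf t3 ++ edgesOf t4, crossB o (c, d) = false := by
  have h := H.crossWith_next_le
  have i1 := H.pos
  have i2 := H.hac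
  have i3 := H.hck
  have i4 := H.hkd
  have x1 : xc (mkE 0 k) (c, d) = 1 := by
    rw [xc_mkE_left, xc_eq_one, crossB_iff]; dsimp only; omega
  rw [edgesOf_append ((H.s1.append H.s2).append H.s3) H.s4, edgesOf_append (H.s1.append H.s2) H.s3,
    edgesOf_append H.s1 H.s2] at h
  simp only [crossWith_append, crossWith_cons, x1] at h
  rw [← crossWith_eq_zero]
  simp only [crossWith_append]
  omega

theorem Hexagon.not_cross_prev {N : ℕ} {col : ℕ → Bool} {t1 t2 t3 t4 : List ℕ} {p a b k c d q : ℕ}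
    (H : Hexagon N col t1 t2 t3 t4 p a b k c d q) :
    ∀ o ∈ edgesOf t1 ++ edgesOf t2 ++ edgesOf t3 ++ edgesOf t4, crossB o (a, b) = false := by
  have h := H.crossWith_prev_le
  have i1 := H.pos
  have i2 := H.hac
  have i3 := H.hck
  have i4 := H.hkd
  have i5 := H.hdb
  have x1 : xc (mkE 0 k) (a, b) = 1 := by
    rw [xc_mkE_left, xc_eq_one, crossB_iff]; dsimp only; omega
  rw [edgesOf_append ((H.s1.append H.s2).append H.s3) H.s4, edgesOf_append (H.s1.append H.s2) H.s3,
    edgesOf_append H.s1 H.s2] at h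
  simp only [crossWith_append, crossWith_cons, x1] at h
  rw [← crossWith_eq_zero]
  simp only [crossWith_append]
  omega

set_option maxHeartbeats 1000000 in
theorem Hexagon.first_eq {N : ℕ} {col : ℕ → Bool} {t1 t2 t3 t4 : List ℕ} {p a b k c d q : ℕ}
    (H : Hexagon N col t1 t2 t3 t4 p a b k c d q) : t1 = [a] := by
  have hf' := H.not_cross_prev
  obtain ⟨ca, cc, ck, cb, cd⟩ := H.color
  obtain ⟨⟨ho, h1, h2, h3, h4, z1, z2, z3, z4, -, -⟩, i1, i2, i3, i4, i5⟩ := H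
  rcases h1.eq_singleton_or_concat with h | ⟨s, y, rfl, hs⟩
  · exact h
  exfalso
  have ha := Seg.singleton a
  have hA := ho.1.2
  rw [Alt.append_iff ((h1.append h2).append h3) h4, Alt.append_iff (h1.append h2) h3,
    Alt.append_iff h1 h2, Alt.append_iff hs ha] at hA
  obtain ⟨⟨⟨⟨A1, A2, cya⟩, A3, -⟩, A4, -⟩, A5, -⟩ := hA
  have cy : col y ≠ col 0 := by rw [← ca]; exact cya
  have ya : y ≠ a := fun e => cya (by rw [e])
  have y0 : y ≠ 0 := fun e => cy (by rw [e])
  have hnd := ho.nodup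
  have hnd' : (s ++ ([a] ++ t2 ++ t3 ++ t4)).Nodup := by simpa using hnd
  have ne : ∀ z ∈ [a] ++ t2 ++ t3 ++ t4, y ≠ z := fun z hz => ne_of_mem_append hnd' hs.mem_right hz
  have yk := ne k (by simp [h3.mem_left])
  have yc := ne c (by simp [h3.mem_right])
  have zya : crossB (y, a) (0, k) = false := by
    rw [← crossB_mkE_left]
    exact z1 _ (by rw [edgesOf_append hs ha]; simp)
  have hyk : y < k := by
    rw [← Bool.not_eq_true, crossB_iff] at zya
    dsimp only at zya
    omega
  have hlt : y < a ∨ (a < y ∧ y < c) ∨ c < y := by omega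
  have p1 : (edgesOf (s ++ [a] ++ t2 ++ t3 ++ t4)).Perm
      ([mkE y a, mkE a b, mkE 0 k, mkE c d] ++ (edgesOf s ++ edgesOf t2 ++ edgesOf t3 ++ edgesOf t4)) := by
    rw [edgesOf_append ((h1.append h2).append h3) h4, edgesOf_append (h1.append h2) h3,
      edgesOf_append h1 h2, edgesOf_append hs ha]
    refine List.perm_iff_count.2 fun e => ?_
    simp only [List.count_append, List.count_cons, List.count_nil, edgesOf]
    ring
  have hz : ∀ o ∈ edgesOf s ++ edgesOf t2 ++ edgesOf t3 ++ edgesOf t4, crossB o (0, k) = false := by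
    intro o ho
    simp only [List.mem_append] at ho
    rcases ho with ((ho | ho) | ho) | ho
    · exact z1 o (by rw [edgesOf_append hs ha]; simp [ho])
    · exact z2 o ho
    · exact z3 o ho
    · exact z4 o ho
  have hf : ∀ o ∈ edgesOf s ++ edgesOf t2 ++ edgesOf t3 ++ edgesOf t4, crossB o (a, b) = false := by
    intro o ho
    refine hf' o ?_
    rw [edgesOf_append hs ha]
    simp only [List.mem_append, List.mem_cons] at ho ⊢
    tauto
  have hav : ∀ o ∈ edgesOf s ++ edgesOf t2 ++ edgesOf t3 ++ edgesOf t4, a ≠ o.1 ∧ a ≠ o.2 := by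
    have hnd2 : ([a] ++ (s ++ t2 ++ t3 ++ t4)).Nodup := by
      refine (List.Perm.nodup_iff ?_).1 hnd
      refine List.perm_iff_count.2 fun e => ?_
      simp only [List.count_append]
      ring
    have hne : ∀ z ∈ s ++ t2 ++ t3 ++ t4, a ≠ z := fun z hz =>
      ne_of_mem_append hnd2 (by simp) hz
    intro o ho
    have : o.1 ∈ s ++ t2 ++ t3 ++ t4 ∧ o.2 ∈ s ++ t2 ++ t3 ++ t4 := by
      simp only [List.mem_append] at ho ⊢
      rcases ho with ((ho | ho) | ho) | ho <;> have := mem_edgesOf_fst_snd ho <;> tauto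
    exact ⟨hne _ this.1, hne _ this.2⟩
  rcases hlt with hlt | ⟨hlt, hlt'⟩ | hlt
  · have g := (hs.append (h2.reverse.append ha)).append (h3.append h4)
    have hN : NoImp [mkE y a, mkE a b, mkE 0 k, mkE c d] [mkE y 0, mkE a k, mkE a b, mkE c d]
        (edgesOf s ++ edgesOf t2 ++ edgesOf t3 ++ edgesOf t4) := by
      refine ho.noImp (((h1.append h2).append h3).append h4) g ?_ ?_ p1 ?_
      · refine List.perm_iff_count.2 fun e => ?_
        simp only [List.count_append, List.count_cons, List.count_nil, List.count_reverse]
        ring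
      · rw [Alt.append_iff (hs.append (h2.reverse.append ha)) (h3.append h4),
          Alt.append_iff hs (h2.reverse.append ha), Alt.append_iff h2.reverse ha, Alt.append_iff h3 h4]
        exact ⟨⟨A1, ⟨A3.reverse, A2, by rw [ca]; exact cb⟩, cy⟩, ⟨A4, A5, by rw [cc]; exact cd.symm⟩,
          by rw [ca]; exact ck.symm⟩
      · rw [edgesOf_append (hs.append (h2.reverse.append ha)) (h3.append h4),
          edgesOf_append hs (h2.reverse.append ha), edgesOf_append h2.reverse ha, edgesOf_append h3 h4,
          edgesOf_reverse, mkE_comm b a]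
        refine List.perm_iff_count.2 fun e => ?_
        simp only [List.count_append, List.count_cons, List.count_nil, edgesOf, List.count_reverse]
        ring
    refine NoImp.contra (xs := [0, y, a, c, k, d, b]) (old := [(1, 2), (2, 6), (0, 4), (3, 5)])
      (new := [(1, 0), (2, 4), (2, 6), (3, 5)]) (fun γ δ => (γ == 0) || (δ == 0) || crossB (1, 9) (γ, δ) ||
        crossB (5, 13) (γ, δ) || (γ == 5) || (δ == 5)) hN (by simp; omega)
      (n := 7) rfl (by decide +kernel) ?_
    intro o ho γ δ hγ hδ
    have n1 := (hγ 0 (by simp)).1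
    have n2 := (hδ 0 (by simp)).1
    have n3 := hγ 2 (by simp)
    have n4 := hδ 2 (by simp)
    have n5 := hav o ho
    simp at n1 n2 n3 n4
    rw [crossB_of_loc_false (i := 0) (j := 4) hγ hδ (by simp) (by simp) rfl rfl (hz o ho),
      crossB_of_loc_false (i := 2) (j := 6) hγ hδ (by simp) (by simp) rfl rfl (hf o ho)]
    simp; omega
  · have g1 := (hs.append h3.reverse).append ha
    have g := (g1.append h2).append h4
    have hN : NoImp [mkE y a, mkE a b, mkE 0 k, mkE c d] [mkE y c, mkE k a, mkE a b, mkE 0 d]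
        (edgesOf s ++ edgesOf t2 ++ edgesOf t3 ++ edgesOf t4) := by
      refine ho.noImp (((h1.append h2).append h3).append h4) g ?_ ?_ p1 ?_
      · refine List.perm_iff_count.2 fun e => ?_
        simp only [List.count_append, List.count_cons, List.count_nil, List.count_reverse]
        ring
      · rw [Alt.append_iff (g1.append h2) h4, Alt.append_iff g1 h2,
          Alt.append_iff (hs.append h3.reverse) ha, Alt.append_iff hs h3.reverse]
        exact ⟨⟨⟨⟨A1, A4.reverse, by rw [cc]; exact cy⟩, A2, by rw [ca]; exact ck⟩, A3,
          by rw [ca]; exact cb.symm⟩, A5, cd.symm⟩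
      · rw [edgesOf_append (g1.append h2) h4, edgesOf_append g1 h2,
          edgesOf_append (hs.append h3.reverse) ha, edgesOf_append hs h3.reverse, edgesOf_reverse]
        refine List.perm_iff_count.2 fun e => ?_
        simp only [List.count_append, List.count_cons, List.count_nil, edgesOf, List.count_reverse]
        ring
    refine NoImp.contra (xs := [0, a, y, c, k, d, b]) (old := [(2, 1), (1, 6), (0, 4), (3, 5)])
      (new := [(2, 3), (4, 1), (1, 6), (0, 5)]) (fun γ δ => (γ == 0) || (δ == 0) || crossB (1, 9) (γ, δ) ||
        crossB (3, 13) (γ, δ) || (γ == 3) || (δ == 3)) hN (by simp; omega)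
      (n := 7) rfl (by decide +kernel) ?_
    intro o ho γ δ hγ hδ
    have n1 := (hγ 0 (by simp)).1
    have n2 := (hδ 0 (by simp)).1
    have n3 := hγ 1 (by simp)
    have n4 := hδ 1 (by simp)
    have n5 := hav o ho
    simp at n1 n2 n3 n4
    rw [crossB_of_loc_false (i := 0) (j := 4) hγ hδ (by simp) (by simp) rfl rfl (hz o ho),
      crossB_of_loc_false (i := 1) (j := 6) hγ hδ (by simp) (by simp) rfl rfl (hf o ho)]
    simp; omega
  · have := Opt.not_cross_of_ne (s1 := s) (s2 := [a] ++ t2 ++ t3) (s3 := t4) (by simpa using ho) hs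
      ((ha.append h2).append h3) h4 (by rw [cc]; exact cy)
    rw [← Bool.not_eq_true, crossB_iff] at this
    dsimp only at this
    omega

set_option maxHeartbeats 1000000 in
theorem Hexagon.last_eq {N : ℕ} {col : ℕ → Bool} {t1 t2 t3 t4 : List ℕ} {p a b k c d q : ℕ}
    (H : Hexagon N col t1 t2 t3 t4 p a b k c d q) : t4 = [d] := by
  have hf' := H.not_cross_next
  obtain ⟨ca, cc, ck, cb, cd⟩ := H.color
  obtain ⟨⟨ho, h1, h2, h3, h4, z1, z2, z3, z4, -, -⟩, i1, i2, i3, i4, i5⟩ := H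
  rcases h4.eq_singleton_or_cons with h | ⟨s, z, rfl, hs⟩
  · exact h
  exfalso
  have hd := Seg.singleton d
  rw [← List.singleton_append] at ho z4 h4 hf'
  have hA := ho.1.2
  rw [Alt.append_iff ((h1.append h2).append h3) h4, Alt.append_iff (h1.append h2) h3,
    Alt.append_iff h1 h2, Alt.append_iff hd hs] at hA
  obtain ⟨⟨⟨A1, A2, -⟩, A3, -⟩, ⟨A4, A5, cdz⟩, -⟩ := hA
  have cz : col z = col 0 := by
    revert cd cdz; cases col z <;> cases col d <;> cases col 0 <;> simp
  have zd : z ≠ d := fun e => cdz (by rw [e])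
  have hnd := ho.nodup
  have hnd' : ((t1 ++ t2 ++ t3 ++ [d]) ++ s).Nodup := by simpa using hnd
  have ne : ∀ y ∈ t1 ++ t2 ++ t3 ++ [d], y ≠ z := fun y hy => ne_of_mem_append hnd' hy hs.mem_left
  have z0 := ne 0 (by simp [h2.mem_right])
  have zk := ne k (by simp [h3.mem_left])
  have zb := ne b (by simp [h2.mem_left])
  have zdz : crossB (d, z) (0, k) = false := by
    rw [← crossB_mkE_left]
    exact z4 _ (by rw [edgesOf_append hd hs]; simp)
  have hkz : k < z := by
    rw [← Bool.not_eq_true, crossB_iff] at zdz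
    dsimp only at zdz
    omega
  have hlt : z < d ∨ (d < z ∧ z < b) ∨ b < z := by omega
  have p1 : (edgesOf (t1 ++ t2 ++ t3 ++ ([d] ++ s))).Perm
      ([mkE a b, mkE 0 k, mkE c d, mkE d z] ++ (edgesOf t1 ++ edgesOf t2 ++ edgesOf t3 ++ edgesOf s)) := by
    rw [edgesOf_append ((h1.append h2).append h3) h4, edgesOf_append (h1.append h2) h3,
      edgesOf_append h1 h2, edgesOf_append hd hs]
    refine List.perm_iff_count.2 fun e => ?_
    simp only [List.count_append, List.count_cons, List.count_nil, edgesOf]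
    ring
  have hz : ∀ o ∈ edgesOf t1 ++ edgesOf t2 ++ edgesOf t3 ++ edgesOf s, crossB o (0, k) = false := by
    intro o ho
    simp only [List.mem_append] at ho
    rcases ho with ((ho | ho) | ho) | ho
    · exact z1 o ho
    · exact z2 o ho
    · exact z3 o ho
    · exact z4 o (by rw [edgesOf_append hd hs]; simp [ho])
  have hf : ∀ o ∈ edgesOf t1 ++ edgesOf t2 ++ edgesOf t3 ++ edgesOf s, crossB o (c, d) = false := by
    intro o ho
    refine hf' o ?_
    rw [edgesOf_append hd hs]
    simp only [List.mem_append, List.mem_cons] at ho ⊢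
    tauto
  have hav : ∀ o ∈ edgesOf t1 ++ edgesOf t2 ++ edgesOf t3 ++ edgesOf s, d ≠ o.1 ∧ d ≠ o.2 := by
    have hnd2 : ([d] ++ (t1 ++ t2 ++ t3 ++ s)).Nodup := by
      refine (List.Perm.nodup_iff ?_).1 hnd
      refine List.perm_iff_count.2 fun e => ?_
      simp only [List.count_append]
      ring
    have hne : ∀ z ∈ t1 ++ t2 ++ t3 ++ s, d ≠ z := fun z hz =>
      ne_of_mem_append hnd2 (by simp) hz
    intro o ho
    have : o.1 ∈ t1 ++ t2 ++ t3 ++ s ∧ o.2 ∈ t1 ++ t2 ++ t3 ++ s := by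
      simp only [List.mem_append] at ho ⊢
      rcases ho with ((ho | ho) | ho) | ho <;> have := mem_edgesOf_fst_snd ho <;> tauto
    exact ⟨hne _ this.1, hne _ this.2⟩
  rcases hlt with hlt | ⟨hlt, hlt'⟩ | hlt
  · have g1 := hd.append h3.reverse
    have g := ((h1.append h2).append g1).append hs
    have hN : NoImp [mkE a b, mkE 0 k, mkE c d, mkE d z] [mkE a b, mkE 0 d, mkE d c, mkE k z]
        (edgesOf t1 ++ edgesOf t2 ++ edgesOf t3 ++ edgesOf s) := by
      refine ho.noImp (((h1.append h2).append h3).append h4) g ?_ ?_ p1 ?_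
      · refine List.perm_iff_count.2 fun e => ?_
        simp only [List.count_append, List.count_cons, List.count_nil, List.count_reverse]
        ring
      · rw [Alt.append_iff ((h1.append h2).append g1) hs,
          Alt.append_iff (h1.append h2) g1, Alt.append_iff h1 h2, Alt.append_iff hd h3.reverse]
        exact ⟨⟨⟨A1, A2, by rw [ca]; exact cb.symm⟩, ⟨A4, A3.reverse, by rw [cc]; exact cd⟩, cd.symm⟩, A5,
          by rw [cz]; exact ck⟩
      · rw [edgesOf_append ((h1.append h2).append g1) hs,
          edgesOf_append (h1.append h2) g1, edgesOf_append h1 h2, edgesOf_append hd h3.reverse,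
          edgesOf_reverse]
        refine List.perm_iff_count.2 fun e => ?_
        simp only [List.count_append, List.count_cons, List.count_nil, edgesOf, List.count_reverse]
        ring
    refine NoImp.contra (xs := [0, a, c, k, z, d, b]) (old := [(1, 6), (0, 3), (2, 5), (5, 4)])
      (new := [(1, 6), (0, 5), (5, 2), (3, 4)]) (fun γ δ => (γ == 0) || (δ == 0) || crossB (1, 7) (γ, δ) ||
        crossB (5, 11) (γ, δ) || (γ == 11) || (δ == 11)) hN (by simp; omega)
      (n := 7) rfl (by decide +kernel) ?_
    intro o ho γ δ hγ hδ
    have n1 := (hγ 0 (by simp)).1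
    have n2 := (hδ 0 (by simp)).1
    have n3 := hγ 5 (by simp)
    have n4 := hδ 5 (by simp)
    have n5 := hav o ho
    simp at n1 n2 n3 n4
    rw [crossB_of_loc_false (i := 0) (j := 3) hγ hδ (by simp) (by simp) rfl rfl (hz o ho),
      crossB_of_loc_false (i := 2) (j := 5) hγ hδ (by simp) (by simp) rfl rfl (hf o ho)]
    simp; omega
  · have g1 := (h1.append h3).append hd
    have g := (g1.append h2.reverse).append hs
    have hN : NoImp [mkE a b, mkE 0 k, mkE c d, mkE d z] [mkE a k, mkE c d, mkE d 0, mkE b z]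
        (edgesOf t1 ++ edgesOf t2 ++ edgesOf t3 ++ edgesOf s) := by
      refine ho.noImp (((h1.append h2).append h3).append h4) g ?_ ?_ p1 ?_
      · refine List.perm_iff_count.2 fun e => ?_
        simp only [List.count_append, List.count_cons, List.count_nil, List.count_reverse]
        ring
      · rw [Alt.append_iff (g1.append h2.reverse) hs, Alt.append_iff g1 h2.reverse,
          Alt.append_iff (h1.append h3) hd, Alt.append_iff h1 h3]
        exact ⟨⟨⟨⟨A1, A3, by rw [ca]; exact ck.symm⟩, A4, by rw [cc]; exact cd.symm⟩, A2.reverse,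
          cd⟩, A5, by rw [cz]; exact cb⟩
      · rw [edgesOf_append (g1.append h2.reverse) hs, edgesOf_append g1 h2.reverse,
          edgesOf_append (h1.append h3) hd, edgesOf_append h1 h3, edgesOf_reverse]
        refine List.perm_iff_count.2 fun e => ?_
        simp only [List.count_append, List.count_cons, List.count_nil, edgesOf, List.count_reverse]
        ring
    refine NoImp.contra (xs := [0, a, c, k, d, z, b]) (old := [(1, 6), (0, 3), (2, 4), (4, 5)])
      (new := [(1, 3), (2, 4), (4, 0), (6, 5)]) (fun γ δ => (γ == 0) || (δ == 0) || crossB (1, 7) (γ, δ) ||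
        crossB (5, 9) (γ, δ) || (γ == 9) || (δ == 9)) hN (by simp; omega)
      (n := 7) rfl (by decide +kernel) ?_
    intro o ho γ δ hγ hδ
    have n1 := (hγ 0 (by simp)).1
    have n2 := (hδ 0 (by simp)).1
    have n3 := hγ 4 (by simp)
    have n4 := hδ 4 (by simp)
    have n5 := hav o ho
    simp at n1 n2 n3 n4
    rw [crossB_of_loc_false (i := 0) (j := 3) hγ hδ (by simp) (by simp) rfl rfl (hz o ho),
      crossB_of_loc_false (i := 2) (j := 4) hγ hδ (by simp) (by simp) rfl rfl (hf o ho)]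
    simp; omega
  · have := Opt.not_cross_of_ne (s1 := t1) (s2 := t2 ++ t3 ++ [d]) (s3 := s) (by simpa using ho) h1
      ((h2.append h3).append hd) hs (by rw [ca]; exact cd.symm)
    rw [← Bool.not_eq_true, crossB_iff] at this
    dsimp only at this
    omega

theorem Hexagon.between {N : ℕ} {col : ℕ → Bool} {t1 t2 t3 t4 : List ℕ} {p a b k c d q : ℕ}
    (H : Hexagon N col t1 t2 t3 t4 p a b k c d q) :
    (∀ z ∈ t2, z = 0 ∨ b ≤ z) ∧ (∀ z ∈ t3, c ≤ z ∧ z ≤ k) ∧ a = 1 ∧ c = 2 ∧ d = k + 1 ∧ b = k + 2 := by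
  have hn := H.not_cross_next
  have hp := H.not_cross_prev
  have f1 := H.first_eq
  have f4 := H.last_eq
  obtain ⟨ca, cc, ck, cb, cd⟩ := H.color
  obtain ⟨⟨ho, h1, h2, h3, h4, z1, z2, z3, z4, -, -⟩, i1, i2, i3, i4, i5⟩ := H
  have hnd := ho.nodup
  subst f1 f4
  have ndis : ∀ y ∈ t2, ∀ z ∈ t3 ++ [d], y ≠ z := fun y hy z hz =>
    ne_of_mem_append (s := [a] ++ t2) (t := t3 ++ [d]) (by simpa using hnd) (by simp [hy]) hz
  have na2 : a ∉ t2 := fun h =>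
    ne_of_mem_append (s := [a]) (t := t2 ++ t3 ++ [d]) (by simpa using hnd) (by simp)
      (by simp [h] : a ∈ t2 ++ t3 ++ [d]) rfl
  have nd3 : d ∉ t3 := fun h =>
    ne_of_mem_append (s := [a] ++ t2 ++ t3) (t := [d]) (by simpa using hnd)
      (by simp [h] : d ∈ [a] ++ t2 ++ t3) (by simp) rfl
  have n0 : 0 ∉ t3 := fun h => ndis 0 h2.mem_right 0 (by simp [h]) rfl
  have nk : k ∉ t2 := fun h => ndis k h k (by simp [h3.mem_left]) rfl
  have nd : d ∉ t2 := fun h => ndis d h d (by simp) rfl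
  have nc : c ∉ t2 := fun h => ndis c h c (by simp [h3.mem_right]) rfl
  have hnd2 : t2.Nodup := ((List.nodup_append.1
    (by simpa using hnd : (([a] ++ t2) ++ (t3 ++ [d])).Nodup)).1).of_append_right
  have hnd3 : t3.Nodup := ((List.nodup_append.1
    (by simpa using hnd : (([a] ++ t2 ++ t3) ++ [d]).Nodup)).1).of_append_right
  have b2 : ∀ z ∈ t2, z = 0 ∨ b ≤ z := by
    rcases h2.eq_singleton_or_concat with h | ⟨m, y, rfl, hm⟩
    · subst h; simp
    have nb : (0 : ℕ) ∉ m := fun h => (List.nodup_append.1 hnd2).2.2 _ h _ (by simp) rfl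
    have e0 := side_eq (m := m) (x := 0) (y := k) (fun e he => z2 e (by
      rw [edgesOf_append hm (Seg.singleton 0)]; simp [he])) nb (fun h => nk (by simp [h])) hm
    have h2' := h2
    rcases h2'.eq_singleton_or_cons with h | ⟨m', y', e', hm'⟩
    · have := hm.mem_left
      rcases m with _ | ⟨x, m⟩
      · simp at this
      · simp at h
    have nb' : b ∉ m' := by
      intro h
      have := hnd2
      rw [e', List.nodup_cons] at this
      exact this.1 h
    have e1 := side_eq (m := m') (x := a) (y := b) (fun e he => hp e (by
      have : e ∈ edgesOf (b :: m') := by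
        rw [← List.singleton_append, edgesOf_append (Seg.singleton b) hm']; simp [he]
      rw [e']; simp [this]))
      (fun h => na2 (by rw [e']; simp [h])) nb' hm'
    have e1' : ∀ z ∈ m', insideB (a, b) z = false := by
      intro z hz
      rw [e1 z hz, ← e1 0 hm'.mem_right]
      simp [insideB]
    intro z hz
    by_cases hz0 : z = 0
    · exact Or.inl hz0
    right
    by_cases hzb : z = b
    · omega
    have q1 : z ∈ m := by simp at hz; tauto
    have q2 : z ∈ m' := by rw [e'] at hz; simp at hz; tauto
    have r1 := e0 z q1
    have r2 := e1' z q2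
    have r3 : insideB (0, k) b = false := by simp [insideB]; omega
    rw [r3] at r1
    have r4 : z ≠ a := fun h => na2 (h ▸ hz)
    have r5 : z ≠ k := fun h => nk (h ▸ hz)
    simp [insideB] at r1 r2
    omega
  have b3 : ∀ z ∈ t3, c ≤ z ∧ z ≤ k := by
    rcases h3.eq_singleton_or_cons with h | ⟨m', y', e', hm'⟩
    · subst h
      have := h3.2
      simp at this
      omega
    have nk' : k ∉ m' := by
      have := hnd3
      rw [e', List.nodup_cons] at this
      exact this.1
    have e0 := side_eq (m := m') (x := 0) (y := k) (fun e he => z3 e (by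
      rw [e', ← List.singleton_append, edgesOf_append (Seg.singleton k) hm']; simp [he]))
      (fun h => n0 (by rw [e']; simp [h])) nk' hm'
    have e0' : ∀ z ∈ m', insideB (0, k) z = true := by
      intro z hz
      rw [e0 z hz, ← e0 c hm'.mem_right]
      simp [insideB]; omega
    rcases h3.eq_singleton_or_concat with h | ⟨m, y, rfl, hm⟩
    · rw [h] at e'
      simp at e'
      omega
    have nc' : c ∉ m := fun h => (List.nodup_append.1 hnd3).2.2 _ h _ (by simp) rfl
    have e1 := side_eq (m := m) (x := c) (y := d) (fun e he => hn e (by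
      rw [edgesOf_append hm (Seg.singleton c)]; simp [he])) nc' (fun h => nd3 (by simp [h])) hm
    intro z hz
    by_cases hzk : z = k
    · omega
    by_cases hzc : z = c
    · omega
    have q2 : z ∈ m' := by rw [e'] at hz; simp at hz; tauto
    have q1 : z ∈ m := by simp at hz; tauto
    have r1 := e0' z q2
    have r2 := e1 z q1
    have r3 : insideB (c, d) k = true := by simp [insideB]; omega
    rw [r3] at r2
    simp [insideB] at r1 r2
    omega
  have hall : ∀ z < N, z = a ∨ (z = 0 ∨ b ≤ z) ∨ (c ≤ z ∧ z ≤ k) ∨ z = d := by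
    intro z hz
    have : z ∈ [a] ++ t2 ++ t3 ++ [d] := ho.1.1.mem_iff.2 (List.mem_range.2 hz)
    simp only [List.mem_append, List.mem_singleton] at this
    rcases this with ((h | h) | h) | h
    · exact Or.inl h
    · exact Or.inr (Or.inl (b2 z h))
    · exact Or.inr (Or.inr (Or.inl (b3 z h)))
    · exact Or.inr (Or.inr (Or.inr h))
  have hb := ho.lt (a := b) (by simp [h2.mem_left])
  refine ⟨b2, b3, ?_, ?_, ?_, ?_⟩
  · have := hall 1 (by omega); omega
  · have := hall 1 (by omega); have := hall 2 (by omega); omega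
  · have := hall (k + 1) (by omega); omega
  · have := hall (k + 1) (by omega); have := hall (k + 2) (by omega); omega

/-- An optimum path consisting of two blocks, such that the second of the three edges between the
blocks and the ends is crossed by the other two. -/
structure TwoBlocks (N : ℕ) (col : ℕ → Bool) (s2 s3 : List ℕ) (t : ℕ) : Prop where
  opt : Opt N col ([0] ++ s2 ++ s3 ++ [t])
  seg2 : Seg s2 (t + 1) (N - 1)
  seg3 : Seg s3 (t - 1) 1
  gt2 : ∀ z ∈ s2, t < z
  lt3 : ∀ z ∈ s3, 0 < z ∧ z < t
  three_le : 3 ≤ t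
  lt : t + 2 < N
  color_last : col (N - 1) = col 0
  color_one : col 1 = col 0

theorem Opt.exists_twoBlocks {N : ℕ} {col : ℕ → Bool} {s1 s2 : List ℕ} {p u v q : ℕ}
    (h : Opt N col (s1 ++ s2)) (h1 : Seg s1 p u) (h2 : Seg s2 v q)
    (h3 : 2 ≤ crossWith (edgesOf (s1 ++ s2)) (u, v)) :
    ∃ σ τ t2 t3 t, Dih N σ τ ∧ (s1 ++ s2).map σ = [0] ++ t2 ++ t3 ++ [t] ∧
      TwoBlocks N (fun x => col (τ x)) t2 t3 t := by
  obtain ⟨σ, τ, t1, t2, t3, t4, p', a, b, k, c, d, q', hD, e1, e2, H⟩ := h.exists_hexagon h1 h2 h3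
  have hD' := hD.rot
  set ρ : ℕ → ℕ := fun x => if x = 0 then N - 1 else x - 1 with hρ
  have hmap : (s1 ++ s2).map (fun a => if σ a = 0 then N - 1 else σ a - 1) =
      [0] ++ t2.map ρ ++ t3.map ρ ++ [k] := by
    have : (fun a => if σ a = 0 then N - 1 else σ a - 1) = ρ ∘ σ := rfl
    obtain ⟨-, -, b1, b2, b3, b4⟩ := H.between
    rw [this, ← List.map_map, List.map_append, e1, e2, H.first_eq, H.last_eq, b1, b3]
    simp [hρ]
  refine ⟨_, _, _, _, _, hD', hmap, ?_⟩
  have hopt := hD'.relabel.opt h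
  rw [hmap] at hopt
  obtain ⟨b2, b3, h4, h5, h6, h7⟩ := H.between
  have hb : b < N := H.opt.lt (by simp [H.s2.mem_left])
  have i3 := H.hck
  obtain ⟨c1, c2, -⟩ := H.color
  rw [h4] at c1
  rw [h5] at c2
  refine ⟨hopt, ?_, ?_, ?_, ?_, by omega, by omega, ?_, ?_⟩
  · have := H.s2.map ρ
    simp only [hρ] at this
    simpa [h7] using this
  · have := H.s3.map ρ
    simp only [hρ] at this
    rw [if_neg (by omega), if_neg (by omega), h5] at this
    exact this
  · intro z hz
    obtain ⟨y, hy, rfl⟩ := List.mem_map.1 hz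
    have := b2 y hy
    simp only [hρ]
    split_ifs <;> omega
  · intro z hz
    obtain ⟨y, hy, rfl⟩ := List.mem_map.1 hz
    have := b3 y hy
    simp only [hρ]
    split_ifs <;> omega
  · rw [if_pos (by omega), if_neg (by omega), c1]
  · rw [if_neg (by omega), if_neg (by omega), c1, c2]

theorem TwoBlocks.color {N : ℕ} {col : ℕ → Bool} {s2 s3 : List ℕ} {t : ℕ}
    (H : TwoBlocks N col s2 s3 t) : Alt col s2 ∧ Alt col s3 ∧ col 0 ≠ col (t + 1) ∧
      col (N - 1) ≠ col (t - 1) ∧ col 1 ≠ col t := by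
  have h0 := Seg.singleton 0
  have hA := H.opt.1.2
  rw [Alt.append_iff ((h0.append H.seg2).append H.seg3) (Seg.singleton t),
    Alt.append_iff (h0.append H.seg2) H.seg3, Alt.append_iff h0 H.seg2] at hA
  obtain ⟨⟨⟨-, A1, A2⟩, A3, A4⟩, -, A5⟩ := hA
  exact ⟨A1, A3, A2, A4, A5⟩

theorem TwoBlocks.le_cr {N : ℕ} {col : ℕ → Bool} {s2 s3 : List ℕ} {t : ℕ}
    (H : TwoBlocks N col s2 s3 t) :
    2 + cr s2 + cr s3 ≤ cr ([0] ++ s2 ++ s3 ++ [t]) := by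
  have h0 := Seg.singleton 0
  have i1 := H.three_le
  have i2 := H.lt
  have hp : (edgesOf ([0] ++ s2 ++ s3 ++ [t])).Perm
      ((edgesOf s2 ++ edgesOf s3) ++ [mkE (N - 1) (t - 1), mkE 0 (t + 1), mkE 1 t]) := by
    rw [edgesOf_append ((h0.append H.seg2).append H.seg3) (Seg.singleton t),
      edgesOf_append (h0.append H.seg2) H.seg3, edgesOf_append h0 H.seg2]
    refine List.perm_iff_count.2 fun e => ?_
    simp only [List.count_append, List.count_cons, List.count_nil, edgesOf]
    ring
  unfold cr
  rw [selfCross_perm hp, selfCross_append, selfCross_append]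
  have : selfCross [mkE (N - 1) (t - 1), mkE 0 (t + 1), mkE 1 t] ≥ 2 := by
    have x1 : xc (N - 1, t - 1) (0, t + 1) = 1 := by
      rw [xc_eq_one, crossB_iff]; dsimp only; omega
    have x2 : xc (N - 1, t - 1) (1, t) = 1 := by
      rw [xc_eq_one, crossB_iff]; dsimp only; omega
    have y1 : xc (0, t + 1) (N - 1, t - 1) = 1 := by rw [xc_comm]; exact x1
    have y2 : xc (1, t) (N - 1, t - 1) = 1 := by rw [xc_comm]; exact x2
    simp [selfCross, y1, y2]
  omega

theorem crossWith_le_of_checkMove {xs : List ℕ} {old new : List (ℕ × ℕ)} (hxs : xs.Pairwise (· < ·))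
    {n : ℕ} (hn : xs.length = n) (hcheck : checkMove n old new (fun _ _ => false) = true) (o : ℕ × ℕ) :
    crossWith (new.map (chordAt xs)) o ≤ crossWith (old.map (chordAt xs)) o := by
  subst hn
  simp only [checkMove, Bool.and_eq_true, List.all_eq_true, decide_eq_true_eq, List.mem_range,
    Bool.false_or] at hcheck
  obtain ⟨⟨⟨ho, hn⟩, -⟩, hc⟩ := hcheck
  obtain ⟨γ, hγ, h1⟩ := exists_loc (sorted_getD hxs) o.1
  obtain ⟨δ, hδ, h2⟩ := exists_loc (sorted_getD hxs) o.2
  have e1 := crossWith_chordAt hn h1 h2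
  have e2 := crossWith_chordAt ho h1 h2
  have := hc γ hγ δ hδ
  rw [show o = (o.1, o.2) from rfl]
  omega

theorem uncross_xc {a1 c1 a2 c2 : ℕ} (h : crossB (a1, c1) (a2, c2) = true) (o : ℕ × ℕ) :
    xc (a1, c2) o + xc (a2, c1) o ≤ xc (a1, c1) o + xc (a2, c2) o := by
  rw [crossB_iff] at h
  dsimp only at h
  rcases h with ⟨h1 | h1, h2 | h2⟩ | ⟨h1 | h1, h2 | h2⟩
  · have := crossWith_le_of_checkMove (xs := [c2, a1, a2, c1]) (old := [(1, 3), (2, 0)])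
      (new := [(1, 0), (2, 3)]) (by simp; omega) (n := 4) rfl (by decide +kernel) o
    simpa [chordAt] using this
  · have := crossWith_le_of_checkMove (xs := [a1, a2, c1, c2]) (old := [(0, 2), (1, 3)])
      (new := [(0, 3), (1, 2)]) (by simp; omega) (n := 4) rfl (by decide +kernel) o
    simpa [chordAt] using this
  · have := crossWith_le_of_checkMove (xs := [c2, c1, a2, a1]) (old := [(3, 1), (2, 0)])
      (new := [(3, 0), (2, 1)]) (by simp; omega) (n := 4) rfl (by decide +kernel) o
    simpa [chordAt] using this
  · have := crossWith_le_of_checkMove (xs := [c1, a2, a1, c2]) (old := [(2, 0), (1, 3)])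
      (new := [(2, 3), (1, 0)]) (by simp; omega) (n := 4) rfl (by decide +kernel) o
    simpa [chordAt] using this
  · have := crossWith_le_of_checkMove (xs := [a2, a1, c2, c1]) (old := [(1, 3), (0, 2)])
      (new := [(1, 2), (0, 3)]) (by simp; omega) (n := 4) rfl (by decide +kernel) o
    simpa [chordAt] using this
  · have := crossWith_le_of_checkMove (xs := [a2, c1, c2, a1]) (old := [(3, 1), (0, 2)])
      (new := [(3, 2), (0, 1)]) (by simp; omega) (n := 4) rfl (by decide +kernel) o
    simpa [chordAt] using this
  · have := crossWith_le_of_checkMove (xs := [a1, c2, c1, a2]) (old := [(0, 2), (3, 1)])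
      (new := [(0, 1), (3, 2)]) (by simp; omega) (n := 4) rfl (by decide +kernel) o
    simpa [chordAt] using this
  · have := crossWith_le_of_checkMove (xs := [c1, c2, a1, a2]) (old := [(2, 0), (3, 1)])
      (new := [(2, 1), (3, 0)]) (by simp; omega) (n := 4) rfl (by decide +kernel) o
    simpa [chordAt] using this

theorem uncross_xc_self {a1 c1 a2 c2 : ℕ} (h : crossB (a1, c1) (a2, c2) = true) :
    xc (a1, c2) (a2, c1) = 0 := by
  rw [xc_eq_zero, ← Bool.not_eq_true, crossB_iff]
  rw [crossB_iff] at h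
  dsimp only at h ⊢
  omega

theorem exists_cross_of_selfCross_pos {M : List (ℕ × ℕ)} (h : 0 < selfCross M) :
    ∃ e f O, M.Perm (e :: f :: O) ∧ crossB e f = true := by
  induction M with
  | nil => simp [selfCross] at h
  | cons e M ih =>
    by_cases hM : 0 < selfCross M
    · obtain ⟨a, b, O, hp, hc⟩ := ih hM
      refine ⟨a, b, e :: O, (hp.cons e).trans ?_, hc⟩
      refine List.perm_iff_count.2 fun x => ?_
      simp only [List.count_cons]
      ring
    · have : 0 < crossWith M e := by
        simp only [selfCross] at h
        omega
      obtain ⟨f, hf, hc⟩ := crossWith_pos this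
      refine ⟨e, f, M.erase f, (List.perm_cons_erase hf).cons e, by rw [crossB_comm]; exact hc⟩

/-- The chords of `M` have pairwise distinct ends, which are the points of the interval from `lo` to
`hi`, and all first ends have color `α` and all second ends another color. -/
structure Cov (col : ℕ → Bool) (lo hi : ℕ) (M : List (ℕ × ℕ)) (α : Bool) : Prop where
  nodup : (M.map Prod.fst ++ M.map Prod.snd).Nodup
  mem : ∀ z, z ∈ M.map Prod.fst ++ M.map Prod.snd ↔ lo ≤ z ∧ z ≤ hi
  fst : ∀ e ∈ M, col e.1 = α
  snd : ∀ e ∈ M, col e.2 ≠ α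

theorem Cov.perm {col : ℕ → Bool} {lo hi : ℕ} {M M' : List (ℕ × ℕ)} {α : Bool}
    (h : Cov col lo hi M α) (hp : M.Perm M') : Cov col lo hi M' α := by
  have h1 := (hp.map Prod.fst).append (hp.map Prod.snd)
  exact ⟨h1.nodup_iff.1 h.nodup, fun z => h1.mem_iff.symm.trans (h.mem z),
    fun e he => h.fst e (hp.mem_iff.2 he), fun e he => h.snd e (hp.mem_iff.2 he)⟩

/-- The equivalence relation generated by a list of pairs. -/
def Conn (M : List (ℕ × ℕ)) : ℕ → ℕ → Prop := Relation.EqvGen fun x y => (x, y) ∈ M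

theorem Conn.mono {M M' : List (ℕ × ℕ)} (h : ∀ x y, (x, y) ∈ M → Conn M' x y) {x y : ℕ}
    (hxy : Conn M x y) : Conn M' x y := by
  induction hxy with
  | rel x y hxy => exact h x y hxy
  | refl x => exact .refl x
  | symm x y _ ih => exact .symm _ _ ih
  | trans x y z _ _ ih1 ih2 => exact .trans _ _ _ ih1 ih2

theorem Cov.uncross {col : ℕ → Bool} {lo hi : ℕ} {M : List (ℕ × ℕ)} {α : Bool}
    (h : Cov col lo hi M α) (hM : 0 < selfCross M) :
    ∃ M' x, Cov col lo hi M' α ∧ selfCross M' + 1 ≤ selfCross M ∧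
      (∀ o, crossWith M' o ≤ crossWith M o) ∧ ∀ a b, (a, b) ∈ M → Conn (x :: M') a b := by
  obtain ⟨⟨a1, c1⟩, ⟨a2, c2⟩, O, hp, hc⟩ := exists_cross_of_selfCross_pos hM
  have h' := h.perm hp
  have hle : ∀ o, crossWith ((a1, c2) :: (a2, c1) :: O) o ≤ crossWith M o := by
    intro o
    rw [crossWith_perm hp]
    simp only [crossWith_cons]
    have := uncross_xc hc o
    omega
  refine ⟨(a1, c2) :: (a2, c1) :: O, (a1, a2), ⟨?_, ?_, ?_, ?_⟩, ?_, hle, ?_⟩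
  · refine (List.Perm.nodup_iff ?_).1 h'.nodup
    refine List.perm_iff_count.2 fun x => ?_
    simp only [List.map_cons, List.count_append, List.count_cons]
    ring
  · intro z
    rw [← h'.mem z]
    simp only [List.map_cons, List.mem_append, List.mem_cons]
    tauto
  · intro e he
    have := h'.fst
    simp only [List.mem_cons, forall_eq_or_imp] at this he
    rcases he with rfl | rfl | he
    · exact this.1
    · exact this.2.1
    · exact this.2.2 e he
  · intro e he
    have := h'.snd
    simp only [List.mem_cons, forall_eq_or_imp] at this he
    rcases he with rfl | rfl | he
    · exact this.2.1
    · exact this.1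
    · exact this.2.2 e he
  · rw [selfCross_perm hp]
    have hx := uncross_xc_self hc
    rw [← xc_eq_one] at hc
    have e1 := selfCross_append [(a1, c1), (a2, c2)] O
    have e2 := selfCross_append [(a1, c2), (a2, c1)] O
    have e3 : crossBetween [(a1, c2), (a2, c1)] O ≤ crossBetween [(a1, c1), (a2, c2)] O :=
      crossBetween_le fun o _ => by
        simp only [crossWith_cons, crossWith_nil]
        have := uncross_xc (xc_eq_one.1 hc) o
        omega
    simp only [selfCross, crossWith_cons, crossWith_nil, List.cons_append, List.nil_append] at e1 e2
    rw [xc_comm] at hc hx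
    simp only [selfCross, crossWith_cons] at *
    omega
  · intro a b hab
    have r1 : Conn ((a1, a2) :: (a1, c2) :: (a2, c1) :: O) a1 a2 := .rel _ _ (by simp)
    have r2 : Conn ((a1, a2) :: (a1, c2) :: (a2, c1) :: O) a1 c2 := .rel _ _ (by simp)
    have r3 : Conn ((a1, a2) :: (a1, c2) :: (a2, c1) :: O) a2 c1 := .rel _ _ (by simp)
    have := hp.mem_iff.1 hab
    simp only [List.mem_cons, Prod.mk.injEq] at this
    rcases this with ⟨rfl, rfl⟩ | ⟨rfl, rfl⟩ | h
    · exact .trans _ _ _ r1 r3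
    · exact .trans _ _ _ (.symm _ _ r1) r2
    · exact .rel _ _ (by simp [h])

theorem Conn.cons {M : List (ℕ × ℕ)} {x y a b : ℕ} (h : Conn ((x, y) :: M) a b) :
    Conn M a b ∨ (Conn M a x ∧ Conn M y b) ∨ (Conn M a y ∧ Conn M x b) := by
  induction h with
  | rel a b hab =>
    rcases List.mem_cons.1 hab with h | h
    · obtain ⟨rfl, rfl⟩ := Prod.mk.inj h
      exact Or.inr (Or.inl ⟨.refl _, .refl _⟩)
    · exact Or.inl (.rel _ _ h)
  | refl a => exact Or.inl (.refl a)
  | symm a b _ ih =>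
    rcases ih with h | ⟨h, h'⟩ | ⟨h, h'⟩
    · exact Or.inl (.symm _ _ h)
    · exact Or.inr (Or.inr ⟨.symm _ _ h', .symm _ _ h⟩)
    · exact Or.inr (Or.inl ⟨.symm _ _ h', .symm _ _ h⟩)
  | trans a b c _ _ ih1 ih2 =>
    rcases ih1 with h | ⟨h, h'⟩ | ⟨h, h'⟩ <;> rcases ih2 with k | ⟨k, k'⟩ | ⟨k, k'⟩
    · exact Or.inl (.trans _ _ _ h k)
    · exact Or.inr (Or.inl ⟨.trans _ _ _ h k, k'⟩)
    · exact Or.inr (Or.inr ⟨.trans _ _ _ h k, k'⟩)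
    · exact Or.inr (Or.inl ⟨h, .trans _ _ _ h' k⟩)
    · exact Or.inr (Or.inl ⟨h, k'⟩)
    · exact Or.inl (.trans _ _ _ h k')
    · exact Or.inr (Or.inr ⟨h, .trans _ _ _ h' k⟩)
    · exact Or.inl (.trans _ _ _ h k')
    · exact Or.inr (Or.inr ⟨h, k'⟩)

theorem card_le_of_conn {M T : List (ℕ × ℕ)} {D : Finset ℕ}
    (h1 : ∀ a ∈ D, ∀ b ∈ D, Conn M a b → a = b) (h2 : ∀ a ∈ D, ∀ b ∈ D, Conn (T ++ M) a b) :
    D.card ≤ T.length + 1 := by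
  induction T generalizing M D with
  | nil => exact Finset.card_le_one.2 fun a ha b hb => h1 a ha b hb (h2 a ha b hb)
  | cons e T ih =>
    obtain ⟨x, y⟩ := e
    have h3 : ((D.filter fun d => Conn M d x)).card ≤ 1 := by
      refine Finset.card_le_one.2 fun a ha b hb => ?_
      rw [Finset.mem_filter] at ha hb
      exact h1 a ha.1 b hb.1 (.trans _ _ _ ha.2 (.symm _ _ hb.2))
    have h4 : ((D.filter fun d => ¬ Conn M d x)).card ≤ T.length + 1 := by
      refine ih (M := (x, y) :: M) ?_ ?_
      · intro a ha b hb hab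
        rw [Finset.mem_filter] at ha hb
        rcases hab.cons with h | ⟨h, -⟩ | ⟨-, h⟩
        · exact h1 a ha.1 b hb.1 h
        · exact absurd h ha.2
        · exact absurd (.symm _ _ h) hb.2
      · intro a ha b hb
        rw [Finset.mem_filter] at ha hb
        refine (h2 a ha.1 b hb.1).mono fun u v huv => .rel _ _ ?_
        simp only [List.cons_append, List.mem_append, List.mem_cons] at huv ⊢
        tauto
    have h5 := Finset.card_filter_add_card_filter_not (s := D) fun d => Conn M d x
    simp only [List.length_cons]
    omega

/-- Number of pairs of consecutive positions of the same color in the interval from `lo` to `hi`. -/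
def sameAdj (col : ℕ → Bool) (lo hi : ℕ) : ℕ :=
  ((Finset.Ico lo hi).filter fun i => col i = col (i + 1)).card

theorem Conn.iff {M : List (ℕ × ℕ)} {P : ℕ → Prop} (hP : ∀ e ∈ M, P e.1 ↔ P e.2) {x y : ℕ}
    (h : Conn M x y) : P x ↔ P y := by
  induction h with
  | rel x y h => exact hP _ h
  | refl x => exact Iff.rfl
  | symm x y _ ih => exact ih.symm
  | trans x y z _ _ ih1 ih2 => exact ih1.trans ih2

section
variable {col : ℕ → Bool} {lo hi : ℕ} {M M' : List (ℕ × ℕ)} {α α' : Bool}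

theorem Cov.mem_fst (h : Cov col lo hi M α) {e : ℕ × ℕ} (he : e ∈ M) : lo ≤ e.1 ∧ e.1 ≤ hi :=
  (h.mem _).1 (List.mem_append_left _ (List.mem_map.2 ⟨e, he, rfl⟩))

theorem Cov.mem_snd (h : Cov col lo hi M α) {e : ℕ × ℕ} (he : e ∈ M) : lo ≤ e.2 ∧ e.2 ≤ hi :=
  (h.mem _).1 (List.mem_append_right _ (List.mem_map.2 ⟨e, he, rfl⟩))

theorem Cov.col_ne (h : Cov col lo hi M α) {e f : ℕ × ℕ} (he : e ∈ M) (hf : f ∈ M) : e.1 ≠ f.2 := by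
  intro hh
  have h1 := h.fst e he
  have h2 := h.snd f hf
  rw [hh] at h1
  exact h2 h1

theorem Cov.eq_of_touch (h : Cov col lo hi M α) {e f : ℕ × ℕ} (he : e ∈ M) (hf : f ∈ M)
    (hef : e.1 = f.1 ∨ e.1 = f.2 ∨ e.2 = f.1 ∨ e.2 = f.2) : e = f := by
  have h1 := List.nodup_append.1 h.nodup
  rcases hef with hh | hh | hh | hh
  · exact List.inj_on_of_nodup_map h1.1 he hf hh
  · exact absurd hh (h.col_ne he hf)
  · exact absurd hh.symm (h.col_ne hf he)
  · exact List.inj_on_of_nodup_map h1.2.1 he hf hh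

theorem Cov.exists_partner (h : Cov col lo hi M α) {z : ℕ} (hz : lo ≤ z ∧ z ≤ hi) :
    ∃ a, (z, a) ∈ M ∨ (a, z) ∈ M := by
  have := (h.mem z).2 hz
  simp only [List.mem_append, List.mem_map] at this
  rcases this with ⟨e, he, rfl⟩ | ⟨e, he, rfl⟩
  · exact ⟨e.2, Or.inl he⟩
  · exact ⟨e.1, Or.inr he⟩

theorem Cov.balance (h : Cov col lo hi M α) {P : ℕ → Prop} [DecidablePred P] (hP : ∀ e ∈ M, P e.1 ↔ P e.2) :
    ∑ z ∈ (Finset.Icc lo hi).filter P, (if col z = true then (1 : ℤ) else -1) = 0 := by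
  have hfin : (M.map Prod.fst ++ M.map Prod.snd).toFinset = Finset.Icc lo hi := by
    ext z
    rw [List.mem_toFinset, h.mem z, Finset.mem_Icc]
  rw [Finset.sum_filter, ← hfin, List.sum_toFinset _ h.nodup, List.map_append, List.sum_append,
    List.map_map, List.map_map]
  have hs := h.fst
  have ht := h.snd
  clear h hfin
  induction M with
  | nil => simp
  | cons e M ih =>
    have ih := ih (fun e he => hP e (by simp [he])) (fun e he => hs e (by simp [he]))
      (fun e he => ht e (by simp [he]))
    have h1 := hs e (by simp)
    have h2 := ht e (by simp)
    have h3 := hP e (by simp)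
    simp only [List.map_cons, List.sum_cons, Function.comp_apply, h3, h1]
    by_cases h4 : P e.2
    · simp only [h4, if_true]
      revert h2
      cases α <;> cases col e.2 <;> simp <;> linarith
    · simp only [h4, if_false]
      linarith

set_option maxHeartbeats 1000000 in
theorem Cov.closed (h : Cov col lo hi M α) (h' : Cov col lo hi M' α')
    (hc : ∀ e ∈ M, ∀ f ∈ M', crossB e f = false) (hs' : ∀ e ∈ M', ∀ f ∈ M', crossB e f = false)
    {u a b : ℕ} (hb : (u, b) ∈ M' ∨ (b, u) ∈ M') (ha : (u, a) ∈ M ∨ (a, u) ∈ M)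
    (hab : min u b ≤ a ∧ a ≤ max u b) :
    ∀ e ∈ M ++ M', (min u b ≤ e.1 ∧ e.1 ≤ max u b) ↔ (min u b ≤ e.2 ∧ e.2 ≤ max u b) := by
  have hcb : ∀ e ∈ M ++ M', crossB e (u, b) = false := by
    intro e he
    rcases List.mem_append.1 he with he | he <;> rcases hb with hb | hb
    · exact hc e he _ hb
    · rw [crossB_comm, crossB_swap, crossB_comm]; exact hc e he _ hb
    · exact hs' e he _ hb
    · rw [crossB_comm, crossB_swap, crossB_comm]; exact hs' e he _ hb
  have gen : ∀ e ∈ M ++ M', e.1 ≠ u → e.1 ≠ b → e.2 ≠ u → e.2 ≠ b →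
      ((min u b ≤ e.1 ∧ e.1 ≤ max u b) ↔ (min u b ≤ e.2 ∧ e.2 ≤ max u b)) := by
    intro e he n1 n2 n3 n4
    have := hcb e he
    rw [← Bool.not_eq_true, crossB_iff] at this
    dsimp only at this
    omega
  have hM' : ∀ e ∈ M', (min u b ≤ e.1 ∧ e.1 ≤ max u b) ↔ (min u b ≤ e.2 ∧ e.2 ≤ max u b) := by
    intro e he
    by_cases ht : e.1 = u ∨ e.1 = b ∨ e.2 = u ∨ e.2 = b
    · have : e = (u, b) ∨ e = (b, u) := by
        rcases hb with hb | hb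
        · exact Or.inl (h'.eq_of_touch he hb (by tauto))
        · exact Or.inr (h'.eq_of_touch he hb (by tauto))
      rcases this with rfl | rfl <;> simp
    · push Not at ht
      exact gen e (by simp [he]) ht.1 ht.2.1 ht.2.2.1 ht.2.2.2
  have hu : ∀ e ∈ M, (e.1 = u ∨ e.2 = u) →
      (min u b ≤ e.1 ∧ e.1 ≤ max u b) ∧ (min u b ≤ e.2 ∧ e.2 ≤ max u b) := by
    intro e he ht
    have : e = (u, a) ∨ e = (a, u) := by
      rcases ha with ha | ha
      · exact Or.inl (h.eq_of_touch he ha (by tauto))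
      · exact Or.inr (h.eq_of_touch he ha (by tauto))
    rcases this with rfl | rfl <;> simp [hab]
  intro e he
  by_contra hne
  have heM : e ∈ M := by
    rcases List.mem_append.1 he with he | he
    · exact he
    · exact absurd (hM' e he) hne
  have hne_u : ¬ (e.1 = u ∨ e.2 = u) := fun ht => hne (iff_of_true (hu e heM ht).1 (hu e heM ht).2)
  have htb : e.1 = b ∨ e.2 = b := by
    by_contra ht
    push Not at ht hne_u
    exact hne (gen e he hne_u.1 ht.1 hne_u.2 ht.2)
  have hM : ∀ f ∈ M, ((min u b ≤ f.1 ∧ f.1 ≤ max u b) ∧ f.1 ≠ b) ↔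
      ((min u b ≤ f.2 ∧ f.2 ≤ max u b) ∧ f.2 ≠ b) := by
    intro f hf
    by_cases ht : f.1 = b ∨ f.2 = b
    · have : f = e := h.eq_of_touch hf heM (by omega)
      subst this
      have n := h.col_ne hf hf
      have hbW : min u b ≤ b ∧ b ≤ max u b := ⟨min_le_right _ _, le_max_right _ _⟩
      rcases htb with htb | htb
      · have n1 : ¬ (min u b ≤ f.2 ∧ f.2 ≤ max u b) := fun hh =>
          hne (iff_of_true (htb ▸ hbW) hh)
        exact iff_of_false (fun hh => hh.2 htb) fun hh => n1 hh.1
      · have n1 : ¬ (min u b ≤ f.1 ∧ f.1 ≤ max u b) := fun hh =>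
          hne (iff_of_true hh (htb ▸ hbW))
        exact iff_of_false (fun hh => n1 hh.1) fun hh => hh.2 htb
    · by_cases hfu : f.1 = u ∨ f.2 = u
      · have := hu f hf hfu
        tauto
      · push Not at ht hfu
        have := gen f (by simp [hf]) hfu.1 ht.1 hfu.2 ht.2
        tauto
  have s1 := h'.balance (P := fun z => min u b ≤ z ∧ z ≤ max u b) hM'
  have s2 := h.balance (P := fun z => (min u b ≤ z ∧ z ≤ max u b) ∧ z ≠ b) hM
  have hbmem : lo ≤ b ∧ b ≤ hi := by
    rcases hb with hb | hb
    · exact h'.mem_snd hb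
    · exact h'.mem_fst hb
  have hins : (Finset.Icc lo hi).filter (fun z => min u b ≤ z ∧ z ≤ max u b) =
      insert b ((Finset.Icc lo hi).filter fun z => (min u b ≤ z ∧ z ≤ max u b) ∧ z ≠ b) := by
    ext z
    simp only [Finset.mem_filter, Finset.mem_insert, Finset.mem_Icc]
    by_cases hz : z = b
    · subst hz; simp; omega
    · tauto
  rw [hins, Finset.sum_insert (by simp), s2] at s1
  split_ifs at s1 <;> simp at s1

/-- The points of the interval all of whose partners are to the right. -/
def rightward (M : List (ℕ × ℕ)) (lo hi : ℕ) : Finset ℕ :=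
  (Finset.Icc lo hi).filter fun u => ∀ e ∈ M, (e.1 = u → u < e.2) ∧ (e.2 = u → u < e.1)

/-- The points of the interval all of whose partners are to the left. -/
def leftward (M : List (ℕ × ℕ)) (lo hi : ℕ) : Finset ℕ :=
  (Finset.Icc lo hi).filter fun u => ∀ e ∈ M, (e.1 = u → e.2 < u) ∧ (e.2 = u → e.1 < u)

theorem Cov.eq_of_rightward (h : Cov col lo hi M α) (h' : Cov col lo hi M' α')
    (hs : ∀ e ∈ M, ∀ f ∈ M, crossB e f = false)
    (hc : ∀ e ∈ M, ∀ f ∈ M', crossB e f = false) (hs' : ∀ e ∈ M', ∀ f ∈ M', crossB e f = false)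
    {x y : ℕ} (hx : x ∈ rightward (M ++ M') lo hi) (hy : y ∈ rightward (M ++ M') lo hi)
    (hxy : Conn (M ++ M') x y) : x = y := by
  have key : ∀ z ∈ rightward (M ++ M') lo hi, ∀ w < z, ¬ Conn (M ++ M') w z := by
    intro z hz w hw hcn
    simp only [rightward, Finset.mem_filter, Finset.mem_Icc] at hz
    obtain ⟨a, ha⟩ := h.exists_partner hz.1
    obtain ⟨b, hb⟩ := h'.exists_partner hz.1
    have za : z < a := by
      rcases ha with ha | ha
      · exact (hz.2 _ (List.mem_append_left _ ha)).1 rfl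
      · exact (hz.2 _ (List.mem_append_left _ ha)).2 rfl
    have zb : z < b := by
      rcases hb with hb | hb
      · exact (hz.2 _ (List.mem_append_right _ hb)).1 rfl
      · exact (hz.2 _ (List.mem_append_right _ hb)).2 rfl
    rcases le_total a b with hab | hab
    · have := Conn.iff (M := M ++ M') (P := fun w => min z b ≤ w ∧ w ≤ max z b)
        (h.closed h' hc hs' hb ha (by omega)) hcn
      omega
    · have hcl := h'.closed h (fun e he f hf => by rw [crossB_comm]; exact hc f hf e he) hs ha hb
        (by omega)
      have := Conn.iff (M := M ++ M') (P := fun w => min z a ≤ w ∧ w ≤ max z a)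
        (fun e he => hcl e (by simp only [List.mem_append] at he ⊢; tauto)) hcn
      omega
  rcases lt_trichotomy x y with hlt | hlt | hlt
  · exact absurd hxy (key y hy x hlt)
  · exact hlt
  · exact absurd (.symm _ _ hxy) (key x hx y hlt)

theorem Cov.eq_of_leftward (h : Cov col lo hi M α) (h' : Cov col lo hi M' α')
    (hs : ∀ e ∈ M, ∀ f ∈ M, crossB e f = false)
    (hc : ∀ e ∈ M, ∀ f ∈ M', crossB e f = false) (hs' : ∀ e ∈ M', ∀ f ∈ M', crossB e f = false)
    {x y : ℕ} (hx : x ∈ leftward (M ++ M') lo hi) (hy : y ∈ leftward (M ++ M') lo hi)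
    (hxy : Conn (M ++ M') x y) : x = y := by
  have key : ∀ z ∈ leftward (M ++ M') lo hi, ∀ w, z < w → ¬ Conn (M ++ M') w z := by
    intro z hz w hw hcn
    simp only [leftward, Finset.mem_filter, Finset.mem_Icc] at hz
    obtain ⟨a, ha⟩ := h.exists_partner hz.1
    obtain ⟨b, hb⟩ := h'.exists_partner hz.1
    have za : a < z := by
      rcases ha with ha | ha
      · exact (hz.2 _ (List.mem_append_left _ ha)).1 rfl
      · exact (hz.2 _ (List.mem_append_left _ ha)).2 rfl
    have zb : b < z := by
      rcases hb with hb | hb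
      · exact (hz.2 _ (List.mem_append_right _ hb)).1 rfl
      · exact (hz.2 _ (List.mem_append_right _ hb)).2 rfl
    rcases le_total b a with hab | hab
    · have := Conn.iff (M := M ++ M') (P := fun w => min z b ≤ w ∧ w ≤ max z b)
        (h.closed h' hc hs' hb ha (by omega)) hcn
      omega
    · have hcl := h'.closed h (fun e he f hf => by rw [crossB_comm]; exact hc f hf e he) hs ha hb
        (by omega)
      have := Conn.iff (M := M ++ M') (P := fun w => min z a ≤ w ∧ w ≤ max z a)
        (fun e he => hcl e (by simp only [List.mem_append] at he ⊢; tauto)) hcn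
      omega
  rcases lt_trichotomy x y with hlt | hlt | hlt
  · exact absurd (.symm _ _ hxy) (key x hx y hlt)
  · exact hlt
  · exact absurd hxy (key y hy x hlt)

theorem sameAdj_le_card (hle : lo ≤ hi) (h : Cov col lo hi M α) (h' : Cov col lo hi M' α')
    (hcr : ∀ e ∈ M ++ M', ∀ f ∈ M ++ M', crossB e f = false) :
    sameAdj col lo hi + 2 ≤ (rightward (M ++ M') lo hi).card + (leftward (M ++ M') lo hi).card := by
  have hmem : ∀ e ∈ M ++ M', (lo ≤ e.1 ∧ e.1 ≤ hi) ∧ (lo ≤ e.2 ∧ e.2 ≤ hi) ∧ col e.1 ≠ col e.2 := by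
    intro e he
    rcases List.mem_append.1 he with he | he
    · exact ⟨h.mem_fst he, h.mem_snd he, by rw [h.fst e he]; exact (h.snd e he).symm⟩
    · exact ⟨h'.mem_fst he, h'.mem_snd he, by rw [h'.fst e he]; exact (h'.snd e he).symm⟩
  have hlo : lo ∈ rightward (M ++ M') lo hi := by
    simp only [rightward, Finset.mem_filter, Finset.mem_Icc]
    refine ⟨by omega, fun e he => ?_⟩
    obtain ⟨h1, h2, h3⟩ := hmem e he
    have : e.1 ≠ e.2 := fun hh => h3 (by rw [hh])
    omega
  have hhi : hi ∈ leftward (M ++ M') lo hi := by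
    simp only [leftward, Finset.mem_filter, Finset.mem_Icc]
    refine ⟨by omega, fun e he => ?_⟩
    obtain ⟨h1, h2, h3⟩ := hmem e he
    have : e.1 ≠ e.2 := fun hh => h3 (by rw [hh])
    omega
  have hsub : ((Finset.Ico lo hi).filter fun i => col i = col (i + 1)) ⊆
      (((rightward (M ++ M') lo hi).erase lo).image fun i => i - 1) ∪
        (leftward (M ++ M') lo hi).erase hi := by
    intro i hi'
    rw [Finset.mem_filter, Finset.mem_Ico] at hi'
    obtain ⟨⟨i1, i2⟩, i3⟩ := hi'
    rw [Finset.mem_union, Finset.mem_image]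
    by_contra hcon
    push Not at hcon
    obtain ⟨n1, n2⟩ := hcon
    have n1' : i + 1 ∉ rightward (M ++ M') lo hi := fun hh =>
      n1 (i + 1) (Finset.mem_erase.2 ⟨by omega, hh⟩) (by omega)
    have n2' : i ∉ leftward (M ++ M') lo hi := fun hh => n2 (Finset.mem_erase.2 ⟨by omega, hh⟩)
    simp only [rightward, leftward, Finset.mem_filter, Finset.mem_Icc, not_and] at n1' n2'
    have n1' := n1' (by omega)
    have n2' := n2' (by omega)
    push Not at n1' n2'
    obtain ⟨e, he, he'⟩ := n1'
    obtain ⟨f, hf, hf'⟩ := n2'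
    have hx := hcr e he f hf
    obtain ⟨-, -, ce⟩ := hmem e he
    obtain ⟨-, -, cf⟩ := hmem f hf
    rw [← Bool.not_eq_true, crossB_iff] at hx
    have e1 : e.1 ≠ e.2 := fun hh => ce (by rw [hh])
    have f1 : f.1 ≠ f.2 := fun hh => cf (by rw [hh])
    have e2 : ¬ (e.1 = i + 1 ∧ e.2 = i) := fun hh => ce (by rw [hh.1, hh.2, i3])
    have e3 : ¬ (e.2 = i + 1 ∧ e.1 = i) := fun hh => ce (by rw [hh.1, hh.2, i3])
    have f2 : ¬ (f.1 = i + 1 ∧ f.2 = i) := fun hh => cf (by rw [hh.1, hh.2, i3])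
    have f3 : ¬ (f.2 = i + 1 ∧ f.1 = i) := fun hh => cf (by rw [hh.1, hh.2, i3])
    have E : (e.1 = i + 1 ∧ e.2 < i) ∨ (e.2 = i + 1 ∧ e.1 < i) := by
      clear hx hf' f1 f2 f3
      by_cases c1 : e.1 = i + 1 ∧ e.2 < i
      · exact Or.inl c1
      · obtain ⟨c2, c3⟩ := he' (fun c => by omega)
        omega
    have F : (f.1 = i ∧ i + 1 < f.2) ∨ (f.2 = i ∧ i + 1 < f.1) := by
      clear hx he' e1 e2 e3 E
      by_cases c1 : f.1 = i ∧ i + 1 < f.2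
      · exact Or.inl c1
      · obtain ⟨c2, c3⟩ := hf' (fun c => by omega)
        omega
    apply hx
    clear hx he' hf'
    rcases E with E | E <;> rcases F with F | F <;> omega
  have h1 := (Finset.card_le_card hsub).trans (Finset.card_union_le _ _)
  have h2 := Finset.card_image_le (s := (rightward (M ++ M') lo hi).erase lo) (f := fun i => i - 1)
  have h3 := Finset.card_erase_add_one hlo
  have h4 := Finset.card_erase_add_one hhi
  unfold sameAdj
  omega

end

theorem crossB_false_of_selfCross {M : List (ℕ × ℕ)} (h : selfCross M = 0) :
    ∀ e ∈ M, ∀ f ∈ M, crossB e f = false := by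
  induction M with
  | nil => simp
  | cons a M ih =>
    simp only [selfCross, Nat.add_eq_zero_iff, crossWith_eq_zero] at h
    have hself : ∀ e : ℕ × ℕ, crossB e e = false := fun e => by
      rw [← Bool.not_eq_true, crossB_iff]; omega
    intro e he f hf
    rcases List.mem_cons.1 he with he | he <;> rcases List.mem_cons.1 hf with hf | hf
    · rw [he, hf, hself]
    · rw [he, crossB_comm, h.1 f hf]
    · rw [hf, h.1 e he]
    · exact ih h.2 e he f hf

theorem sameAdj_le {col : ℕ → Bool} {lo hi : ℕ} {M M' T : List (ℕ × ℕ)} {α α' : Bool} (hle : lo ≤ hi)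
    (h : Cov col lo hi M α) (h' : Cov col lo hi M' α')
    (hc : ∀ e ∈ M, ∀ f ∈ M', crossB e f = false)
    (hT : ∀ x, lo ≤ x → x ≤ hi → ∀ y, lo ≤ y → y ≤ hi → Conn (T ++ (M ++ M')) x y) :
    sameAdj col lo hi ≤ 2 * (selfCross M + selfCross M' + T.length) := by
  induction hn : selfCross M + selfCross M' using Nat.strong_induction_on generalizing M M' T with
  | _ n ih =>
  subst hn
  by_cases hM : 0 < selfCross M
  · obtain ⟨N, x, c1, c2, c3, c4⟩ := h.uncross hM
    have := ih _ (by omega) (M := N) (M' := M') (T := x :: T) c1 h' ?_ ?_ rfl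
    · simp only [List.length_cons] at this
      omega
    · intro e he f hf
      have h0 : crossWith M f = 0 := crossWith_eq_zero.2 fun e he => hc e he f hf
      have h1 := c3 f
      exact crossWith_eq_zero.1 (by omega : crossWith N f = 0) e he
    · intro a ha ha' b hb hb'
      refine (hT a ha ha' b hb hb').mono fun u v huv => ?_
      simp only [List.mem_append] at huv
      rcases huv with huv | huv | huv
      · exact .rel _ _ (by simp [huv])
      · refine (c4 u v huv).mono fun u v huv => .rel _ _ ?_
        simp only [List.mem_cons, List.mem_append, List.cons_append] at huv ⊢
        tauto
      · exact .rel _ _ (by simp [huv])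
  by_cases hM' : 0 < selfCross M'
  · obtain ⟨N, x, c1, c2, c3, c4⟩ := h'.uncross hM'
    have := ih _ (by omega) (M := M) (M' := N) (T := x :: T) h c1 ?_ ?_ rfl
    · simp only [List.length_cons] at this
      omega
    · intro e he f hf
      have h0 : crossWith M' e = 0 := crossWith_eq_zero.2 fun f hf => by
        rw [crossB_comm]; exact hc e he f hf
      have h1 := c3 e
      rw [crossB_comm]
      exact crossWith_eq_zero.1 (by omega : crossWith N e = 0) f hf
    · intro a ha ha' b hb hb'
      refine (hT a ha ha' b hb hb').mono fun u v huv => ?_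
      simp only [List.mem_append] at huv
      rcases huv with huv | huv | huv
      · exact .rel _ _ (by simp [huv])
      · exact .rel _ _ (by simp [huv])
      · refine (c4 u v huv).mono fun u v huv => .rel _ _ ?_
        simp only [List.mem_cons, List.mem_append, List.cons_append] at huv ⊢
        tauto
  have s1 := crossB_false_of_selfCross (by omega : selfCross M = 0)
  have s2 := crossB_false_of_selfCross (by omega : selfCross M' = 0)
  have h1 := sameAdj_le_card hle h h' (by
    intro e he f hf
    rcases List.mem_append.1 he with he | he <;> rcases List.mem_append.1 hf with hf | hf
    · exact s1 e he f hf
    · exact hc e he f hf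
    · rw [crossB_comm]; exact hc f hf e he
    · exact s2 e he f hf)
  have h2 : (rightward (M ++ M') lo hi).card ≤ T.length + 1 :=
    card_le_of_conn (M := M ++ M') (fun a ha b hb => h.eq_of_rightward h' s1 hc s2 ha hb)
      fun a ha b hb => by
        simp only [rightward, Finset.mem_filter, Finset.mem_Icc] at ha hb
        exact hT a ha.1.1 ha.1.2 b hb.1.1 hb.1.2
  have h3 : (leftward (M ++ M') lo hi).card ≤ T.length + 1 :=
    card_le_of_conn (M := M ++ M') (fun a ha b hb => h.eq_of_leftward h' s1 hc s2 ha hb)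
      fun a ha b hb => by
        simp only [leftward, Finset.mem_filter, Finset.mem_Icc] at ha hb
        exact hT a ha.1.1 ha.1.2 b hb.1.1 hb.1.2
  omega

/-- The first, third, fifth, … pair of consecutive elements. -/
def pairsOf : List ℕ → List (ℕ × ℕ)
  | [] => []
  | [_] => []
  | a :: b :: t => (a, b) :: pairsOf t

theorem edgesOf_perm_pairsOf (s : List ℕ) :
    (edgesOf s).Perm ((pairsOf s ++ pairsOf s.tail).map fun e => mkE e.1 e.2) := by
  induction s with
  | nil => simp [edgesOf, pairsOf]
  | cons a s ih =>
    cases s with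
    | nil => simp [edgesOf, pairsOf]
    | cons b t =>
      simp only [edgesOf, pairsOf, List.tail_cons, List.cons_append, List.map_cons] at ih ⊢
      refine List.Perm.cons _ (ih.trans ?_)
      exact (List.perm_append_comm).map _

theorem selfCross_map_mkE (M : List (ℕ × ℕ)) :
    selfCross (M.map fun e => mkE e.1 e.2) = selfCross M := by
  have h : ∀ (M : List (ℕ × ℕ)) o, crossWith (M.map fun e => mkE e.1 e.2) o = crossWith M o := by
    intro M o
    simp only [crossWith, List.map_map, Function.comp_def, xc_mkE_left]
  induction M with
  | nil => rfl
  | cons e M ih => simp only [List.map_cons, selfCross, ih, h]; simp [crossWith, xc]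

theorem mem_pairsOf {s : List ℕ} {e : ℕ × ℕ} (h : e ∈ pairsOf s ++ pairsOf s.tail) :
    ∃ u v, s = u ++ e.1 :: e.2 :: v := by
  induction s with
  | nil => simp [pairsOf] at h
  | cons a s ih =>
    cases s with
    | nil => simp [pairsOf] at h
    | cons b t =>
      simp only [pairsOf, List.tail_cons, List.cons_append, List.mem_cons, List.mem_append] at h
      rcases h with h | h | h
      · exact ⟨[], t, by simp [h]⟩
      · obtain ⟨u, v, huv⟩ := ih (by simp [h])
        exact ⟨a :: u, v, by simp [huv]⟩
      · obtain ⟨u, v, huv⟩ := ih (by simp [h])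
        exact ⟨a :: u, v, by simp [huv]⟩

theorem Alt.color_pairsOf {col : ℕ → Bool} {a : ℕ} {s : List ℕ} (h : Alt col (a :: s)) :
    ∀ e ∈ pairsOf (a :: s), col e.1 = col a ∧ col e.2 ≠ col a := by
  induction hn : s.length using Nat.strong_induction_on generalizing a s with
  | _ n ih =>
  match s, h, hn with
  | [], _, _ => simp [pairsOf]
  | [b], h, _ =>
    simp only [Alt, List.isChain_cons_cons] at h
    simp [pairsOf, h.1.symm]
  | b :: c :: t, h, hn =>
    simp only [Alt, List.isChain_cons_cons] at h
    obtain ⟨h1, h2, h3⟩ := h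
    have := ih t.length (by simp at hn; omega) (a := c) (s := t) h3 rfl
    have hac : col c = col a := by
      revert h1 h2
      cases col a <;> cases col b <;> cases col c <;> simp
    intro e he
    rw [pairsOf, List.mem_cons] at he
    rcases he with rfl | he
    · exact ⟨rfl, h1.symm⟩
    · rw [← hac]; exact this e he

theorem Alt.even_length {col : ℕ → Bool} {p q : ℕ} {s : List ℕ} (h : Alt col s) (hs : Seg s p q)
    (hne : col p ≠ col q) : Even s.length := by
  induction hn : s.length using Nat.strong_induction_on generalizing p s with
  | _ n ih =>
  match s, h, hn with
  | [], _, hn => simp at hn; simp [← hn]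
  | [a], h, _ =>
    obtain ⟨h1, h2⟩ := hs
    simp at h1 h2
    subst h1; subst h2; exact absurd rfl hne
  | [a, b], h, hn => simp at hn; simp [← hn]
  | a :: b :: c :: t, h, hn =>
    simp only [Alt, List.isChain_cons_cons] at h
    obtain ⟨h1, h2, h3⟩ := h
    obtain ⟨g1, g2⟩ := hs
    have hac : col c = col p := by
      simp at g1
      subst g1
      revert h1 h2
      cases col a <;> cases col b <;> cases col c <;> simp
    simp only [List.length_cons] at hn
    have := ih (t.length + 1) (by omega) (s := c :: t) (p := c) h3 ⟨rfl, by simpa using g2⟩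
      (by rw [hac]; exact hne) (by simp)
    rw [← hn]
    simpa [Nat.even_add_one] using this

theorem perm_pairsOf {s : List ℕ} (h : Even s.length) :
    ((pairsOf s).map Prod.fst ++ (pairsOf s).map Prod.snd).Perm s := by
  induction hn : s.length using Nat.strong_induction_on generalizing s with
  | _ n ih =>
  match s, h, hn with
  | [], _, _ => simp [pairsOf]
  | [a], h, _ => simp at h
  | a :: b :: t, h, hn =>
    have := ih t.length (by simp at hn; omega) (s := t) (by simpa [Nat.even_add_one] using h) rfl
    simp only [pairsOf, List.map_cons, List.cons_append]
    exact (List.perm_middle.trans (this.cons b)).cons a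

theorem pairsOf_append {s : List ℕ} (h : Even s.length) (r : List ℕ) :
    pairsOf (s ++ r) = pairsOf s ++ pairsOf r := by
  induction hn : s.length using Nat.strong_induction_on generalizing s with
  | _ n ih =>
  match s, h, hn with
  | [], _, _ => simp [pairsOf]
  | [a], h, _ => simp at h
  | a :: b :: t, h, hn =>
    have := ih t.length (by simp at hn; omega) (s := t) (by simpa [Nat.even_add_one] using h) rfl
    simp [pairsOf, this]

theorem Opt.crossB_eq_false {col : ℕ → Bool} {N : ℕ} {l u v u' v' : List ℕ} {a b c d : ℕ}
    (h : Opt N col l) (h1 : l = u ++ a :: b :: v) (h2 : l = u' ++ c :: d :: v')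
    (hne : col a ≠ col c) : crossB (a, b) (c, d) = false := by
  have key : ∀ {u m v' : List ℕ} {a b c d : ℕ}, l = (u ++ [a]) ++ (b :: m) ++ (d :: v') →
      (b :: m).getLast? = some c → col a ≠ col c → crossB (a, b) (c, d) = false := by
    intro u m v' a b c d hl hm hne
    subst hl
    obtain ⟨p, hp⟩ : ∃ p, (u ++ [a]).head? = some p := by
      cases u <;> simp
    exact h.not_cross_of_ne ⟨hp, by simp⟩ ⟨rfl, hm⟩
      ⟨rfl, List.getLast?_eq_some_getLast (by simp)⟩ hne
  have he := h1.symm.trans h2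
  rcases List.append_eq_append_iff.1 he with ⟨w, w1, w2⟩ | ⟨w, w1, w2⟩
  · cases w with
    | nil => simp at w2; exact absurd (by rw [w2.1]) hne
    | cons x w =>
      simp only [List.cons_append, List.cons.injEq] at w2
      obtain ⟨rfl, w2⟩ := w2
      cases w with
      | nil =>
        simp at w2
        obtain ⟨rfl, rfl⟩ := w2
        exact key (u := u) (m := []) (v' := v') (by rw [h1]; simp) (by simp) hne
      | cons y w =>
        simp only [List.cons_append, List.cons.injEq] at w2
        obtain ⟨rfl, rfl⟩ := w2
        exact key (u := u) (m := w ++ [c]) (v' := v') (by rw [h1]; simp) (by simp [List.getLast?_cons]) hne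
  · rw [crossB_comm]
    cases w with
    | nil => simp at w2; exact absurd (by rw [w2.1]) hne
    | cons x w =>
      simp only [List.cons_append, List.cons.injEq] at w2
      obtain ⟨rfl, w2⟩ := w2
      cases w with
      | nil =>
        simp at w2
        obtain ⟨rfl, rfl⟩ := w2
        exact key (u := u') (m := []) (v' := v) (by rw [h2]; simp) (by simp) hne.symm
      | cons y w =>
        simp only [List.cons_append, List.cons.injEq] at w2
        obtain ⟨rfl, rfl⟩ := w2
        exact key (u := u') (m := w ++ [a]) (v' := v) (by rw [h2]; simp) (by simp [List.getLast?_cons]) hne.symm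

theorem Conn.of_pairs {M : List (ℕ × ℕ)} {a : ℕ} {s : List ℕ}
    (h : ∀ e ∈ pairsOf (a :: s) ++ pairsOf s, Conn M e.1 e.2) : ∀ x ∈ a :: s, Conn M a x := by
  induction s generalizing a with
  | nil => intro x hx; simp at hx; rw [hx]; exact .refl _
  | cons b t ih =>
    intro x hx
    rw [List.mem_cons] at hx
    rcases hx with rfl | hx
    · exact .refl _
    · refine .trans _ _ _ (h (a, b) (by simp [pairsOf])) (ih (fun e he => h e ?_) x hx)
      simp only [pairsOf, List.cons_append, List.mem_cons, List.mem_append] at he ⊢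
      tauto

theorem sameAdj_le_cr {col : ℕ → Bool} {N lo hi p q : ℕ} {pre s post : List ℕ}
    (ho : Opt N col (pre ++ s ++ post)) (hs : Seg s p q) (hpq : (p = lo ∧ q = hi) ∨ (p = hi ∧ q = lo))
    (hA : Alt col s) (hm : ∀ z, z ∈ s ↔ lo ≤ z ∧ z ≤ hi) (hne : col p ≠ col q) :
    sameAdj col lo hi ≤ 2 * cr s := by
  have hnd : s.Nodup := (List.nodup_append.1 (List.nodup_append.1 ho.nodup).1).2.1
  have hev := hA.even_length hs hne
  have hle : lo ≤ hi := by have := (hm p).1 hs.mem_left; omega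
  obtain ⟨m, hm'⟩ : ∃ m, s = p :: m := by
    cases s with
    | nil => simp [Seg] at hs
    | cons x t => exact ⟨t, by have := hs.1; simp at this; rw [this]⟩
  have hmm : m ≠ [] := by
    rintro rfl
    subst hm'
    have := hs.2
    simp at this
    exact hne (by rw [this])
  have hlast : m.getLast? = some q := by
    have := hs.2
    rw [hm', List.getLast?_cons] at this
    rw [List.getLast?_eq_some_getLast hmm] at this ⊢
    simpa using this
  obtain ⟨b, m', rfl⟩ := List.exists_cons_of_ne_nil hmm
  subst hm'
  have hbp : col p ≠ col b := by
    simp only [Alt, List.isChain_cons_cons] at hA; exact hA.1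
  have hqb : col q = col b := by
    revert hne hbp
    cases col p <;> cases col b <;> cases col q <;> simp
  have C1 : Cov col lo hi (pairsOf (p :: b :: m')) (col p) := by
    have hp := perm_pairsOf hev
    have hc := hA.color_pairsOf
    exact ⟨hp.nodup_iff.2 hnd, fun z => hp.mem_iff.trans (hm z), fun e he => (hc e he).1,
      fun e he => (hc e he).2⟩
  have hA' : Alt col (b :: m') := by
    simp only [Alt, List.isChain_cons_cons] at hA; exact hA.2
  obtain ⟨n, hn⟩ : ∃ n, b :: m' = n ++ [q] := by
    rcases List.eq_nil_or_concat (b :: m') with h | ⟨n, y, h⟩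
    · simp at h
    · refine ⟨n, ?_⟩
      rw [h] at hlast
      simp at hlast
      rw [h, hlast, List.concat_eq_append]
  have C2 : Cov col lo hi (pairsOf (b :: m' ++ [p])) (col b) := by
    have hA2 : Alt col (b :: m' ++ [p]) := by
      rw [Alt.append_iff (⟨rfl, hlast⟩ : Seg (b :: m') b q) (Seg.singleton p)]
      exact ⟨hA', by simp [Alt], hne.symm⟩
    have hp := (perm_pairsOf (s := b :: m' ++ [p]) (by simpa using hev)).trans
      (List.perm_append_comm (l₁ := b :: m') (l₂ := [p]))
    have hc := hA2.color_pairsOf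
    exact ⟨hp.nodup_iff.2 hnd, fun z => hp.mem_iff.trans (hm z), fun e he => (hc e he).1,
      fun e he => (hc e he).2⟩
  have hevn : Even n.length := by
    have := hev
    rw [List.length_cons, hn] at this
    simpa [Nat.even_add_one] using this
  have e1 : pairsOf (b :: m') = pairsOf n := by
    rw [hn, pairsOf_append hevn]; simp [pairsOf]
  have e2 : pairsOf (b :: m' ++ [p]) = pairsOf (b :: m') ++ [(q, p)] := by
    rw [e1, hn, List.append_assoc, pairsOf_append hevn]; simp [pairsOf]
  rw [e2] at C2
  have hmem : ∀ e ∈ pairsOf (p :: b :: m') ++ pairsOf (b :: m'),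
      ∃ u v, pre ++ (p :: b :: m') ++ post = u ++ e.1 :: e.2 :: v := by
    intro e he
    obtain ⟨u, v, h⟩ := mem_pairsOf (s := p :: b :: m') he
    exact ⟨pre ++ u, v ++ post, by rw [h]; simp⟩
  have hout : ∀ e : ℕ × ℕ, (lo ≤ e.1 ∧ e.1 ≤ hi) → (lo ≤ e.2 ∧ e.2 ≤ hi) →
      crossB e (q, p) = false := by
    intro e h1 h2
    rw [← Bool.not_eq_true, crossB_iff]
    dsimp only
    omega
  have h0 : selfCross (pairsOf (b :: m') ++ [(q, p)]) = selfCross (pairsOf (b :: m')) := by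
    rw [selfCross_append]
    simp only [selfCross, crossBetween_cons, crossBetween_nil, crossWith_nil]
    have : crossWith (pairsOf (b :: m')) (q, p) = 0 := crossWith_eq_zero.2 fun e he =>
      hout e (C2.mem_fst (by simp [he])) (C2.mem_snd (by simp [he]))
    omega
  have h1 := sameAdj_le (T := []) hle C1 C2 ?_ ?_
  · have h2 := selfCross_perm (edgesOf_perm_pairsOf (p :: b :: m'))
    rw [selfCross_map_mkE, selfCross_append, List.tail_cons] at h2
    rw [h0] at h1
    simp only [List.length_nil] at h1
    unfold cr
    omega
  · intro e he f hf
    rw [List.mem_append, List.mem_singleton] at hf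
    rcases hf with hf | rfl
    · obtain ⟨u, v, h3⟩ := hmem e (by simp [he])
      obtain ⟨u', v', h4⟩ := hmem f (by simp [hf])
      refine ho.crossB_eq_false h3 h4 ?_
      rw [C1.fst e he, C2.fst f (by simp [hf])]
      exact hbp
    · exact hout e (C1.mem_fst he) (C1.mem_snd he)
  · have hcon : ∀ x ∈ p :: b :: m',
        Conn ([] ++ (pairsOf (p :: b :: m') ++ (pairsOf (b :: m') ++ [(q, p)]))) p x := by
      refine Conn.of_pairs fun e he => .rel _ _ ?_
      simp only [List.mem_append] at he ⊢
      tauto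
    intro x hx1 hx2 y hy1 hy2
    exact .trans _ _ _ (.symm _ _ (hcon x ((hm x).2 ⟨hx1, hx2⟩))) (hcon y ((hm y).2 ⟨hy1, hy2⟩))

theorem TwoBlocks.sameAdj_le {N : ℕ} {col : ℕ → Bool} {s2 s3 : List ℕ} {t : ℕ}
    (H : TwoBlocks N col s2 s3 t) :
    4 + sameAdj col 1 (t - 1) + sameAdj col (t + 1) (N - 1) ≤
      2 * cr ([0] ++ s2 ++ s3 ++ [t]) := by
  obtain ⟨A2, A3, c1, c2, c3⟩ := H.color
  have i1 := H.three_le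
  have i2 := H.lt
  have hp : ∀ z, z ∈ [0] ++ s2 ++ s3 ++ [t] ↔ z < N := fun z => by
    rw [H.opt.1.1.mem_iff, List.mem_range]
  simp only [List.mem_append, List.mem_singleton] at hp
  have h2 := sameAdj_le_cr (pre := [0]) (s := s2) (post := s3 ++ [t]) (by simpa using H.opt) H.seg2
    (Or.inl ⟨rfl, rfl⟩) A2 (fun z => ⟨fun hz => by
      have := H.gt2 z hz
      have := (hp z).1 (by tauto)
      omega, fun hz => by
      rcases (hp z).2 (by omega) with ((h | h) | h) | h
      · omega
      · exact h
      · have := H.lt3 z h; omega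
      · omega⟩) (by rw [H.color_last]; exact c1.symm)
  have h3 := sameAdj_le_cr (pre := [0] ++ s2) (s := s3) (post := [t]) H.opt H.seg3
    (Or.inr ⟨rfl, rfl⟩) A3 (fun z => ⟨fun hz => by
      have := H.lt3 z hz
      omega, fun hz => by
      rcases (hp z).2 (by omega) with ((h | h) | h) | h
      · omega
      · have := H.gt2 z h; omega
      · exact h
      · omega⟩) (by rw [H.color_one, ← H.color_last]; exact c2.symm)
  have := H.le_cr
  omega

/-- The order embedding of `ℕ` which leaves out `i` and `i + 1`. -/
def skip (i x : ℕ) : ℕ := if x < i then x else x + 2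

theorem crossB_skip (i a b c d : ℕ) :
    crossB (skip i a, skip i b) (skip i c, skip i d) = crossB (a, b) (c, d) := by
  rw [Bool.eq_iff_iff, crossB_iff, crossB_iff]
  simp only [skip]
  split_ifs <;> omega

theorem edgesOf_map_skip (i : ℕ) (l : List ℕ) :
    edgesOf (l.map (skip i)) = (edgesOf l).map fun e => (skip i e.1, skip i e.2) := by
  have hmk : ∀ a b, mkE (skip i a) (skip i b) = (skip i (mkE a b).1, skip i (mkE a b).2) := by
    intro a b
    simp only [mkE, skip, Prod.mk.injEq]
    rcases le_total a b with h | h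
    · simp only [min_eq_left h, max_eq_right h]; split_ifs <;> omega
    · simp only [min_eq_right h, max_eq_left h]; split_ifs <;> omega
  induction l with
  | nil => rfl
  | cons x t ih =>
    cases t with
    | nil => rfl
    | cons y t =>
      simp only [List.map_cons, edgesOf] at ih ⊢
      rw [ih, hmk]

theorem selfCross_map_skip (i : ℕ) (L : List (ℕ × ℕ)) :
    selfCross (L.map fun e => (skip i e.1, skip i e.2)) = selfCross L := by
  induction L with
  | nil => rfl
  | cons e L ih =>
    simp only [List.map_cons, selfCross, ih, crossWith, List.map_map, Function.comp_def, xc,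
      crossB_skip]

theorem selfCross_append_three (O : List (ℕ × ℕ)) (e1 e2 e3 : ℕ × ℕ) :
    selfCross (O ++ [e1, e2, e3]) = selfCross O + (crossWith O e1 + crossWith O e2 + crossWith O e3) +
      (xc e1 e2 + xc e1 e3 + xc e2 e3) := by
  rw [selfCross_append]
  simp only [selfCross, crossBetween_cons, crossBetween_nil, crossWith_cons, crossWith_nil,
    xc_comm e2 e1, xc_comm e3 e1, xc_comm e3 e2]
  omega

theorem perm_insert_skip {N i : ℕ} (hi : i ≤ N) {s1 s2 : List ℕ} (h : (s1 ++ s2).Perm (List.range N))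
    {m1 m2 : ℕ} (hm : (m1 = i ∧ m2 = i + 1) ∨ (m1 = i + 1 ∧ m2 = i)) :
    (s1.map (skip i) ++ ([m1, m2] ++ s2.map (skip i))).Perm (List.range (N + 2)) := by
  have h1 : (s1.map (skip i) ++ ([m1, m2] ++ s2.map (skip i))).Perm
      ([m1, m2] ++ (List.range N).map (skip i)) := by
    refine (List.perm_append_comm_assoc _ _ _).trans ?_
    rw [← List.map_append]
    exact (h.map _).append_left _
  refine h1.trans ?_
  have hinj : Function.Injective (skip i) := by
    intro a b hab
    simp only [skip] at hab
    split_ifs at hab <;> omega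
  refine (List.perm_ext_iff_of_nodup ?_ List.nodup_range).2 ?_
  · rw [List.nodup_append]
    refine ⟨by simp; omega, List.nodup_range.map hinj, ?_⟩
    intro a ha b hb
    simp only [List.mem_map, List.mem_range] at hb
    obtain ⟨c, -, rfl⟩ := hb
    simp only [List.mem_cons, List.not_mem_nil, or_false] at ha
    simp only [skip]
    split_ifs <;> omega
  · intro z
    simp only [List.mem_append, List.mem_map, List.mem_range, List.mem_cons, List.not_mem_nil,
      or_false]
    constructor
    · rintro (h | ⟨c, hc, rfl⟩)
      · omega
      · simp only [skip]; split_ifs <;> omega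
    · intro hz
      by_cases h3 : z = i ∨ z = i + 1
      · left; omega
      · right
        by_cases h4 : z < i
        · exact ⟨z, by omega, by simp [skip, h4]⟩
        · exact ⟨z - 2, by omega, by simp only [skip]; rw [if_neg (by omega)]; omega⟩

theorem Alt.map_comp {col : ℕ → Bool} {f : ℕ → ℕ} {l : List ℕ} :
    Alt (fun x => col (f x)) l ↔ Alt col (l.map f) := by
  unfold Alt
  rw [List.isChain_map]

section
variable {N i : ℕ} {col : ℕ → Bool} {s1 s2 : List ℕ} {p q x z m1 m2 k : ℕ}

theorem Valid.insert (hi : i ≤ N) (h : Valid N (fun y => col (skip i y)) (s1 ++ s2)) (h1 : Seg s1 p x)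
    (h2 : Seg s2 z q) (hm : (m1 = i ∧ m2 = i + 1) ∨ (m1 = i + 1 ∧ m2 = i))
    (hne : col i ≠ col (i + 1)) (hc : col (skip i x) ≠ col m1) :
    Valid (N + 2) col (s1.map (skip i) ++ ([m1, m2] ++ s2.map (skip i))) := by
  refine ⟨perm_insert_skip hi h.1 hm, ?_⟩
  have hA := h.2
  rw [Alt.append_iff h1 h2, Alt.map_comp (f := skip i), Alt.map_comp (f := skip i)] at hA
  obtain ⟨A1, A2, A3⟩ := hA
  have hm' : Seg [m1, m2] m1 m2 := ⟨rfl, rfl⟩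
  have h1' := h1.map (skip i)
  have h2' := h2.map (skip i)
  have hne' : col m1 ≠ col m2 := by
    rcases hm with ⟨rfl, rfl⟩ | ⟨rfl, rfl⟩
    · exact hne
    · exact hne.symm
  rw [Alt.append_iff h1' (hm'.append h2'), Alt.append_iff hm' h2']
  refine ⟨A1, ⟨by simpa [Alt] using hne', A2, ?_⟩, hc⟩
  revert A3 hne' hc
  cases col m1 <;> cases col m2 <;> cases col (skip i x) <;> cases col (skip i z) <;> simp

theorem cr_insert_le (hx : x + 1 = i ∨ x = i) (hnd : (s1 ++ s2).Nodup) (h1 : Seg s1 p x)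
    (h2 : Seg s2 z q) (hm : (m1 = i ∧ m2 = i + 1) ∨ (m1 = i + 1 ∧ m2 = i))
    (hk : ∀ w, xc (skip i x, m1) (m2, w) ≤ k)
    (hy : ∀ e ∈ edgesOf s1, e.1 = x ∨ e.2 = x →
      crossB (skip i e.1, skip i e.2) (m2, skip i z) = false) :
    cr (s1.map (skip i) ++ ([m1, m2] ++ s2.map (skip i))) ≤ cr (s1 ++ s2) + k := by
  have hm' : Seg [m1, m2] m1 m2 := ⟨rfl, rfl⟩
  have h1' := h1.map (skip i)
  have h2' := h2.map (skip i)
  set O := edgesOf s1 ++ edgesOf s2 with hO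
  set φ := fun e : ℕ × ℕ => (skip i e.1, skip i e.2) with hφ
  have e1 : cr (s1 ++ s2) = selfCross O + crossWith O (x, z) := by
    unfold cr
    rw [edgesOf_append h1 h2, selfCross_perm (List.perm_middle), selfCross]
    have : ∀ L, crossWith L (mkE x z) = crossWith L (x, z) := fun L => by simp [crossWith]
    rw [this, hO]; omega
  have hp : (edgesOf (s1.map (skip i) ++ ([m1, m2] ++ s2.map (skip i)))).Perm
      (O.map φ ++ [mkE (skip i x) m1, mkE m1 m2, mkE m2 (skip i z)]) := by
    rw [edgesOf_append h1' (hm'.append h2'), edgesOf_append hm' h2', edgesOf_map_skip,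
      edgesOf_map_skip, hO, List.map_append]
    simp only [edgesOf, List.append_assoc, List.cons_append, List.nil_append]
    refine List.Perm.append_left _ ?_
    exact List.perm_append_comm (l₁ := [_, _, _])
  have e2 : cr (s1.map (skip i) ++ ([m1, m2] ++ s2.map (skip i))) = _ := selfCross_perm hp
  rw [e2, selfCross_append_three, selfCross_map_skip, e1]
  have c1 : crossWith (O.map φ) (mkE (skip i x) m1) = 0 := by
    refine crossWith_eq_zero.2 fun e he => ?_
    obtain ⟨⟨a, b⟩, -, rfl⟩ := List.mem_map.1 he
    rw [crossB_mkE_right, ← Bool.not_eq_true, crossB_iff]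
    simp only [hφ, skip]
    split_ifs <;> omega
  have c2 : crossWith (O.map φ) (mkE m1 m2) = 0 := by
    refine crossWith_eq_zero.2 fun e he => ?_
    obtain ⟨⟨a, b⟩, -, rfl⟩ := List.mem_map.1 he
    rw [crossB_mkE_right, ← Bool.not_eq_true, crossB_iff]
    simp only [hφ, skip]
    split_ifs <;> omega
  have c3 : crossWith (O.map φ) (mkE m2 (skip i z)) ≤ crossWith O (x, z) := by
    unfold crossWith
    rw [List.map_map]
    refine List.sum_le_sum fun e he => ?_
    rw [Function.comp_apply, xc_mkE_right]
    by_cases ht : e.1 = x ∨ e.2 = x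
    · have : e ∈ edgesOf s1 := by
        rcases List.mem_append.1 he with he | he
        · exact he
        · exfalso
          obtain ⟨m1, m2⟩ := mem_edgesOf_fst_snd he
          rcases ht with ht | ht
          · exact ne_of_mem_append hnd h1.mem_right m1 ht.symm
          · exact ne_of_mem_append hnd h1.mem_right m2 ht.symm
      have := hy e this ht
      simp only [hφ, xc, this]
      simp
    · by_cases hcr : crossB (φ e) (m2, skip i z) = true
      · have : crossB e (x, z) = true := by
          rw [crossB_iff] at hcr ⊢
          simp only [hφ, skip] at hcr ⊢
          push Not at ht
          split_ifs at hcr <;> omega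
        simp [xc, hcr, this]
      · simp [xc, hcr]
  have c4 : xc (mkE (skip i x) m1) (mkE m1 m2) = 0 := by
    rw [xc_mkE_left, xc_mkE_right, xc_eq_zero, ← Bool.not_eq_true, crossB_iff]; dsimp only; omega
  have c5 : xc (mkE m1 m2) (mkE m2 (skip i z)) = 0 := by
    rw [xc_mkE_left, xc_mkE_right, xc_eq_zero, ← Bool.not_eq_true, crossB_iff]; dsimp only; omega
  have c6 : xc (mkE (skip i x) m1) (mkE m2 (skip i z)) ≤ k := by
    rw [xc_mkE_left, xc_mkE_right]; exact hk _
  omega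
end

theorem Seg.exists_append {l : List ℕ} {p q x : ℕ} (h : Seg l p q) (hx : x ∈ l) :
    (∃ s1 s2 z, l = s1 ++ s2 ∧ Seg s1 p x ∧ Seg s2 z q) ∨ (∃ s1, l = s1 ++ [x] ∧ q = x) := by
  obtain ⟨u, v, rfl⟩ := List.append_of_mem hx
  cases v with
  | nil => right; exact ⟨u, rfl, by have := h.2; simpa using this.symm⟩
  | cons z v =>
    left
    refine ⟨u ++ [x], z :: v, z, by simp, ⟨?_, by simp⟩, ⟨rfl, ?_⟩⟩
    · have := h.1
      cases u <;> simpa using this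
    · have := h.2
      simpa [List.getLast?_append, List.getLast?_cons] using this

section
variable {N i : ℕ} {col : ℕ → Bool} {Q : List ℕ} {p q x m1 m2 k : ℕ}

theorem exists_insert_at (hi : 1 ≤ i) (hiN : i < N) (hx : x + 1 = i ∨ x = i)
    (hm : (m1 = i ∧ m2 = i + 1) ∨ (m1 = i + 1 ∧ m2 = i))
    (hne : col i ≠ col (i + 1)) (hc : col (skip i x) ≠ col m1)
    (hk : ∀ w, xc (skip i x, m1) (m2, w) ≤ k)
    (h : Valid N (fun y => col (skip i y)) Q) (hs : Seg Q p q) :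
    ∃ Q', Valid (N + 2) col Q' ∧ Seg Q' (skip i p) (skip i q) ∧ cr Q' ≤ cr Q + k := by
  have hm' : Seg [m1, m2] m1 m2 := ⟨rfl, rfl⟩
  have hnd : Q.Nodup := h.1.nodup_iff.2 List.nodup_range
  have hxQ : x ∈ Q := h.1.mem_iff.2 (List.mem_range.2 (by omega))
  have key : ∀ {Q p q s1 s2 z}, Valid N (fun y => col (skip i y)) Q → Q = s1 ++ s2 → Seg s1 p x →
      Seg s2 z q → (∀ e ∈ edgesOf s1, e.1 = x ∨ e.2 = x →
      crossB (skip i e.1, skip i e.2) (m2, skip i z) = false) →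
      ∃ Q', Valid (N + 2) col Q' ∧ Seg Q' (skip i p) (skip i q) ∧ cr Q' ≤ cr Q + k := by
    intro Q p q s1 s2 z h e h1 h2 hy
    subst e
    exact ⟨_, h.insert hiN.le h1 h2 hm hne hc, (h1.map _).append (hm'.append (h2.map _)),
      cr_insert_le hx (h.1.nodup_iff.2 List.nodup_range) h1 h2 hm hk hy⟩
  have krev : ∀ {Q p q s1 s2 z}, Valid N (fun y => col (skip i y)) Q → Q.reverse = s1 ++ s2 →
      Seg s1 q x → Seg s2 z p → (∀ e ∈ edgesOf s1, e.1 = x ∨ e.2 = x →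
      crossB (skip i e.1, skip i e.2) (m2, skip i z) = false) →
      ∃ Q', Valid (N + 2) col Q' ∧ Seg Q' (skip i p) (skip i q) ∧ cr Q' ≤ cr Q + k := by
    intro Q p q s1 s2 z h e h1 h2 hy
    obtain ⟨Q', v, s, c⟩ := key h.reverse e h1 h2 hy
    exact ⟨Q'.reverse, v.reverse, s.reverse, by rw [cr_reverse]; rwa [cr_reverse] at c⟩
  have single : ∀ (e : ℕ × ℕ), e ∉ edgesOf [x] := fun e he => by simp [edgesOf] at he
  -- an edge at `x` of a path ending in `y, x` with distinct vertices is `y x`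
  have last : ∀ {s : List ℕ} {p y : ℕ}, (s ++ [x]).Nodup → Seg s p y → ∀ e ∈ edgesOf (s ++ [x]),
      e.1 = x ∨ e.2 = x → e = mkE y x := by
    intro s p y hnd hs e he ht
    rw [edgesOf_append hs (Seg.singleton x)] at he
    simp only [edgesOf, List.mem_append, List.mem_singleton] at he
    rcases he with he | he
    · obtain ⟨n1, n2⟩ := mem_edgesOf_fst_snd he
      rcases ht with ht | ht
      · exact absurd ht (ne_of_mem_append hnd n1 (by simp))
      · exact absurd ht (ne_of_mem_append hnd n2 (by simp))
    · exact he
  rcases hs.exists_append hxQ with ⟨s1, s2, z, e, h1, h2⟩ | ⟨s1, e, rfl⟩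
  · rcases h1.eq_singleton_or_concat with e1 | ⟨s, y, e1, h3⟩
    · subst e1
      exact key h e h1 h2 fun e he => absurd he (single e)
    · subst e
      by_cases hcr : crossB (skip i y, skip i x) (m2, skip i z) = false
      · refine key h rfl h1 h2 fun e he ht => ?_
        subst e1
        have := last (List.nodup_append.1 hnd).1 h3 e he ht
        subst this
        rcases mkE_cases y x with hh | hh <;> rw [hh]
        · exact hcr
        · rw [crossB_swap]; exact hcr
      · subst e1
        have hr : (s ++ [x] ++ s2).reverse = (s2.reverse ++ [x]) ++ s.reverse := by simp
        refine krev h hr (h2.reverse.append (Seg.singleton x)) h3.reverse fun e he ht => ?_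
        have hnd' : (s2.reverse ++ [x]).Nodup := by
          have := List.nodup_reverse.2 hnd
          rw [hr] at this
          exact (List.nodup_append.1 this).1
        have hzx : z ≠ x := by
          rintro rfl
          exact ne_of_mem_append hnd' (List.mem_reverse.2 h2.mem_left) (by simp) rfl
        have hyz : y ≠ z := by
          rintro rfl
          exact ne_of_mem_append hnd (by simp [h3.mem_right]) h2.mem_left rfl
        have := last hnd' h2.reverse e he ht
        subst this
        have goal' : crossB (skip i z, skip i x) (m2, skip i y) = false := by
          rw [Bool.not_eq_false, crossB_iff] at hcr
          rw [← Bool.not_eq_true, crossB_iff]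
          simp only [skip] at hcr ⊢
          clear hk single last key krev
          split_ifs at hcr ⊢ <;> omega
        rcases mkE_cases z x with hh | hh <;> rw [hh]
        · exact goal'
        · rw [crossB_swap]; exact goal'
  · have hr : Q.reverse = [q] ++ s1.reverse := by rw [e]; simp
    have hs1 : s1 ≠ [] := by
      rintro rfl
      have := h.1.length_eq
      rw [e] at this
      simp at this
      omega
    obtain ⟨p', hp'⟩ : ∃ y, s1.getLast? = some y := ⟨_, List.getLast?_eq_some_getLast hs1⟩
    have hp : s1.head? = some p := by
      have := hs.1
      rw [e] at this
      cases s1 with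
      | nil => exact absurd rfl hs1
      | cons a s1 => simpa using this
    exact krev h hr (Seg.singleton q) (z := p') (Seg.reverse ⟨hp, hp'⟩) fun e he => absurd he (single e)

theorem exists_insert (hi : 1 ≤ i) (hiN : i < N) (hne : col i ≠ col (i + 1))
    (h : Valid N (fun y => col (skip i y)) Q) (hs : Seg Q p q) :
    ∃ Q', Valid (N + 2) col Q' ∧ Seg Q' (skip i p) (skip i q) ∧
      cr Q' ≤ cr Q + if col (i - 1) = col i ∧ col (i + 1) = col (i + 2) then 1 else 0 := by
  have e1 : skip i (i - 1) = i - 1 := by simp only [skip]; split_ifs <;> omega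
  have e2 : skip i i = i + 2 := by simp [skip]
  by_cases h1 : col (i - 1) = col i
  · by_cases h2 : col (i + 1) = col (i + 2)
    · rw [if_pos ⟨h1, h2⟩]
      exact exists_insert_at hi hiN (x := i - 1) (Or.inl (by omega)) (Or.inr ⟨rfl, rfl⟩) hne
        (by rw [e1, h1]; exact hne) (fun w => xc_le_one _ _) h hs
    · refine (exists_insert_at (k := 0) hi hiN (x := i) (Or.inr rfl) (Or.inr ⟨rfl, rfl⟩) hne
        (by rw [e2]; exact Ne.symm h2) (fun w => ?_) h hs).imp fun Q' hQ => ⟨hQ.1, hQ.2.1, by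
          have := hQ.2.2; omega⟩
      rw [Nat.le_zero, xc_eq_zero, ← Bool.not_eq_true, crossB_iff, e2]; dsimp only; omega
  · refine (exists_insert_at (k := 0) hi hiN (x := i - 1) (Or.inl (by omega)) (Or.inl ⟨rfl, rfl⟩) hne
        (by rw [e1]; exact h1) (fun w => ?_) h hs).imp fun Q' hQ => ⟨hQ.1, hQ.2.1, by
          have := hQ.2.2; omega⟩
    rw [Nat.le_zero, xc_eq_zero, ← Bool.not_eq_true, crossB_iff, e1]; dsimp only; omega

end

theorem skip_lt {i x : ℕ} (h : x < i) : skip i x = x := by simp [skip, h]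

theorem skip_ge {i x : ℕ} (h : i ≤ x) : skip i x = x + 2 := by simp [skip, not_lt.2 h]

theorem sum_skip_right {M : Type*} [AddCommMonoid M] (f : ℕ → M) {lo hi i : ℕ} (h : i ≤ lo) :
    ∑ x ∈ Finset.Ico (lo + 2) (hi + 2), f x = ∑ x ∈ Finset.Ico lo hi, f (skip i x) := by
  rw [← Finset.sum_Ico_add' f lo hi 2]
  refine Finset.sum_congr rfl fun x hx => ?_
  rw [skip_ge (by have := Finset.mem_Ico.1 hx; omega)]

theorem sum_skip_left {M : Type*} [AddCommMonoid M] (f : ℕ → M) {lo hi i : ℕ} (h : hi ≤ i) :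
    ∑ x ∈ Finset.Ico lo hi, f x = ∑ x ∈ Finset.Ico lo hi, f (skip i x) := by
  refine Finset.sum_congr rfl fun x hx => ?_
  rw [skip_lt (by have := Finset.mem_Ico.1 hx; omega)]

theorem sum_skip {M : Type*} [AddCommMonoid M] (f : ℕ → M) {lo hi i : ℕ} (h : lo ≤ i) (h' : i ≤ hi) :
    ∑ x ∈ Finset.Ico lo (hi + 2), f x =
      (∑ x ∈ Finset.Ico lo hi, f (skip i x)) + (f i + f (i + 1)) := by
  rw [← Finset.sum_Ico_consecutive _ h h', ← sum_skip_left f le_rfl, ← sum_skip_right f le_rfl,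
    ← Finset.sum_Ico_consecutive f (by omega : lo ≤ i + 2) (by omega : i + 2 ≤ hi + 2),
    Finset.sum_Ico_succ_top (by omega : lo ≤ i + 1), Finset.sum_Ico_succ_top h]
  abel

theorem sameAdj_eq_sum (col : ℕ → Bool) (lo hi : ℕ) :
    sameAdj col lo hi = ∑ x ∈ Finset.Ico lo hi, if col x = col (x + 1) then 1 else 0 := by
  rw [sameAdj, Finset.card_filter]

theorem sameAdj_skip_right (col : ℕ → Bool) {lo hi i : ℕ} (h : i ≤ lo) :
    sameAdj col (lo + 2) (hi + 2) = sameAdj (fun y => col (skip i y)) lo hi := by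
  rw [sameAdj_eq_sum, sameAdj_eq_sum, sum_skip_right _ h]
  refine Finset.sum_congr rfl fun x hx => ?_
  have := Finset.mem_Ico.1 hx
  rw [skip_ge (by omega), skip_ge (by omega)]

theorem sameAdj_skip_left (col : ℕ → Bool) {lo hi i : ℕ} (h : hi < i) :
    sameAdj col lo hi = sameAdj (fun y => col (skip i y)) lo hi := by
  rw [sameAdj_eq_sum, sameAdj_eq_sum]
  refine Finset.sum_congr rfl fun x hx => ?_
  have := Finset.mem_Ico.1 hx
  rw [skip_lt (by omega), skip_lt (by omega)]

theorem sameAdj_skip (col : ℕ → Bool) {lo hi i : ℕ} (h : lo < i) (h' : i ≤ hi)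
    (hne : col i ≠ col (i + 1)) :
    sameAdj col lo (hi + 2) = sameAdj (fun y => col (skip i y)) lo hi +
      2 * if col (i - 1) = col i ∧ col (i + 1) = col (i + 2) then 1 else 0 := by
  obtain ⟨j, rfl⟩ : ∃ j, i = j + 1 := ⟨i - 1, by omega⟩
  have e1 := sameAdj_skip_right col (lo := j + 1) (hi := hi) (i := j + 1) le_rfl
  have e2 := sameAdj_skip_left col (lo := lo) (hi := j) (i := j + 1) (by omega)
  rw [sameAdj_eq_sum, sameAdj_eq_sum] at e1 e2
  rw [sameAdj_eq_sum, sameAdj_eq_sum,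
    ← Finset.sum_Ico_consecutive _ (by omega : lo ≤ j + 3) (by omega : j + 3 ≤ hi + 2), e1,
    Finset.sum_Ico_succ_top (by omega), Finset.sum_Ico_succ_top (by omega),
    Finset.sum_Ico_succ_top (by omega), e2,
    ← Finset.sum_Ico_consecutive _ (by omega : lo ≤ j + 1) h',
    Finset.sum_Ico_succ_top (by omega : lo ≤ j)]
  rw [skip_lt (by omega : j < j + 1), skip_ge le_rfl]
  simp only [Nat.add_sub_cancel, add_assoc, Nat.reduceAdd]
  have : ∀ A B c1 c2 c3 c4 c5 : ℕ, c1 + (c2 + c3) = c4 + c5 →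
      A + (c1 + (c2 + (c3 + B))) = A + (c4 + (B + c5)) := by intros; omega
  apply this
  have hne' : col (j + 1) ≠ col (j + 2) := hne
  revert hne'
  cases col j <;> cases col (j + 1) <;> cases col (j + 2) <;> cases col (j + 3) <;> simp

/-- There is an alternating Hamiltonian path from `0` to `t` with few crossings. -/
def Achieves (col : ℕ → Bool) (N t : ℕ) : Prop :=
  ∃ Q, Valid N col Q ∧ Seg Q 0 t ∧
    2 * cr Q ≤ 2 + sameAdj col 1 (t - 1) + sameAdj col (t + 1) (N - 1)

theorem Achieves.insert_left {col : ℕ → Bool} {N t i : ℕ} (h1 : 1 < i) (h2 : i + 1 ≤ t) (h3 : t + 2 ≤ N)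
    (hne : col i ≠ col (i + 1)) (h : Achieves (fun y => col (skip i y)) N t) :
    Achieves col (N + 2) (t + 2) := by
  obtain ⟨Q, v, s, c⟩ := h
  obtain ⟨Q', v', s', c'⟩ := exists_insert (by omega) (by omega) hne v s
  rw [skip_lt (by omega), skip_ge (by omega)] at s'
  refine ⟨Q', v', s', ?_⟩
  have e1 := sameAdj_skip col (hi := t - 1) h1 (by omega) hne
  have e2 := sameAdj_skip_right col (lo := t + 1) (hi := N - 1) (i := i) (by omega)
  rw [show t - 1 + 2 = t + 2 - 1 by omega] at e1
  rw [show N - 1 + 2 = N + 2 - 1 by omega, show t + 1 + 2 = t + 2 + 1 by omega] at e2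
  omega

theorem Achieves.insert_right {col : ℕ → Bool} {N t i : ℕ} (h1 : t + 1 < i) (h2 : i + 1 ≤ N) (h3 : 1 ≤ t)
    (hne : col i ≠ col (i + 1)) (h : Achieves (fun y => col (skip i y)) N t) :
    Achieves col (N + 2) t := by
  obtain ⟨Q, v, s, c⟩ := h
  obtain ⟨Q', v', s', c'⟩ := exists_insert (by omega) (by omega) hne v s
  rw [skip_lt (by omega), skip_lt (by omega)] at s'
  refine ⟨Q', v', s', ?_⟩
  have e1 := sameAdj_skip_left col (lo := 1) (hi := t - 1) (i := i) (by omega)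
  have e2 := sameAdj_skip col (lo := t + 1) (hi := N - 1) (i := i) h1 (by omega) hne
  rw [show N - 1 + 2 = N + 2 - 1 by omega] at e2
  omega

/-- `1` for the color `a` and `-1` for the other one. -/
def sgn (a : Bool) (col : ℕ → Bool) (x : ℕ) : ℤ := if col x = a then 1 else -1

theorem sgn_pos {a : Bool} {col : ℕ → Bool} {x : ℕ} (h : col x = a) : sgn a col x = 1 := if_pos h

theorem sgn_neg {a : Bool} {col : ℕ → Bool} {x : ℕ} (h : col x ≠ a) : sgn a col x = -1 := if_neg h

theorem sgn_add {a : Bool} {col : ℕ → Bool} {x y : ℕ} (h : col x ≠ col y) :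
    sgn a col x + sgn a col y = 0 := by
  unfold sgn
  revert h
  cases a <;> cases col x <;> cases col y <;> simp

theorem sum_sgn_const {a : Bool} {col : ℕ → Bool} {lo hi : ℕ} {c : ℤ}
    (h : ∀ x, lo ≤ x → x < hi → sgn a col x = c) :
    ∑ x ∈ Finset.Ico lo hi, sgn a col x = ((hi - lo : ℕ) : ℤ) * c := by
  rw [Finset.sum_congr rfl fun x hx => h x (Finset.mem_Ico.1 hx).1 (Finset.mem_Ico.1 hx).2]
  simp

theorem exists_unlike {a : Bool} {col : ℕ → Bool} {lo hi : ℕ} (h : lo < hi)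
    (hs : ∑ x ∈ Finset.Ico lo hi, sgn a col x = 0) :
    ∃ i, lo ≤ i ∧ i + 1 < hi ∧ col i ≠ col (i + 1) := by
  by_contra! hcon
  have hconst : ∀ n, lo + n < hi → col (lo + n) = col lo := by
    intro n
    induction n with
    | zero => simp
    | succ n ih => intro hn; rw [← ih (by omega), ← add_assoc, hcon (lo + n) (by omega) (by omega)]
  rw [sum_sgn_const (c := sgn a col lo) fun x h1 h2 => by
    obtain ⟨n, rfl⟩ := Nat.exists_eq_add_of_le h1
    simp only [sgn, hconst n h2]] at hs
  have h1 : sgn a col lo ≠ 0 := by unfold sgn; split_ifs <;> simp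
  have h2 : ((hi - lo : ℕ) : ℤ) ≠ 0 := by omega
  exact (mul_ne_zero h2 h1) hs

/-- The shape of the color pattern around a doubly crossed edge. -/
structure Pattern (a : Bool) (col : ℕ → Bool) (N t : ℕ) : Prop where
  three_le : 3 ≤ t
  le : t + 3 ≤ N
  zero : col 0 = a
  one : col 1 = a
  pred : col (t - 1) ≠ a
  mid : col t ≠ a
  succ : col (t + 1) ≠ a
  last : col (N - 1) = a
  bal_left : ∑ x ∈ Finset.Ico 1 t, sgn a col x = 0
  bal_right : ∑ x ∈ Finset.Ico (t + 1) N, sgn a col x = 0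

theorem Pattern.skip_right {a : Bool} {col : ℕ → Bool} {N t i : ℕ} (h : Pattern a col (N + 2) t)
    (h1 : t + 1 < i) (h2 : i + 1 ≤ N) (hne : col i ≠ col (i + 1)) :
    Pattern a (fun y => col (skip i y)) N t := by
  have h3 := h.three_le
  refine ⟨h3, by omega, ?_, ?_, ?_, ?_, ?_, ?_, ?_, ?_⟩
  · rw [skip_lt (by omega)]; exact h.zero
  · rw [skip_lt (by omega)]; exact h.one
  · rw [skip_lt (by omega)]; exact h.pred
  · rw [skip_lt (by omega)]; exact h.mid
  · rw [skip_lt (by omega)]; exact h.succ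
  · rw [skip_ge (by omega), show N - 1 + 2 = N + 2 - 1 by omega]; exact h.last
  · rw [← h.bal_left, sum_skip_left (sgn a col) (by omega : t ≤ i)]; rfl
  · have := sum_skip (sgn a col) (by omega : t + 1 ≤ i) (by omega : i ≤ N)
    rw [h.bal_right, sgn_add hne, add_zero] at this
    rw [this]; rfl

theorem Pattern.skip_left {a : Bool} {col : ℕ → Bool} {N t i : ℕ} (h : Pattern a col (N + 2) (t + 2))
    (h1 : 1 < i) (h2 : i + 1 ≤ t) (hne : col i ≠ col (i + 1)) :
    Pattern a (fun y => col (skip i y)) N t := by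
  have h4 := h.le
  refine ⟨by omega, by omega, ?_, ?_, ?_, ?_, ?_, ?_, ?_, ?_⟩
  · rw [skip_lt (by omega)]; exact h.zero
  · rw [skip_lt (by omega)]; exact h.one
  · rw [skip_ge (by omega), show t - 1 + 2 = t + 2 - 1 by omega]; exact h.pred
  · rw [skip_ge (by omega)]; exact h.mid
  · rw [skip_ge (by omega)]; exact h.succ
  · rw [skip_ge (by omega), show N - 1 + 2 = N + 2 - 1 by omega]; exact h.last
  · have := sum_skip (sgn a col) (by omega : 1 ≤ i) (by omega : i ≤ t)
    rw [h.bal_left, sgn_add hne, add_zero] at this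
    rw [this]; rfl
  · have := sum_skip_right (sgn a col) (by omega : i ≤ t + 1) (hi := N)
    rw [show t + 1 + 2 = t + 2 + 1 by omega, h.bal_right] at this
    rw [this]; rfl

theorem Pattern.achieves_base {a : Bool} {col : ℕ → Bool} (h : Pattern a col 10 7) (h2 : col 2 ≠ a)
    (h3 : col 3 ≠ a) (h4 : col 4 = a) (h5 : col 5 = a) : Achieves col 10 7 := by
  have h0 := h.zero
  have h1 := h.one
  have h6 := h.pred
  have h7 := h.mid
  have h8 := h.succ
  have h9 := h.last
  simp only [Nat.reduceSub, Nat.reduceAdd] at h6 h8 h9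
  refine ⟨[0, 2, 1, 3, 9, 8, 4, 6, 5, 7], ⟨by decide, ?_⟩, ⟨rfl, rfl⟩, ?_⟩
  · simp only [Alt, List.isChain_cons_cons, h0, h1, h4, h5, h9]
    simp [h2, h3, h6, h8, Ne.symm h2, Ne.symm h3, Ne.symm h6, Ne.symm h7, Ne.symm h8]
  · have hc : cr [0, 2, 1, 3, 9, 8, 4, 6, 5, 7] = 2 := by decide
    have hs : sameAdj col 1 (7 - 1) = 2 := by
      rw [sameAdj_eq_sum]
      simp only [Nat.reduceSub, Finset.sum_Ico_succ_top (by omega : 1 ≤ 5),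
        Finset.sum_Ico_succ_top (by omega : 1 ≤ 4), Finset.sum_Ico_succ_top (by omega : 1 ≤ 3),
        Finset.sum_Ico_succ_top (by omega : 1 ≤ 2), Finset.sum_Ico_succ_top (by omega : 1 ≤ 1)]
      have e3 : col 3 = col 2 := by
        revert h2 h3; cases a <;> cases col 2 <;> cases col 3 <;> simp
      simp [h1, h4, h5, e3, h2, Ne.symm h2, Ne.symm h6]
    omega

theorem Pattern.achieves {a : Bool} {col : ℕ → Bool} {N t j : ℕ} (h : Pattern a col N t) (hj : j ≤ t)
    (hneg : ∑ x ∈ Finset.Ico 1 j, sgn a col x < 0) : Achieves col N t := by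
  induction hn : N using Nat.strong_induction_on generalizing N col t j with
  | _ n ih =>
  subst hn
  have h3 := h.three_le
  have h4 := h.le
  obtain ⟨M, rfl⟩ : ∃ M, N = M + 2 := ⟨N - 2, by omega⟩
  by_cases hlen : t + 3 < M + 2
  · have hb := h.bal_right
    rw [Finset.sum_Ico_succ_top (by omega), Finset.sum_eq_sum_Ico_succ_bot (by omega),
      sgn_neg h.succ, sgn_pos (show col (M + 1) = a from h.last)] at hb
    obtain ⟨i, i1, i2, i3⟩ := exists_unlike (a := a) (col := col) (lo := t + 1 + 1) (hi := M + 1)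
      (by omega) (by linarith)
    refine Achieves.insert_right (i := i) (by omega) (by omega) (by omega) i3 ?_
    refine ih M (by omega) (h.skip_right (by omega) (by omega) i3) hj ?_ rfl
    rw [sum_skip_left (sgn a col) (by omega : j ≤ i)] at hneg
    exact hneg
  have hM : M = t + 1 := by omega
  subst hM
  obtain ⟨t, rfl⟩ : ∃ s, t = s + 2 := ⟨t - 2, by omega⟩
  by_cases hpeak : ∃ i, 1 < i ∧ i + 1 ≤ t ∧ col i = a ∧ col (i + 1) ≠ a
  · obtain ⟨i, i1, i2, i3, i4⟩ := hpeak
    have hne : col i ≠ col (i + 1) := fun hh => i4 (hh ▸ i3)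
    refine Achieves.insert_left (i := i) i1 i2 (by omega) hne ?_
    obtain ⟨j', hj', hneg'⟩ : ∃ j' ≤ t, ∑ x ∈ Finset.Ico 1 j', sgn a (fun y => col (skip i y)) x < 0 := by
      rcases lt_trichotomy j (i + 1) with h1 | h1 | h1
      · refine ⟨j, by omega, ?_⟩
        rw [sum_skip_left (sgn a col) (by omega : j ≤ i)] at hneg
        exact hneg
      · refine ⟨i, by omega, ?_⟩
        rw [h1, Finset.sum_Ico_succ_top (by omega), sgn_pos i3,
          sum_skip_left (sgn a col) (by omega : i ≤ i)] at hneg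
        have : ∑ x ∈ Finset.Ico 1 i, sgn a col (skip i x) < 0 := by linarith
        exact this
      · obtain ⟨k, rfl⟩ : ∃ k, j = k + 2 := ⟨j - 2, by omega⟩
        refine ⟨k, by omega, ?_⟩
        rw [sum_skip (sgn a col) (by omega : 1 ≤ i) (by omega : i ≤ k), sgn_add hne, add_zero] at hneg
        exact hneg
    exact ih _ (by omega) (h.skip_left i1 i2 hne) hj' hneg' rfl
  push Not at hpeak
  obtain ⟨m, m1, m2, m3, m4⟩ : ∃ m, 2 ≤ m ∧ m ≤ t + 1 ∧ (∀ x, 2 ≤ x → x < m → col x ≠ a) ∧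
      ∀ x, m ≤ x → x < t + 1 → col x = a := by
    have hex : ∃ m, 2 ≤ m ∧ (col m = a ∨ t + 1 ≤ m) := ⟨t + 1, by omega, Or.inr le_rfl⟩
    obtain ⟨g1, g2⟩ := Nat.find_spec hex
    have gmin := fun k (hk : k < Nat.find hex) => Nat.find_min hex hk
    generalize Nat.find hex = m at *
    have gt : m ≤ t + 1 := by
      by_contra hh
      exact gmin (t + 1) (by omega) ⟨by omega, Or.inr le_rfl⟩
    refine ⟨m, g1, gt, fun x x1 x2 hx => gmin x x2 ⟨x1, Or.inl hx⟩, ?_⟩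
    intro x hx
    induction x, hx using Nat.le_induction with
    | base => intro hm; exact g2.resolve_right (by omega)
    | succ x hx ihx => intro hm; exact hpeak x (by omega) (by omega) (ihx (by omega))
  have hpred : col (t + 1) ≠ a := h.pred
  have hsum := h.bal_left
  rw [← Finset.sum_Ico_consecutive _ (by omega : 1 ≤ m) (by omega : m ≤ t + 2),
    Finset.sum_Ico_succ_top (by omega : m ≤ t + 1), Finset.sum_eq_sum_Ico_succ_bot (by omega),
    sum_sgn_const (c := -1) fun x x1 x2 => sgn_neg (m3 x (by omega) x2),
    sum_sgn_const (c := 1) fun x x1 x2 => sgn_pos (m4 x (by omega) x2),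
    sgn_pos h.one, sgn_neg hpred] at hsum
  have ht : t + 3 = 2 * m := by omega
  rcases lt_or_ge m 4 with hm | hm
  · exfalso
    have s1 := sgn_pos h.one
    interval_cases m
    · have : t = 1 := by omega
      subst this
      have s2 := sgn_neg hpred
      interval_cases j <;> simp [Finset.sum_Ico_succ_top, s1, s2] at hneg
    · have : t = 3 := by omega
      subst this
      have s2 := sgn_neg (m3 2 le_rfl (by omega))
      have s3 := sgn_pos (m4 3 le_rfl (by omega))
      have s4 := sgn_neg hpred
      interval_cases j <;> simp [Finset.sum_Ico_succ_top, s1, s2, s3, s4] at hneg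
  rcases hm.eq_or_lt with hm | hm
  · subst hm
    have : t = 5 := by omega
    subst this
    exact h.achieves_base (m3 2 le_rfl (by omega)) (m3 3 (by omega) (by omega))
      (m4 4 le_rfl (by omega)) (m4 5 (by omega) (by omega))
  · have hne : col (m - 1) ≠ col (m - 1 + 1) := by
      rw [show m - 1 + 1 = m by omega, m4 m le_rfl (by omega)]
      exact m3 (m - 1) (by omega) (by omega)
    refine Achieves.insert_left (i := m - 1) (by omega) (by omega) (by omega) hne ?_
    refine ih _ (by omega) (h.skip_left (by omega) (by omega) hne) (j := 4) (by omega) ?_ rfl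
    have hs := sum_skip_left (sgn a col) (lo := 1) (hi := 4) (i := m - 1) (by omega)
    have : ∑ x ∈ Finset.Ico 1 4, sgn a col x < 0 := by
      simp [Finset.sum_Ico_succ_top, sgn_pos h.one, sgn_neg (m3 2 le_rfl (by omega)),
        sgn_neg (m3 3 (by omega) (by omega))]
    rw [hs] at this
    exact this

theorem sum_sgn_pairs {a : Bool} {col : ℕ → Bool} {M : List (ℕ × ℕ)}
    (h : ∀ e ∈ M, col e.1 ≠ col e.2) :
    ((M.map Prod.fst ++ M.map Prod.snd).map (sgn a col)).sum = 0 := by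
  induction M with
  | nil => simp
  | cons e M ih =>
    have h1 := ih fun f hf => h f (List.mem_cons_of_mem _ hf)
    have h2 := sgn_add (a := a) (h e List.mem_cons_self)
    simp only [List.map_append, List.map_cons, List.sum_append, List.sum_cons] at h1 ⊢
    linarith

theorem Alt.sum_sgn {a : Bool} {col : ℕ → Bool} {s : List ℕ} {p q lo hi : ℕ} (h : Alt col s)
    (hs : Seg s p q) (hne : col p ≠ col q) (hnd : s.Nodup) (hm : ∀ z, z ∈ s ↔ lo ≤ z ∧ z < hi) :
    ∑ x ∈ Finset.Ico lo hi, sgn a col x = 0 := by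
  have hp := perm_pairsOf (h.even_length hs hne)
  have h1 : ∑ x ∈ Finset.Ico lo hi, sgn a col x = (s.map (sgn a col)).sum := by
    rw [← List.sum_toFinset _ hnd]
    exact Finset.sum_congr (by ext z; simp [hm]) fun _ _ => rfl
  rw [h1, ← (hp.map _).sum_eq]
  refine sum_sgn_pairs fun e he => ?_
  cases s with
  | nil => simp [pairsOf] at he
  | cons x t =>
    obtain ⟨h2, h3⟩ := h.color_pairsOf e he
    rw [h2]
    exact h3.symm

theorem TwoBlocks.pattern {N : ℕ} {col : ℕ → Bool} {s2 s3 : List ℕ} {t : ℕ}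
    (H : TwoBlocks N col s2 s3 t) : Pattern (col 0) col N t := by
  obtain ⟨A2, A3, c1, c2, c3⟩ := H.color
  have i1 := H.three_le
  have i2 := H.lt
  have hp : ∀ z, z ∈ [0] ++ s2 ++ s3 ++ [t] ↔ z < N := fun z => by
    rw [H.opt.1.1.mem_iff, List.mem_range]
  have hnd := H.opt.nodup
  have hnd2 : s2.Nodup := (List.nodup_append.1 (List.nodup_append.1
    (List.nodup_append.1 hnd).1).1).2.1
  have hnd3 : s3.Nodup := (List.nodup_append.1 (List.nodup_append.1 hnd).1).2.1
  simp only [List.mem_append, List.mem_singleton] at hp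
  have i3 : t + 1 ≠ N - 1 := fun h => by
    rw [h, H.color_last] at c1
    exact c1 rfl
  refine ⟨i1, by omega, rfl, H.color_one, ?_, ?_, c1.symm, H.color_last, ?_, ?_⟩
  · rw [← H.color_last]; exact c2.symm
  · rw [← H.color_one]; exact c3.symm
  · refine A3.sum_sgn H.seg3 (by rw [H.color_one, ← H.color_last]; exact c2.symm) hnd3
      fun z => ⟨fun hz => by have := H.lt3 z hz; omega, fun hz => ?_⟩
    rcases (hp z).2 (by omega) with ((h | h) | h) | h
    · omega
    · have := H.gt2 z h; omega
    · exact h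
    · omega
  · refine A2.sum_sgn H.seg2 (by rw [H.color_last]; exact c1.symm) hnd2
      fun z => ⟨fun hz => ?_, fun hz => ?_⟩
    · have := H.gt2 z hz
      have := (hp z).1 (by tauto)
      omega
    rcases (hp z).2 (by omega) with ((h | h) | h) | h
    · omega
    · exact h
    · have := H.lt3 z h; omega
    · omega

theorem Opt.not_achieves {N : ℕ} {col : ℕ → Bool} {l : List ℕ} {t : ℕ} (h : Opt N col l)
    (hs : Seg l 0 t) (hl : 4 + sameAdj col 1 (t - 1) + sameAdj col (t + 1) (N - 1) ≤ 2 * cr l) :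
    ¬ Achieves col N t := by
  rintro ⟨Q, h1, h2, h3⟩
  have := h.2 Q h1 (h2.1.trans hs.1.symm) (h2.2.trans hs.2.symm)
  omega

/-- Reflection of the circular order fixing `0`. -/
def mir (N x : ℕ) : ℕ := if x = 0 then 0 else N - x

theorem mir_zero {N : ℕ} : mir N 0 = 0 := rfl

theorem mir_pos {N x : ℕ} (h : x ≠ 0) : mir N x = N - x := if_neg h

theorem sum_mir (f : ℕ → ℤ) {N i j : ℕ} (h1 : 1 ≤ i) (_ : i ≤ j) (h3 : j ≤ N) :
    ∑ x ∈ Finset.Ico i j, f (mir N x) = ∑ x ∈ Finset.Ico (N + 1 - j) (N + 1 - i), f x := by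
  rw [← Finset.sum_Ico_reflect f i (by omega : j ≤ N + 1)]
  refine Finset.sum_congr rfl fun x hx => ?_
  rw [Finset.mem_Ico] at hx
  rw [mir_pos (by omega)]

theorem sameAdj_mir (col : ℕ → Bool) {N i j : ℕ} (h1 : 1 ≤ i) (h2 : i ≤ j) (h3 : j < N) :
    sameAdj (fun x => col (mir N x)) i j = sameAdj col (N - j) (N - i) := by
  unfold sameAdj
  refine Finset.card_nbij' (fun x => N - 1 - x) (fun x => N - 1 - x) ?_ ?_ ?_ ?_
  · intro x hx
    simp only [Finset.coe_filter, Finset.mem_Ico, Set.mem_ofPred_eq] at hx ⊢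
    obtain ⟨⟨h4, h5⟩, h6⟩ := hx
    rw [mir_pos (by omega), mir_pos (by omega)] at h6
    refine ⟨by omega, ?_⟩
    rw [show N - 1 - x + 1 = N - x by omega, show N - 1 - x = N - (x + 1) by omega]
    exact h6.symm
  · intro x hx
    simp only [Finset.coe_filter, Finset.mem_Ico, Set.mem_ofPred_eq] at hx ⊢
    obtain ⟨⟨h4, h5⟩, h6⟩ := hx
    rw [mir_pos (by omega), mir_pos (by omega)]
    refine ⟨by omega, ?_⟩
    rw [show N - (N - 1 - x) = x + 1 by omega, show N - (N - 1 - x + 1) = x by omega]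
    exact h6.symm
  · intro x hx
    simp only [Finset.coe_filter, Finset.mem_Ico, Set.mem_ofPred_eq] at hx
    dsimp only
    omega
  · intro x hx
    simp only [Finset.coe_filter, Finset.mem_Ico, Set.mem_ofPred_eq] at hx
    dsimp only
    omega

theorem Pattern.mir {a : Bool} {col : ℕ → Bool} {N t : ℕ} (h : Pattern a col N t) :
    Pattern a (fun x => col (mir N x)) N (N - t) := by
  have h1 := h.three_le
  have h2 := h.le
  refine ⟨by omega, by omega, h.zero, ?_, ?_, ?_, ?_, ?_, ?_, ?_⟩
  · rw [mir_pos (by omega)]; exact h.last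
  · rw [mir_pos (by omega), show N - (N - t - 1) = t + 1 by omega]; exact h.succ
  · rw [mir_pos (by omega), show N - (N - t) = t by omega]; exact h.mid
  · rw [mir_pos (by omega), show N - (N - t + 1) = t - 1 by omega]; exact h.pred
  · rw [mir_pos (by omega), show N - (N - 1) = 1 by omega]; exact h.one
  · have := sum_mir (sgn a col) (by omega : 1 ≤ 1) (by omega : 1 ≤ N - t) (by omega : N - t ≤ N)
    rw [show N + 1 - (N - t) = t + 1 by omega, Nat.add_sub_cancel, h.bal_right] at this
    exact this
  · have := sum_mir (sgn a col) (by omega : 1 ≤ N - t + 1) (by omega : N - t + 1 ≤ N) le_rfl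
    rw [show N + 1 - (N - t + 1) = t by omega, show N + 1 - N = 1 by omega, h.bal_left] at this
    exact this

/-- The circular color sequence of a special configuration with distinguished points `0`
and `t`. -/
structure Ballot (a : Bool) (col : ℕ → Bool) (N t : ℕ) : Prop extends Pattern a col N t where
  left : ∀ j ≤ t, 0 ≤ ∑ x ∈ Finset.Ico 1 j, sgn a col x
  right : ∀ j, t < j → j ≤ N → 0 ≤ ∑ x ∈ Finset.Ico j N, sgn a col x

theorem TwoBlocks.ballot {N : ℕ} {col : ℕ → Bool} {s2 s3 : List ℕ} {t : ℕ}
    (H : TwoBlocks N col s2 s3 t) : Ballot (col 0) col N t := by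
  have hP := H.pattern
  have h1 := hP.three_le
  have h2 := hP.le
  have hseg : Seg ([0] ++ s2 ++ s3 ++ [t]) 0 t :=
    (((Seg.singleton 0).append H.seg2).append H.seg3).append (Seg.singleton t)
  refine ⟨hP, fun j hj => ?_, fun j hj hj' => ?_⟩
  · by_contra hcon
    exact H.opt.not_achieves hseg H.sameAdj_le (hP.achieves hj (not_le.1 hcon))
  · by_contra hcon
    have hopt := ((Dih.id (N := N)).refl.relabel).opt H.opt
    have hcr := ((Dih.id (N := N)).refl.relabel).cr (l := [0] ++ s2 ++ s3 ++ [t])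
      fun x hx => H.opt.lt hx
    have hseg' := hseg.map (mir N)
    rw [mir_pos (by omega : t ≠ 0), mir_zero] at hseg'
    have hneg := sum_mir (sgn (col 0) col) (by omega : 1 ≤ 1) (by omega : 1 ≤ N + 1 - j)
      (by omega : N + 1 - j ≤ N)
    rw [show N + 1 - (N + 1 - j) = j by omega, Nat.add_sub_cancel] at hneg
    have e1 := sameAdj_mir col (by omega : 1 ≤ 1) (by omega : 1 ≤ N - t - 1) (by omega : N - t - 1 < N)
    have e2 := sameAdj_mir col (by omega : 1 ≤ N - t + 1) (by omega : N - t + 1 ≤ N - 1)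
      (by omega : N - 1 < N)
    rw [show N - (N - t - 1) = t + 1 by omega] at e1
    rw [show N - (N - 1) = 1 by omega, show N - (N - t + 1) = t - 1 by omega] at e2
    have hle := H.sameAdj_le
    refine Opt.not_achieves hopt hseg' ?_ (hP.mir.achieves (by omega : N + 1 - j ≤ N - t) ?_)
    · change _ ≤ 2 * cr (([0] ++ s2 ++ s3 ++ [t]).map (mir N))
      change cr (([0] ++ s2 ++ s3 ++ [t]).map (mir N)) = _ at hcr
      rw [hcr]
      change 4 + sameAdj (fun x => col (mir N x)) 1 (N - t - 1) +
        sameAdj (fun x => col (mir N x)) (N - t + 1) (N - 1) ≤ _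
      omega
    · change ∑ x ∈ Finset.Ico 1 (N + 1 - j), sgn (col 0) col (mir N x) < 0
      omega

theorem Ballot.mir {a : Bool} {col : ℕ → Bool} {N t : ℕ} (h : Ballot a col N t) :
    Ballot a (fun x => col (mir N x)) N (N - t) := by
  have h1 := h.three_le
  have h2 := h.le
  refine ⟨h.toPattern.mir, fun j hj => ?_, fun j hj hj' => ?_⟩
  · rcases Nat.eq_zero_or_pos j with rfl | hj0
    · simp
    · have := sum_mir (sgn a col) (by omega : 1 ≤ 1) (by omega : 1 ≤ j) (by omega : j ≤ N)
      rw [Nat.add_sub_cancel] at this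
      refine le_of_le_of_eq (h.right (N + 1 - j) (by omega) (by omega)) this.symm
  · have := sum_mir (sgn a col) (by omega : 1 ≤ j) (by omega : j ≤ N) le_rfl
    rw [show N + 1 - N = 1 by omega] at this
    refine le_of_le_of_eq (h.left (N + 1 - j) (by omega)) this.symm

/-- Rotation of the circular order moving `t` to `0`. -/
def spin (N t x : ℕ) : ℕ := if x + t < N then x + t else x + t - N

theorem sum_spin_left (f : ℕ → ℤ) {N t i j : ℕ} (h : j + t ≤ N) :
    ∑ x ∈ Finset.Ico i j, f (spin N t x) = ∑ x ∈ Finset.Ico (i + t) (j + t), f x := by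
  rw [← Finset.sum_Ico_add']
  refine Finset.sum_congr rfl fun x hx => ?_
  rw [Finset.mem_Ico] at hx
  rw [spin, if_pos (by omega)]

theorem sum_spin_right (f : ℕ → ℤ) {N t i j : ℕ} (h1 : N ≤ i + t) (h : t ≤ N) (h2 : i ≤ j) :
    ∑ x ∈ Finset.Ico i j, f (spin N t x) = ∑ x ∈ Finset.Ico (i + t - N) (j + t - N), f x := by
  have h3 := Finset.sum_Ico_add' f (i + t - N) (j + t - N) (N - t)
  rw [show i + t - N + (N - t) = i by omega, show j + t - N + (N - t) = j by omega] at h3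
  have h4 := Finset.sum_Ico_add' (fun x => f (spin N t x)) (i + t - N) (j + t - N) (N - t)
  rw [show i + t - N + (N - t) = i by omega, show j + t - N + (N - t) = j by omega] at h4
  rw [← h4]
  refine Finset.sum_congr rfl fun x hx => ?_
  rw [spin, if_neg (by omega)]
  congr 1
  omega

theorem sgn_not (a : Bool) (col : ℕ → Bool) (x : ℕ) : sgn (!a) col x = -sgn a col x := by
  unfold sgn
  cases a <;> cases col x <;> simp

theorem Ballot.spin {a : Bool} {col : ℕ → Bool} {N t : ℕ} (h : Ballot a col N t) :
    Ballot (!a) (fun x => col (spin N t x)) N (N - t) := by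
  have h1 := h.three_le
  have h2 := h.le
  have hn : ∀ x, col x ≠ a → col x = !a := fun x hx => by
    revert hx; cases a <;> cases col x <;> simp
  have hn' : ∀ x, col x = a → col x ≠ !a := fun x hx => by
    revert hx; cases a <;> cases col x <;> simp
  have hs : ∀ i j, ∑ x ∈ Finset.Ico i j, sgn (!a) (fun x => col (_root_.spin N t x)) x =
      -∑ x ∈ Finset.Ico i j, sgn a col (_root_.spin N t x) := fun i j => by
    rw [← Finset.sum_neg_distrib]
    exact Finset.sum_congr rfl fun x _ => sgn_not a _ x
  have e1 : ∀ x, x < N - t → _root_.spin N t x = x + t := fun x hx => if_pos (by omega)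
  have e2 : ∀ x, N - t ≤ x → _root_.spin N t x = x + t - N := fun x hx => if_neg (by omega)
  refine ⟨⟨by omega, by omega, ?_, ?_, ?_, ?_, ?_, ?_, ?_, ?_⟩, fun j hj => ?_, fun j hj hj' => ?_⟩
  · rw [e1 _ (by omega), zero_add]; exact hn _ h.mid
  · rw [e1 _ (by omega), add_comm]; exact hn _ h.succ
  · rw [e1 _ (by omega), show N - t - 1 + t = N - 1 by omega]; exact hn' _ h.last
  · rw [e2 _ (by omega), show N - t + t - N = 0 by omega]; exact hn' _ h.zero
  · rw [e2 _ (by omega), show N - t + 1 + t - N = 1 by omega]; exact hn' _ h.one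
  · rw [e2 _ (by omega), show N - 1 + t - N = t - 1 by omega]; exact hn _ h.pred
  · rw [hs, sum_spin_left _ (by omega), show N - t + t = N by omega, add_comm 1 t, h.bal_right,
      neg_zero]
  · rw [hs, sum_spin_right _ (by omega) (by omega) (by omega),
      show N - t + 1 + t - N = 1 by omega, show N + t - N = t by omega, h.bal_left, neg_zero]
  · rcases Nat.eq_zero_or_pos j with rfl | hj0
    · simp
    · rw [hs, sum_spin_left _ (by omega)]
      have h3 := h.right (j + t) (by omega) (by omega)
      have h4 := Finset.sum_Ico_consecutive (sgn a col) (by omega : t + 1 ≤ j + t)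
        (by omega : j + t ≤ N)
      rw [h.bal_right] at h4
      rw [add_comm 1 t]
      linarith
  · rw [hs, sum_spin_right _ (by omega) (by omega) (by omega), show N + t - N = t by omega]
    have h3 := h.left (j + t - N) (by omega)
    have h4 := Finset.sum_Ico_consecutive (sgn a col) (by omega : 1 ≤ j + t - N)
      (by omega : j + t - N ≤ t)
    rw [h.bal_left] at h4
    linarith

/-- A listing of the points of `S` in circular order. -/
structure Listing (S : Finset Pt) (N : ℕ) (pt : ℕ → Pt) (ε : ℝ) : Prop where
  inj : ∀ i < N, ∀ j < N, pt i = pt j → i = j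
  mem : ∀ z, z ∈ S ↔ ∃ i < N, pt i = z
  sign : ε = 1 ∨ ε = -1
  pos : ∀ i j k, i < j → j < k → k < N → 0 < ε * det2 (pt i) (pt j) (pt k)

theorem det2_rotate (a b c : Pt) : det2 b c a = det2 a b c := by
  unfold det2; ring

theorem det2_swap (a b c : Pt) : det2 b a c = -det2 a b c := by
  unfold det2; ring

theorem det2_swap' (a b c : Pt) : det2 a c b = -det2 a b c := by
  unfold det2; ring

theorem det2_reverse (a b c : Pt) : det2 c b a = -det2 a b c := by
  unfold det2; ring

theorem exists_enum (T : Finset Pt) (key : Pt → ℝ)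
    (hk : ∀ x ∈ T, ∀ y ∈ T, key x = key y → x = y) :
    ∃ g : ℕ → Pt, (∀ z, z ∈ T ↔ ∃ i < T.card, g i = z) ∧
      ∀ i j, i < j → j < T.card → key (g i) < key (g j) := by
  have hK : (T.image key).card = T.card := Finset.card_image_of_injOn fun x hx y hy h => hk x hx y hy h
  set emb := (T.image key).orderEmbOfFin hK with hemb
  have hex : ∀ i : Fin T.card, ∃ z ∈ T, key z = emb i := fun i =>
    Finset.mem_image.1 (Finset.orderEmbOfFin_mem _ hK i)
  choose z hz1 hz2 using hex
  refine ⟨fun i => if h : i < T.card then z ⟨i, h⟩ else 0, fun w => ⟨fun hw => ?_, ?_⟩,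
    fun i j hij hj => ?_⟩
  · have h1 : key w ∈ Set.range emb := by
      rw [hemb, Finset.range_orderEmbOfFin]
      exact Finset.mem_coe.2 (Finset.mem_image_of_mem _ hw)
    obtain ⟨i, hi⟩ := h1
    refine ⟨i, i.2, ?_⟩
    dsimp only
    rw [dif_pos i.2]
    exact hk _ (hz1 _) _ hw ((hz2 _).trans hi)
  · rintro ⟨i, hi, rfl⟩
    dsimp only
    rw [dif_pos hi]
    exact hz1 _
  · dsimp only
    rw [dif_pos hj, dif_pos (hij.trans hj), hz2, hz2]
    exact emb.lt_iff_lt.2 hij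

theorem not_mem_triangle {S : Finset Pt} (hS : ConvexPosition S) {p a b c : Pt} (hp : p ∈ S) (ha : a ∈ S)
    (hb : b ∈ S) (hc : c ∈ S) (h1 : p ≠ b) (h2 : a ≠ b) (h3 : c ≠ b) {x y z : ℝ} (hx : 0 ≤ x)
    (hy : 0 ≤ y) (hz : 0 ≤ z) (h : x + y + z = 1) : x • p + y • a + z • c ≠ b := by
  intro he
  apply hS b hb
  have hsub := subset_convexHull ℝ ((S.erase b : Finset Pt) : Set Pt)
  have hm : ∀ w ∈ S, w ≠ b → w ∈ convexHull ℝ ((S.erase b : Finset Pt) : Set Pt) := fun w hw hwb =>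
    hsub (Finset.mem_coe.2 (Finset.mem_erase.2 ⟨hwb, hw⟩))
  have := (convex_convexHull ℝ ((S.erase b : Finset Pt) : Set Pt)).sum_mem
    (t := Finset.univ) (w := ![x, y, z]) (z := ![p, a, c])
    (by intro i _; fin_cases i <;> simpa) (by simp [Fin.sum_univ_three, h])
    (by intro i _; fin_cases i; exacts [hm _ hp h1, hm _ ha h2, hm _ hc h3])
  simp only [Fin.sum_univ_three] at this
  rw [← he] at this ⊢
  exact this

/-- A sorting key for the slopes of the lines through `p`. -/
def slopeKey (α β : ℝ) (p s : Pt) : ℝ :=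
  (-β * (s.1 - p.1) + α * (s.2 - p.2)) / (α * (p.1 - s.1) + β * (p.2 - s.2))

theorem det2_slopeKey {α β : ℝ} {p a b : Pt} (ha : 0 < α * (p.1 - a.1) + β * (p.2 - a.2))
    (hb : 0 < α * (p.1 - b.1) + β * (p.2 - b.2)) :
    (α ^ 2 + β ^ 2) * det2 p a b =
      (α * (p.1 - a.1) + β * (p.2 - a.2)) * (α * (p.1 - b.1) + β * (p.2 - b.2)) *
        (slopeKey α β p a - slopeKey α β p b) := by
  have h : ∀ x y u v : ℝ, u ≠ 0 → v ≠ 0 → u * v * (x / u - y / v) = x * v - y * u := by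
    intro x y u v hu hv
    field_simp
  unfold slopeKey det2
  rw [h _ _ _ _ ha.ne' hb.ne']
  ring

theorem ConvexPosition.exists_listing {S : Finset Pt} (hS : ConvexPosition S) {p : Pt} (hp : p ∈ S) :
    ∃ pt : ℕ → Pt, Listing S S.card pt (-1) := by
  obtain ⟨f, u, hf1, hf2⟩ := geometric_hahn_banach_closed_point (convex_convexHull ℝ _)
    (Set.Finite.isClosed_convexHull (𝕜 := ℝ) (Finset.finite_toSet (S.erase p))) (hS p hp)
  obtain ⟨α, β, hf⟩ : ∃ α β : ℝ, ∀ s : Pt, f s = α * s.1 + β * s.2 := by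
    refine ⟨f (1, 0), f (0, 1), fun s => ?_⟩
    have : s = s.1 • ((1, 0) : Pt) + s.2 • ((0, 1) : Pt) := by ext <;> simp
    conv_lhs => rw [this]
    rw [map_add, map_smul, map_smul, smul_eq_mul, smul_eq_mul]
    ring
  have hw : ∀ s ∈ S.erase p, 0 < α * (p.1 - s.1) + β * (p.2 - s.2) := fun s hs => by
    have h1 := hf1 s (subset_convexHull ℝ _ (Finset.mem_coe.2 hs))
    rw [hf] at h1 hf2
    linarith
  have hkey : ∀ x ∈ S.erase p, ∀ y ∈ S.erase p, slopeKey α β p x = slopeKey α β p y → x = y := by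
    intro x hx y hy h
    wlog hle : α * (p.1 - x.1) + β * (p.2 - x.2) ≤ α * (p.1 - y.1) + β * (p.2 - y.2) generalizing x y
    · exact (this y hy x hx h.symm (le_of_lt (not_le.1 hle))).symm
    by_contra hne
    have wx := hw x hx
    have wy := hw y hy
    have hd := det2_slopeKey wx wy
    rw [h, sub_self, mul_zero] at hd
    have hαβ : α ^ 2 + β ^ 2 ≠ 0 := by
      intro h0
      have h1 : α = 0 := by nlinarith [sq_nonneg α, sq_nonneg β]
      have h2 : β = 0 := by nlinarith [sq_nonneg α, sq_nonneg β]
      simp [h1, h2] at wx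
    have hd0 := (mul_eq_zero.1 hd).resolve_left hαβ
    obtain ⟨hxp, hxS⟩ := Finset.mem_erase.1 hx
    obtain ⟨hyp, hyS⟩ := Finset.mem_erase.1 hy
    set l := (α * (p.1 - x.1) + β * (p.2 - x.2)) / (α * (p.1 - y.1) + β * (p.2 - y.2)) with hl
    have hl0 : 0 < l := div_pos wx wy
    have hl1 : l ≤ 1 := (div_le_one wy).2 hle
    refine not_mem_triangle hS hp hyS hxS hyS hxp.symm (Ne.symm hne) (Ne.symm hne) (x := 1 - l)
      (y := l) (z := 0) (by linarith) hl0.le le_rfl (by ring) ?_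
    have hly : l * (α * (p.1 - y.1) + β * (p.2 - y.2)) = α * (p.1 - x.1) + β * (p.2 - x.2) :=
      div_mul_cancel₀ _ wy.ne'
    unfold det2 at hd0
    have e1 : (1 - l) * p.1 + l * y.1 = x.1 := by
      refine mul_right_cancel₀ wy.ne' ?_
      linear_combination (y.1 - p.1) * hly + β * hd0
    have e2 : (1 - l) * p.2 + l * y.2 = x.2 := by
      refine mul_right_cancel₀ wy.ne' ?_
      linear_combination (y.2 - p.2) * hly - α * hd0
    ext
    · simpa using e1
    · simpa using e2
  obtain ⟨g, hg1, hg2⟩ := exists_enum (S.erase p) (slopeKey α β p) hkey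
  have hcard : S.card = (S.erase p).card + 1 := (Finset.card_erase_add_one hp).symm
  have hgm : ∀ i < (S.erase p).card, g i ∈ S.erase p := fun i hi => (hg1 _).2 ⟨i, hi, rfl⟩
  have hdet : ∀ i j, i < j → j < (S.erase p).card → det2 p (g i) (g j) < 0 := by
    intro i j hij hj
    have wi := hw _ (hgm i (hij.trans hj))
    have wj := hw _ (hgm j hj)
    have h1 := det2_slopeKey wi wj
    have h2 := hg2 i j hij hj
    have h3 := mul_pos wi wj
    have h4 : (α ^ 2 + β ^ 2) * det2 p (g i) (g j) < 0 := by
      rw [h1]; exact mul_neg_of_pos_of_neg h3 (by linarith)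
    by_contra h5
    have := mul_nonneg (by positivity : 0 ≤ α ^ 2 + β ^ 2) (not_lt.1 h5)
    linarith
  refine ⟨fun i => if i = 0 then p else g (i - 1), fun i hi j hj h => ?_, fun z => ?_, Or.inr rfl,
    fun i j k hij hjk hk => ?_⟩
  · split_ifs at h with h1 h2 h2
    · omega
    · exact absurd h.symm (Finset.mem_erase.1 (hgm (j - 1) (by omega))).1
    · exact absurd h (Finset.mem_erase.1 (hgm (i - 1) (by omega))).1
    · rcases lt_trichotomy (i - 1) (j - 1) with h3 | h3 | h3
      · have := hg2 _ _ h3 (by omega); rw [h] at this; exact absurd this (lt_irrefl _)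
      · omega
      · have := hg2 _ _ h3 (by omega); rw [h] at this; exact absurd this (lt_irrefl _)
  · constructor
    · intro hz
      by_cases h : z = p
      · exact ⟨0, by omega, by simp [h]⟩
      · obtain ⟨i, hi, h1⟩ := (hg1 z).1 (Finset.mem_erase.2 ⟨h, hz⟩)
        exact ⟨i + 1, by omega, by simp [h1]⟩
    · rintro ⟨i, hi, rfl⟩
      split_ifs
      · exact hp
      · exact Finset.mem_of_mem_erase (hgm (i - 1) (by omega))
  · have hj0 : j ≠ 0 := by omega
    have hk0 : k ≠ 0 := by omega
    simp only [if_neg hj0, if_neg hk0]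
    have d2 := hdet (j - 1) (k - 1) (by omega) (by omega)
    split_ifs with hi0
    · linarith
    · have d1 := hdet (i - 1) (j - 1) (by omega) (by omega)
      have d3 := hdet (i - 1) (k - 1) (by omega) (by omega)
      have m1 := hgm (i - 1) (by omega)
      have m2 := hgm (j - 1) (by omega)
      have m3 := hgm (k - 1) (by omega)
      have n1 : g (i - 1) ≠ g (j - 1) := fun h => by
        have := hg2 (i - 1) (j - 1) (by omega) (by omega)
        rw [h] at this; exact lt_irrefl _ this
      have n2 : g (k - 1) ≠ g (j - 1) := fun h => by
        have := hg2 (j - 1) (k - 1) (by omega) (by omega)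
        rw [h] at this; exact lt_irrefl _ this
      generalize g (i - 1) = a at *
      generalize g (j - 1) = b at *
      generalize g (k - 1) = c at *
      obtain ⟨nb, mb⟩ := Finset.mem_erase.1 m2
      by_contra hcon
      have hD : det2 a b c = det2 p a b + det2 p b c - det2 p a c := by unfold det2; ring
      have hneg : 0 < -det2 p a c := by linarith
      refine not_mem_triangle hS hp (Finset.mem_of_mem_erase m1) mb (Finset.mem_of_mem_erase m3)
        nb.symm n1 n2 (x := det2 a b c / -det2 p a c) (y := -det2 p b c / -det2 p a c)
        (z := -det2 p a b / -det2 p a c) (div_nonneg (by linarith) hneg.le)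
        (div_nonneg (by linarith) hneg.le) (div_nonneg (by linarith) hneg.le) ?_ ?_
      · rw [← add_div, ← add_div, div_eq_one_iff_eq hneg.ne']; linarith
      · have hne : det2 p a c ≠ 0 := d3.ne
        ext
        · simp only [Prod.fst_add, Prod.smul_fst, smul_eq_mul]
          field_simp
          unfold det2
          ring
        · simp only [Prod.snd_add, Prod.smul_snd, smul_eq_mul]
          field_simp
          unfold det2
          ring

theorem Listing.congr {S : Finset Pt} {N : ℕ} {pt pt' : ℕ → Pt} {ε : ℝ} (h : Listing S N pt ε)
    (he : ∀ i < N, pt' i = pt i) : Listing S N pt' ε := by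
  refine ⟨fun i hi j hj => ?_, fun z => ?_, h.sign, fun i j k hij hjk hk => ?_⟩
  · rw [he i hi, he j hj]; exact h.inj i hi j hj
  · rw [h.mem]
    exact exists_congr fun i => and_congr_right fun hi => by rw [he i hi]
  · rw [he i (by omega), he j (by omega), he k hk]; exact h.pos i j k hij hjk hk

theorem Listing.mir {S : Finset Pt} {N : ℕ} {pt : ℕ → Pt} {ε : ℝ} (h : Listing S N pt ε) :
    Listing S N (fun x => pt (mir N x)) (-ε) := by
  refine ⟨fun i hi j hj he => ?_, fun z => ?_, ?_, fun i j k hij hjk hk => ?_⟩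
  · have := h.inj _ (by unfold _root_.mir; split_ifs <;> omega) _
      (by unfold _root_.mir; split_ifs <;> omega) he
    unfold _root_.mir at this
    split_ifs at this <;> omega
  · rw [h.mem]
    constructor
    · rintro ⟨i, hi, rfl⟩
      refine ⟨_root_.mir N i, by unfold _root_.mir; split_ifs <;> omega, ?_⟩
      congr 1
      unfold _root_.mir; split_ifs <;> omega
    · rintro ⟨i, hi, rfl⟩
      exact ⟨_root_.mir N i, by unfold _root_.mir; split_ifs <;> omega, rfl⟩
  · rcases h.sign with h | h <;> simp [h]
  · rw [mir_pos (by omega : j ≠ 0), mir_pos (by omega : k ≠ 0)]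
    rcases Nat.eq_zero_or_pos i with rfl | hi
    · rw [mir_zero, det2_swap', neg_mul_neg]
      exact h.pos _ _ _ (by omega) (by omega) (by omega)
    · rw [mir_pos (by omega : i ≠ 0), det2_reverse, neg_mul_neg]
      exact h.pos _ _ _ (by omega) (by omega) (by omega)

theorem Listing.spin {S : Finset Pt} {N t : ℕ} {pt : ℕ → Pt} {ε : ℝ} (h : Listing S N pt ε)
    (ht : t ≤ N) : Listing S N (fun x => pt (spin N t x)) ε := by
  have hlt : ∀ i < N, _root_.spin N t i < N := fun i hi => by
    unfold _root_.spin; split_ifs <;> omega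
  refine ⟨fun i hi j hj he => ?_, fun z => ?_, h.sign, fun i j k hij hjk hk => ?_⟩
  · have := h.inj _ (hlt i hi) _ (hlt j hj) he
    unfold _root_.spin at this
    split_ifs at this <;> omega
  · rw [h.mem]
    constructor
    · rintro ⟨i, hi, rfl⟩
      refine ⟨_root_.spin N (N - t) i, by unfold _root_.spin; split_ifs <;> omega, ?_⟩
      congr 1
      unfold _root_.spin; split_ifs <;> omega
    · rintro ⟨i, hi, rfl⟩
      exact ⟨_root_.spin N t i, hlt i hi, rfl⟩
  · by_cases hk' : k + t < N
    · rw [_root_.spin, _root_.spin, _root_.spin, if_pos hk', if_pos (by omega), if_pos (by omega)]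
      exact h.pos _ _ _ (by omega) (by omega) (by omega)
    by_cases hj' : j + t < N
    · rw [_root_.spin, _root_.spin, _root_.spin, if_neg hk', if_pos (by omega), if_pos (by omega),
        det2_rotate]
      exact h.pos _ _ _ (by omega) (by omega) (by omega)
    by_cases hi' : i + t < N
    · rw [_root_.spin, _root_.spin, _root_.spin, if_pos hi', if_neg hj', if_neg hk',
        ← det2_rotate]
      exact h.pos _ _ _ (by omega) (by omega) (by omega)
    · rw [_root_.spin, _root_.spin, _root_.spin, if_neg hi', if_neg hj', if_neg hk']
      exact h.pos _ _ _ (by omega) (by omega) (by omega)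

theorem Dih.listing {S : Finset Pt} {N : ℕ} {pt : ℕ → Pt} {ε : ℝ} {σ τ : ℕ → ℕ}
    (hD : Dih N σ τ) (h : Listing S N pt ε) : ∃ ε', Listing S N (fun x => pt (τ x)) ε' := by
  induction hD with
  | id => exact ⟨ε, h⟩
  | rot hD ih =>
    obtain ⟨ε', h'⟩ := ih
    rcases Nat.eq_zero_or_pos N with rfl | hN
    · exact ⟨ε', h'.congr fun i hi => absurd hi (Nat.not_lt_zero i)⟩
    refine ⟨ε', (h'.spin (t := 1) hN).congr fun i hi => ?_⟩
    dsimp only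
    congr 2
    unfold spin
    split_ifs <;> omega
  | refl hD ih =>
    obtain ⟨ε', h'⟩ := ih
    exact ⟨-ε', h'.mir⟩

theorem SegCross.symm {e f : Pt × Pt} (h : SegCross e f) : SegCross f e :=
  ⟨h.choose, h.choose_spec.2, h.choose_spec.1⟩

theorem segCross_comm {e f : Pt × Pt} : SegCross e f ↔ SegCross f e := ⟨SegCross.symm, SegCross.symm⟩

theorem segCross_swap {a b : Pt} {f : Pt × Pt} : SegCross (a, b) f ↔ SegCross (b, a) f := by
  simp only [SegCross, openSegment_symm ℝ a b]

theorem segCross_of_det2 {a b c d : Pt} (h1 : det2 a b c * det2 a b d < 0)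
    (h2 : det2 c d a * det2 c d b < 0) : SegCross (a, b) (c, d) := by
  have key : ∀ x y : ℝ, x * y < 0 → 0 < x / (x - y) ∧ x / (x - y) < 1 := fun x y h => by
    rcases lt_trichotomy x 0 with hx | hx | hx
    · have hy : 0 < y := by by_contra hy; nlinarith [not_lt.1 hy]
      rw [← neg_div_neg_eq]
      exact ⟨div_pos (by linarith) (by linarith), (div_lt_one (by linarith)).2 (by linarith)⟩
    · rw [hx, zero_mul] at h; exact absurd h (lt_irrefl _)
    · have hy : y < 0 := by by_contra hy; nlinarith [not_lt.1 hy]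
      exact ⟨div_pos (by linarith) (by linarith), (div_lt_one (by linarith)).2 (by linarith)⟩
  have n1 : det2 a b c - det2 a b d ≠ 0 := by
    intro h
    rw [sub_eq_zero.1 h] at h1
    nlinarith [mul_self_nonneg (det2 a b d)]
  have n2 : det2 c d a - det2 c d b ≠ 0 := by
    intro h
    rw [sub_eq_zero.1 h] at h2
    nlinarith [mul_self_nonneg (det2 c d b)]
  set s := det2 c d a / (det2 c d a - det2 c d b) with hs
  set r := det2 a b c / (det2 a b c - det2 a b d) with hr
  have hs' : s * (det2 c d a - det2 c d b) = det2 c d a := div_mul_cancel₀ _ n2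
  have hr' : r * (det2 a b c - det2 a b d) = det2 a b c := div_mul_cancel₀ _ n1
  have n3 : det2 a b c - det2 a b d = -(det2 c d a - det2 c d b) := by unfold det2; ring
  rw [SegCross]
  simp only [openSegment_eq_image, Set.mem_image, Set.mem_Ioo]
  refine ⟨_, ⟨s, key _ _ h2, rfl⟩, r, key _ _ h1, ?_⟩
  rw [n3] at hr'
  unfold det2 at hs' hr' n2
  ext
  · simp only [Prod.fst_add, Prod.smul_fst, smul_eq_mul]
    refine mul_right_cancel₀ n2 ?_
    linear_combination (-(d.1 - c.1)) * hr' - (b.1 - a.1) * hs'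
  · simp only [Prod.snd_add, Prod.smul_snd, smul_eq_mul]
    refine mul_right_cancel₀ n2 ?_
    linear_combination (-(d.2 - c.2)) * hr' - (b.2 - a.2) * hs'

theorem not_segCross_of_det2 {a b c d : Pt} {ε : ℝ} (h1 : 0 ≤ ε * det2 a b c)
    (h2 : 0 ≤ ε * det2 a b d) (h3 : 0 < ε * det2 a b c + ε * det2 a b d) :
    ¬ SegCross (a, b) (c, d) := by
  rintro ⟨x, hx1, hx2⟩
  rw [openSegment_eq_image] at hx1 hx2
  obtain ⟨s, -, rfl⟩ := hx1
  obtain ⟨r, ⟨hr0, hr1⟩, he⟩ := hx2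
  have e1 := congrArg Prod.fst he
  have e2 := congrArg Prod.snd he
  simp only [Prod.fst_add, Prod.smul_fst, Prod.snd_add, Prod.smul_snd, smul_eq_mul] at e1 e2
  have h4 : (1 - r) * (ε * det2 a b c) + r * (ε * det2 a b d) = 0 := by
    unfold det2
    linear_combination ε * (b.1 - a.1) * e2 - ε * (b.2 - a.2) * e1
  have h5 := mul_nonneg (sub_pos.2 hr1).le h1
  have h6 := mul_nonneg hr0.le h2
  have h7 : ε * det2 a b c = 0 := by
    by_contra h
    have := mul_pos (sub_pos.2 hr1) (lt_of_le_of_ne h1 (Ne.symm h))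
    linarith
  have h8 : ε * det2 a b d = 0 := by
    by_contra h
    have := mul_pos hr0 (lt_of_le_of_ne h2 (Ne.symm h))
    linarith
  linarith

section
variable {S : Finset Pt} {N : ℕ} {pt : ℕ → Pt} {ε : ℝ}

theorem Listing.det2_out (h : Listing S N pt ε) {i j k : ℕ} (hij : i < j) (hj : j < N)
    (hk : k < N) (hk' : k < i ∨ j < k) : 0 < ε * det2 (pt i) (pt j) (pt k) := by
  rcases hk' with hk' | hk'
  · rw [det2_rotate]; exact h.pos _ _ _ hk' hij hj
  · exact h.pos _ _ _ hij hk' hk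

theorem Listing.det2_in (h : Listing S N pt ε) {i j k : ℕ} (hj : j < N)
    (hik : i < k) (hkj : k < j) : 0 < -ε * det2 (pt i) (pt j) (pt k) := by
  rw [det2_swap', neg_mul_neg]; exact h.pos _ _ _ hik hkj hj

theorem det2_self_left (a b : Pt) : det2 a b a = 0 := by unfold det2; ring

theorem det2_self_right (a b : Pt) : det2 a b b = 0 := by unfold det2; ring

theorem Listing.segCross_of_lt (h : Listing S N pt ε) {a b c d : ℕ} (hac : a < c) (hcb : c < b)
    (hbd : b < d) (hd : d < N) : SegCross (pt a, pt b) (pt c, pt d) := by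
  have hε : ε * ε = 1 := by rcases h.sign with h | h <;> simp [h]
  have d1 := h.det2_in (by omega) hac hcb
  have d2 := h.det2_out (hac.trans hcb) (by omega) hd (Or.inr hbd)
  have d3 := h.det2_out (hcb.trans hbd) hd (k := a) (by omega) (Or.inl hac)
  have d4 := h.det2_in hd hcb hbd
  apply segCross_of_det2
  · have h5 := mul_pos d1 d2
    rw [show ∀ x y : ℝ, -ε * x * (ε * y) = ε * ε * (-(x * y)) by intros; ring, hε] at h5
    linarith
  · have h5 := mul_pos d3 d4
    rw [show ∀ x y : ℝ, ε * x * (-ε * y) = ε * ε * (-(x * y)) by intros; ring, hε] at h5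
    linarith

theorem Listing.segCross_iff_of_lt (h : Listing S N pt ε) {a b c d : ℕ} (hab : a < b) (hcd : c < d)
    (hb : b < N) (hd : d < N) (hne : ¬ (a = c ∧ b = d)) :
    SegCross (pt a, pt b) (pt c, pt d) ↔ crossB (a, b) (c, d) = true := by
  constructor
  · intro hX
    rw [crossB_iff]
    dsimp only
    by_contra hcon
    have hout : ∀ z < N, (z ≤ a ∨ b ≤ z) → 0 ≤ ε * det2 (pt a) (pt b) (pt z) ∧
        ((z < a ∨ b < z) → 0 < ε * det2 (pt a) (pt b) (pt z)) := fun z hz hz' => by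
      refine ⟨?_, h.det2_out hab hb hz⟩
      by_cases h1 : z < a ∨ b < z
      · exact (h.det2_out hab hb hz h1).le
      · rcases (by omega : z = a ∨ z = b) with rfl | rfl
        · rw [det2_self_left, mul_zero]
        · rw [det2_self_right, mul_zero]
    have hin : ∀ z < N, (a ≤ z ∧ z ≤ b) → 0 ≤ -ε * det2 (pt a) (pt b) (pt z) ∧
        ((a < z ∧ z < b) → 0 < -ε * det2 (pt a) (pt b) (pt z)) := fun z hz hz' => by
      refine ⟨?_, fun hh => h.det2_in hb hh.1 hh.2⟩
      by_cases h1 : a < z ∧ z < b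
      · exact (h.det2_in hb h1.1 h1.2).le
      · rcases (by omega : z = a ∨ z = b) with rfl | rfl
        · rw [det2_self_left, mul_zero]
        · rw [det2_self_right, mul_zero]
    by_cases h1 : (c ≤ a ∨ b ≤ c) ∧ (d ≤ a ∨ b ≤ d)
    · obtain ⟨p1, p2⟩ := hout c (by omega) h1.1
      obtain ⟨q1, q2⟩ := hout d hd h1.2
      refine not_segCross_of_det2 p1 q1 ?_ hX
      rcases (by omega : (c < a ∨ b < c) ∨ (d < a ∨ b < d)) with h2 | h2
      · linarith [p2 h2]
      · linarith [q2 h2]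
    · obtain ⟨p1, p2⟩ := hin c (by omega) (by omega)
      obtain ⟨q1, q2⟩ := hin d hd (by omega)
      refine not_segCross_of_det2 p1 q1 ?_ hX
      rcases (by omega : (a < c ∧ c < b) ∨ (a < d ∧ d < b)) with h2 | h2
      · linarith [p2 h2]
      · linarith [q2 h2]
  · intro hX
    rw [crossB_iff] at hX
    dsimp only at hX
    rcases (by omega : (a < c ∧ c < b ∧ b < d) ∨ (c < a ∧ a < d ∧ d < b)) with h1 | h1
    · exact h.segCross_of_lt h1.1 h1.2.1 h1.2.2 hd
    · exact (h.segCross_of_lt h1.1 h1.2.1 h1.2.2 hb).symm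

theorem Listing.segCross_iff (h : Listing S N pt ε) {a b c d : ℕ} (ha : a < N) (hb : b < N)
    (hc : c < N) (hd : d < N) (hab : a ≠ b) (hcd : c ≠ d) (h1 : ¬ (a = c ∧ b = d))
    (h2 : ¬ (a = d ∧ b = c)) :
    SegCross (pt a, pt b) (pt c, pt d) ↔ crossB (a, b) (c, d) = true := by
  wlog hab' : a < b generalizing a b
  · rw [segCross_swap, crossB_swap]
    exact this hb ha hab.symm (by tauto) (by tauto) (by omega)
  wlog hcd' : c < d generalizing c d
  · rw [segCross_comm, segCross_swap, segCross_comm, crossB_comm, crossB_swap, crossB_comm]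
    exact this hd hc hcd.symm (by tauto) (by tauto) (by omega)
  exact h.segCross_iff_of_lt hab' hcd' hb hd h1

end

theorem crossNum_cons (e : Pt × Pt) (es : List (Pt × Pt)) :
    crossNum (e :: es) = ((Finset.range es.length).filter fun j =>
      SegCross e (es.getD j ((0, 0), (0, 0)))).card + crossNum es := by
  unfold crossNum
  simp only [Finset.card_filter, Finset.sum_product, List.length_cons]
  rw [Finset.sum_range_succ', add_comm]
  congr 1
  · rw [Finset.sum_range_succ']
    simp
  · refine Finset.sum_congr rfl fun i _ => ?_
    rw [Finset.sum_range_succ']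
    simp

theorem crossNum_eq_selfCross {es : List (Pt × Pt)} {fs : List (ℕ × ℕ)}
    (hl : es.length = fs.length)
    (h : ∀ i j, i < j → j < es.length → (SegCross (es.getD i ((0, 0), (0, 0)))
      (es.getD j ((0, 0), (0, 0))) ↔ crossB (fs.getD i (0, 0)) (fs.getD j (0, 0)) = true)) :
    crossNum es = selfCross fs := by
  induction es generalizing fs with
  | nil =>
    cases fs with
    | nil => simp [crossNum, selfCross]
    | cons => simp at hl
  | cons e es ih =>
    cases fs with
    | nil => simp at hl
    | cons f fs =>
      simp only [List.length_cons, Nat.add_right_cancel_iff] at hl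
      rw [crossNum_cons, selfCross, ih hl fun i j hij hj => by
        simpa using h (i + 1) (j + 1) (by omega) (by simpa using hj)]
      congr 1
      have h0 : ∀ j < es.length, (SegCross e (es.getD j ((0, 0), (0, 0))) ↔
          crossB f (fs.getD j (0, 0)) = true) := fun j hj => by
        simpa using h 0 (j + 1) (by omega) (by simpa using hj)
      clear h ih
      induction es generalizing fs with
      | nil =>
        cases fs with
        | nil => simp
        | cons => simp at hl
      | cons e' es ih =>
        cases fs with
        | nil => simp at hl
        | cons f' fs =>
          simp only [List.length_cons, Nat.add_right_cancel_iff] at hl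
          have i1 := ih fs hl fun j hj => by simpa using h0 (j + 1) (by simpa using hj)
          have i2 := h0 0 (by simp)
          simp only [List.getD_cons_zero] at i2
          rw [crossWith_cons, ← i1, Finset.card_filter, Finset.card_filter, List.length_cons,
            Finset.sum_range_succ', add_comm, xc, crossB_comm f' f]
          simp only [List.getD_cons_zero, List.getD_cons_succ]
          congr 1
          by_cases hX : SegCross e e'
          · rw [if_pos hX, i2.1 hX]; rfl
          · rw [if_neg hX, Bool.eq_false_iff.2 fun hh => hX (i2.2 hh)]; rfl

theorem edgesOf_eq_map_zip (l : List ℕ) : edgesOf l = (l.zip l.tail).map fun e => mkE e.1 e.2 := by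
  induction l with
  | nil => rfl
  | cons a t ih =>
    cases t with
    | nil => rfl
    | cons b t => simpa [edgesOf] using ih

theorem crossWith_eq_sum (A : List (ℕ × ℕ)) (o : ℕ × ℕ) :
    crossWith A o = ∑ j ∈ Finset.range A.length, xc (A.getD j (0, 0)) o := by
  induction A with
  | nil => simp
  | cons e A ih =>
    rw [crossWith_cons, ih, List.length_cons, Finset.sum_range_succ', add_comm]
    simp

theorem crossWith_map_mkE (A : List (ℕ × ℕ)) (o : ℕ × ℕ) :
    crossWith (A.map fun e => mkE e.1 e.2) o = crossWith A o := by
  induction A with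
  | nil => rfl
  | cons e A ih => simp [ih]

theorem pathEdges_map (l : List ℕ) (pt : ℕ → Pt) :
    pathEdges (l.map pt) = (l.zip l.tail).map fun e => (pt e.1, pt e.2) := by
  rw [pathEdges, ← List.map_tail, List.zip_map]
  rfl

theorem length_zip_tail {α : Type*} (l : List α) : (l.zip l.tail).length = l.length - 1 := by
  simp

theorem getD_zip_tail (l : List ℕ) {i : ℕ} (h : i + 1 < l.length) :
    (l.zip l.tail).getD i (0, 0) = (l.getD i 0, l.getD (i + 1) 0) := by
  rw [List.getD_eq_getElem _ _ (by rw [length_zip_tail]; omega), List.getD_eq_getElem _ _ (by omega),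
    List.getD_eq_getElem _ _ h, List.getElem_zip, List.getElem_tail]

theorem getD_pathEdges (l : List ℕ) (pt : ℕ → Pt) {i : ℕ} (h : i + 1 < l.length) :
    (pathEdges (l.map pt)).getD i ((0, 0), (0, 0)) = (pt (l.getD i 0), pt (l.getD (i + 1) 0)) := by
  have h1 := getD_zip_tail l h
  rw [List.getD_eq_getElem _ _ (by rw [length_zip_tail]; omega)] at h1
  rw [pathEdges_map, List.getD_eq_getElem _ _ (by simp; omega), List.getElem_map, h1]

theorem length_pathEdges (l : List ℕ) (pt : ℕ → Pt) :
    (pathEdges (l.map pt)).length = l.length - 1 := by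
  rw [pathEdges_map, List.length_map, length_zip_tail]

section
variable {S : Finset Pt} {N : ℕ} {pt : ℕ → Pt} {ε : ℝ} {l : List ℕ}

theorem Listing.segCross_pathEdges (h : Listing S N pt ε) (hl : ∀ x ∈ l, x < N) (hn : l.Nodup) {i j : ℕ}
    (hi : i + 1 < l.length) (hj : j + 1 < l.length) (hij : i ≠ j) :
    SegCross ((pathEdges (l.map pt)).getD i ((0, 0), (0, 0)))
      ((pathEdges (l.map pt)).getD j ((0, 0), (0, 0))) ↔
    crossB ((l.zip l.tail).getD i (0, 0)) ((l.zip l.tail).getD j (0, 0)) = true := by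
  have hlt : ∀ k < l.length, l.getD k 0 < N := fun k hk => by
    rw [List.getD_eq_getElem _ _ hk]; exact hl _ (List.getElem_mem hk)
  have hinj : ∀ k k', k < l.length → k' < l.length → l.getD k 0 = l.getD k' 0 → k = k' :=
    fun k k' hk hk' he => by
      rw [List.getD_eq_getElem _ _ hk, List.getD_eq_getElem _ _ hk'] at he
      exact (hn.getElem_inj_iff).1 he
  rw [getD_pathEdges l pt hi, getD_pathEdges l pt hj, getD_zip_tail l hi, getD_zip_tail l hj]
  refine h.segCross_iff (hlt _ (by omega)) (hlt _ hi) (hlt _ (by omega)) (hlt _ hj) ?_ ?_ ?_ ?_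
  · intro he; have := hinj _ _ (by omega) hi he; omega
  · intro he; have := hinj _ _ (by omega) hj he; omega
  · rintro ⟨he, -⟩; exact hij (hinj _ _ (by omega) (by omega) he)
  · rintro ⟨he, he'⟩
    have := hinj _ _ (by omega) hj he
    have := hinj _ _ hi (by omega) he'
    omega

theorem Listing.crossNum_pathEdges (h : Listing S N pt ε) (hl : ∀ x ∈ l, x < N) (hn : l.Nodup) :
    crossNum (pathEdges (l.map pt)) = cr l := by
  rw [cr, edgesOf_eq_map_zip, selfCross_map_mkE]
  refine crossNum_eq_selfCross (by rw [length_pathEdges, length_zip_tail]) fun i j hij hj => ?_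
  rw [length_pathEdges] at hj
  exact h.segCross_pathEdges hl hn (by omega) (by omega) hij.ne

theorem Listing.edgeCrossCount_le (h : Listing S N pt ε) (hl : ∀ x ∈ l, x < N) (hn : l.Nodup) {i : ℕ}
    (hi : i + 1 < l.length) : edgeCrossCount (pathEdges (l.map pt)) i ≤
      crossWith (edgesOf l) (l.getD i 0, l.getD (i + 1) 0) := by
  rw [edgesOf_eq_map_zip, crossWith_map_mkE, crossWith_eq_sum, edgeCrossCount, Finset.card_filter,
    length_pathEdges, length_zip_tail]
  refine Finset.sum_le_sum fun j hj => ?_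
  rw [Finset.mem_range] at hj
  split_ifs with hX
  · rw [h.segCross_pathEdges hl hn hi (by omega) (Ne.symm hX.1), getD_zip_tail l hi, crossB_comm,
      ← xc_eq_one] at hX
    exact hX.2.ge
  · exact Nat.zero_le _

end

section
variable {R B : Finset Pt} {p q : Pt} {N : ℕ} {pt : ℕ → Pt} {ε : ℝ}

theorem HamAltPath.exists_labels (P : HamAltPath R B p q) (hdisj : Disjoint R B)
    (h : Listing (R ∪ B) N pt ε) :
    ∃ l, P.verts = l.map pt ∧ Valid N (fun i => decide (pt i ∈ R)) l := by
  have hm : ∀ z ∈ P.verts, ∃ i < N, pt i = z := fun z hz =>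
    (h.mem z).1 (by rw [← P.cover]; exact List.mem_toFinset.2 hz)
  obtain ⟨l, hl⟩ : ∃ l : List ℕ, P.verts = l.map pt ∧ ∀ i ∈ l, i < N := by
    generalize P.verts = vs at hm
    induction vs with
    | nil => exact ⟨[], rfl, by simp⟩
    | cons z vs ih =>
      obtain ⟨i, hi, rfl⟩ := hm z (by simp)
      obtain ⟨l, h1, h2⟩ := ih fun z hz => hm z (by simp [hz])
      exact ⟨i :: l, by rw [h1]; rfl, by simpa using ⟨hi, h2⟩⟩
  obtain ⟨h1, h2⟩ := hl
  refine ⟨l, h1, ?_, ?_⟩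
  · have hnd : l.Nodup := by
      have := P.nodup
      rw [h1] at this
      exact this.of_map
    refine (List.perm_ext_iff_of_nodup hnd List.nodup_range).2 fun i => ?_
    rw [List.mem_range]
    refine ⟨h2 i, fun hi => ?_⟩
    have h3 : pt i ∈ P.verts := by
      rw [← List.mem_toFinset, P.cover, h.mem]; exact ⟨i, hi, rfl⟩
    rw [h1, List.mem_map] at h3
    obtain ⟨j, hj, he⟩ := h3
    rw [← h.inj j (h2 j hj) i hi he]
    exact hj
  · have h3 := P.alt
    rw [h1] at h3
    clear h1 h2
    induction l with
    | nil => simp [Alt]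
    | cons a t ih =>
      cases t with
      | nil => simp [Alt]
      | cons b t =>
        rw [Alt, List.isChain_cons_cons]
        refine ⟨?_, ih fun e he => h3 e ?_⟩
        · have h4 := h3 (pt a, pt b) (by simp [pathEdges])
          rw [Finset.disjoint_left] at hdisj
          intro he
          rw [decide_eq_decide] at he
          rcases h4 with ⟨h5, h6⟩ | ⟨h5, h6⟩
          · exact hdisj (he.1 h5) h6
          · exact hdisj (he.2 h6) h5
        · simp only [pathEdges, List.map_cons, List.tail_cons, List.zip_cons_cons] at he ⊢
          exact List.mem_cons_of_mem _ he

theorem Valid.exists_path {l : List ℕ} (hv : Valid N (fun i => decide (pt i ∈ R)) l)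
    (h : Listing (R ∪ B) N pt ε) (hp : (l.map pt).head? = some p) (hq : (l.map pt).getLast? = some q) :
    ∃ Q : HamAltPath R B p q, Q.verts = l.map pt := by
  have hlt : ∀ i ∈ l, i < N := fun i hi => List.mem_range.1 (hv.1.mem_iff.1 hi)
  refine ⟨⟨l.map pt, ?_, ?_, hp, hq, ?_⟩, rfl⟩
  · exact (hv.1.nodup_iff.2 List.nodup_range).map_on fun x hx y hy he =>
      h.inj x (hlt x hx) y (hlt y hy) he
  · ext z
    rw [List.mem_toFinset, List.mem_map, h.mem]
    exact exists_congr fun i => by rw [hv.1.mem_iff, List.mem_range]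
  · have hA := hv.2
    clear hp hq hv
    induction l with
    | nil => simp [pathEdges]
    | cons a t ih =>
      cases t with
      | nil => simp [pathEdges]
      | cons b t =>
        rw [Alt, List.isChain_cons_cons] at hA
        intro e he
        simp only [pathEdges, List.map_cons, List.tail_cons, List.zip_cons_cons, List.mem_cons] at he
        rcases he with rfl | he
        · have m1 := (h.mem (pt a)).2 ⟨a, hlt a (by simp), rfl⟩
          have m2 := (h.mem (pt b)).2 ⟨b, hlt b (by simp), rfl⟩
          rw [Finset.mem_union] at m1 m2
          have h1 := hA.1
          rw [Ne, decide_eq_decide] at h1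
          unfold Bichromatic
          dsimp only
          tauto
        · exact ih (fun i hi => hlt i (List.mem_cons_of_mem _ hi)) hA.2 e (by
            simpa [pathEdges] using he)

theorem OptimumPath.opt {P : HamAltPath R B p q} (hP : OptimumPath R B p q P)
    (h : Listing (R ∪ B) N pt ε) {l : List ℕ} (hl : P.verts = l.map pt)
    (hv : Valid N (fun i => decide (pt i ∈ R)) l) : Opt N (fun i => decide (pt i ∈ R)) l := by
  refine ⟨hv, fun l' hv' h1 h2 => ?_⟩
  have hp := P.head_eq
  have hq := P.last_eq
  rw [hl, List.head?_map, ← h1, ← List.head?_map] at hp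
  rw [hl, List.getLast?_map, ← h2, ← List.getLast?_map] at hq
  obtain ⟨Q, hQ⟩ := hv'.exists_path h hp hq
  have := hP Q
  rwa [hQ, hl, h.crossNum_pathEdges (fun x hx => List.mem_range.1 (hv.1.mem_iff.1 hx))
    (hv.1.nodup_iff.2 List.nodup_range),
    h.crossNum_pathEdges (fun x hx => List.mem_range.1 (hv'.1.mem_iff.1 hx))
    (hv'.1.nodup_iff.2 List.nodup_range)] at this

end

section
variable {S A C : Finset Pt} {N t : ℕ} {pt : ℕ → Pt} {ε : ℝ} {a : Bool} {col : ℕ → Bool}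

theorem Listing.eq_one_or_last (h : Listing S N pt ε) {x : Pt} (hx : x ∈ S) (h0 : x ≠ pt 0) {δ : ℝ}
    (hδ : ∀ y ∈ S, y ≠ pt 0 → y ≠ x → 0 < δ * det2 (pt 0) x y) : x = pt 1 ∨ x = pt (N - 1) := by
  obtain ⟨k, hk, rfl⟩ := (h.mem x).1 hx
  by_contra hcon
  rw [not_or] at hcon
  have k0 : k ≠ 0 := fun e => h0 (by rw [e])
  have k1 : k ≠ 1 := fun e => hcon.1 (by rw [e])
  have k2 : k ≠ N - 1 := fun e => hcon.2 (by rw [← e])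
  have hne : ∀ i < N, ∀ j < N, i ≠ j → pt i ≠ pt j := fun i hi j hj hij e => hij (h.inj i hi j hj e)
  have h1 := hδ (pt 1) ((h.mem _).2 ⟨1, by omega, rfl⟩) (hne _ (by omega) _ (by omega) (by omega))
    (hne _ (by omega) _ (by omega) (by omega))
  have h2 := hδ (pt (N - 1)) ((h.mem _).2 ⟨N - 1, by omega, rfl⟩)
    (hne _ (by omega) _ (by omega) (by omega)) (hne _ (by omega) _ (by omega) (by omega))
  have h3 := h.det2_in (i := 0) (j := k) (k := 1) hk (by omega) (by omega)
  have h4 := h.det2_out (i := 0) (j := k) (k := N - 1) (by omega) hk (by omega) (by omega)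
  generalize det2 (pt 0) (pt k) (pt 1) = u at *
  generalize det2 (pt 0) (pt k) (pt (N - 1)) = v at *
  have h5 := mul_pos h1 h2
  have h6 := mul_pos h3 h4
  have h7 : ε * ε = 1 := by rcases h.sign with e | e <;> rw [e] <;> norm_num
  have h8 : u * v < 0 := by
    have : -ε * u * (ε * v) = -(ε * ε) * (u * v) := by ring
    rw [this, h7] at h6
    linarith
  have h9 := mul_nonneg (sq_nonneg δ) (neg_nonneg.2 h8.le)
  have : δ * u * (δ * v) = -(δ ^ 2 * -(u * v)) := by ring
  linarith

theorem CWList.det2_cycSucc {m : ℕ} (hm : 0 < m) {p : Fin m → Pt} (hp : CWList p) {i j : Fin m}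
    (h1 : j ≠ i) (h2 : j ≠ cycSucc hm i) : det2 (p i) (p (cycSucc hm i)) (p j) < 0 := by
  have h1' : j.val ≠ i.val := fun e => h1 (Fin.ext e)
  have h2' : j.val ≠ (cycSucc hm i).val := fun e => h2 (Fin.ext e)
  have hi := i.2
  have hj := j.2
  by_cases hlast : i.val + 1 = m
  · have hs : (cycSucc hm i).val = 0 := by simp [cycSucc, hlast]
    rw [← det2_rotate]
    exact hp.2 _ _ _ (Fin.lt_def.2 (by omega)) (Fin.lt_def.2 (by omega))
  · have hs : (cycSucc hm i).val = i.val + 1 := Nat.mod_eq_of_lt (by omega)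
    rcases lt_or_gt_of_ne h1' with h | h
    · rw [det2_rotate]
      exact hp.2 _ _ _ h (Fin.lt_def.2 (by omega))
    · exact hp.2 _ _ _ (Fin.lt_def.2 (by omega)) (Fin.lt_def.2 (by omega))

theorem cycSucc_cycPred {m : ℕ} (hm : 0 < m) (i : Fin m) : cycSucc hm (cycPred hm i) = i := by
  have hi := i.2
  apply Fin.ext
  simp only [cycSucc, cycPred, Nat.mod_add_mod]
  rw [show i.val + (m - 1) + 1 = i.val + m by omega, Nat.add_mod_right, Nat.mod_eq_of_lt hi]

theorem cycSucc_ne {m : ℕ} (hm : 0 < m) (h2 : 2 ≤ m) (i : Fin m) : cycSucc hm i ≠ i := by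
  intro e
  have h1 := congrArg Fin.val e
  have hi := i.2
  simp only [cycSucc] at h1
  by_cases hlast : i.val + 1 = m
  · rw [hlast, Nat.mod_self] at h1; omega
  · rw [Nat.mod_eq_of_lt (by omega)] at h1; omega

theorem ConvexPosition.hullPts_eq (hS : ConvexPosition S) : hullPts S = S :=
  Finset.filter_true_of_mem hS

theorem Listing.neighbors (h : Listing S N pt ε) (hN : 2 ≤ N) (hS : ConvexPosition S) {m : ℕ}
    (hm : 0 < m) {p : Fin m → Pt} (hp : IsHullList S p) {i : Fin m} (hi : p i = pt 0) :
    (p (cycPred hm i) = pt 1 ∨ p (cycPred hm i) = pt (N - 1)) ∧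
      (p (cycSucc hm i) = pt 1 ∨ p (cycSucc hm i) = pt (N - 1)) := by
  obtain ⟨hC, him⟩ := hp
  rw [hS.hullPts_eq] at him
  have hmem : ∀ j, p j ∈ S := fun j => him ▸ Finset.mem_image_of_mem p (Finset.mem_univ j)
  have hm2 : 2 ≤ m := by
    by_contra hcon
    have hsub : ∀ x y : Fin m, x = y := fun x y => Fin.ext (by have := x.2; have := y.2; omega)
    have h1 : ∀ x < N, pt x = pt 0 := fun x hx => by
      have : pt x ∈ S := (h.mem _).2 ⟨x, hx, rfl⟩
      rw [← him, Finset.mem_image] at this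
      obtain ⟨j, -, hj⟩ := this
      rw [← hj, hsub j i, hi]
    have := h.inj 1 (by omega) 0 (by omega) (h1 1 (by omega))
    omega
  have hall : ∀ y ∈ S, ∃ j, p j = y := fun y hy => by
    rw [← him, Finset.mem_image] at hy
    obtain ⟨j, -, hj⟩ := hy
    exact ⟨j, hj⟩
  constructor
  · have e := cycSucc_cycPred hm i
    have hne := cycSucc_ne hm hm2 (cycPred hm i)
    rw [e] at hne
    refine h.eq_one_or_last (δ := 1) (hmem _) (fun e' => hne (hC.1 (hi.trans e'.symm)))
      fun y hy hy0 hyx => ?_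
    obtain ⟨j, rfl⟩ := hall y hy
    have := hC.det2_cycSucc hm (i := cycPred hm i) (j := j) (fun e' => hyx (by rw [e']))
      (fun e' => hy0 (by rw [e', e, hi]))
    rw [e, det2_swap, hi] at this
    linarith
  · refine h.eq_one_or_last (δ := -1) (hmem _)
      (fun e' => cycSucc_ne hm hm2 i (hC.1 (e'.trans hi.symm))) fun y hy hy0 hyx => ?_
    obtain ⟨j, rfl⟩ := hall y hy
    have := hC.det2_cycSucc hm (i := i) (j := j) (fun e' => hy0 (by rw [e', hi]))
      (fun e' => hyx (by rw [e']))
    rw [hi] at this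
    linarith

theorem sum_sgn_eq (s : Finset ℕ) : ∑ x ∈ s, sgn a col x =
    ((s.filter fun x => col x = a).card : ℤ) - (s.filter fun x => col x ≠ a).card := by
  unfold sgn
  rw [Finset.sum_ite]
  simp [sub_eq_add_neg]

theorem Listing.firstBalanced (h : Listing S N pt ε) (hb : Ballot a col N t)
    (hA : ∀ i < N, pt i ∈ A ↔ col i = a) (hC : ∀ i < N, pt i ∈ C ↔ col i ≠ a) {k : ℕ}
    {q : Fin k → Pt} (him : Finset.univ.image q = S.erase (pt 0))
    (hpos : ∀ i j, i < j → 0 < ε * det2 (pt 0) (q i) (q j)) {j : Fin k}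
    (hj : FirstBalanced A C q j) : q j = pt t := by
  have i1 := hb.three_le
  have i2 := hb.le
  have hex : ∀ i, ∃ x, x < N ∧ x ≠ 0 ∧ pt x = q i := fun i => by
    have : q i ∈ S.erase (pt 0) := him ▸ Finset.mem_image_of_mem q (Finset.mem_univ i)
    rw [Finset.mem_erase, h.mem] at this
    obtain ⟨h1, x, hx, h2⟩ := this
    exact ⟨x, hx, fun e => h1 (by rw [← h2, e]), h2⟩
  choose lam hlt hne0 hlam using hex
  have hmono : StrictMono lam := fun i i' hii => by
    have h1 := hpos i i' hii
    by_contra hcon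
    rcases (not_lt.1 hcon).lt_or_eq with h2 | h2
    · have h3 := h.pos 0 (lam i') (lam i) (Nat.pos_of_ne_zero (hne0 _)) h2 (hlt i)
      rw [hlam, hlam, det2_swap'] at h3
      linarith
    · rw [← hlam, ← hlam, h2, det2_self_right, mul_zero] at h1
      exact h1.false
  have hsurj : ∀ x < N, x ≠ 0 → ∃ i, lam i = x := fun x hx hx0 => by
    have : pt x ∈ S.erase (pt 0) := Finset.mem_erase.2
      ⟨fun e => hx0 (h.inj x hx 0 (by omega) e), (h.mem _).2 ⟨x, hx, rfl⟩⟩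
    rw [← him, Finset.mem_image] at this
    obtain ⟨i, -, hi⟩ := this
    exact ⟨i, h.inj _ (hlt i) _ hx ((hlam i).trans hi)⟩
  have hcount : ∀ (D : Finset Pt) (P : ℕ → Prop) [DecidablePred P], (∀ x < N, pt x ∈ D ↔ P x) → ∀ i,
      (Finset.univ.filter fun i' : Fin k => i' ≤ i ∧ q i' ∈ D).card =
        ((Finset.Ico 1 (lam i + 1)).filter P).card := fun D P _ hP i => by
    rw [← Finset.card_image_of_injective _ hmono.injective]
    congr 1
    ext x
    simp only [Finset.mem_image, Finset.mem_filter, Finset.mem_univ, true_and, Finset.mem_Ico]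
    constructor
    · rintro ⟨i', ⟨h1, h2⟩, rfl⟩
      have := hmono.monotone h1
      have := hne0 i'
      refine ⟨⟨by omega, by omega⟩, (hP _ (hlt i')).1 ?_⟩
      rwa [hlam]
    · rintro ⟨⟨h1, h2⟩, h3⟩
      have := hlt i
      obtain ⟨i', rfl⟩ := hsurj x (by omega) (by omega)
      refine ⟨i', ⟨hmono.le_iff_le.1 (by omega), ?_⟩, rfl⟩
      rw [← hlam]
      exact (hP _ (hlt i')).2 h3
  have hbal : ∀ i, BalancedAt A C q i ↔ 1 + ∑ x ∈ Finset.Ico 1 (lam i + 1), sgn a col x = 0 :=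
    fun i => by
      rw [BalancedAt, hcount A _ hA, hcount C _ hC, sum_sgn_eq]
      omega
  obtain ⟨i0, hi0⟩ := hsurj t (by omega) (by omega)
  have hbal0 : BalancedAt A C q i0 := by
    rw [hbal, hi0, Finset.sum_Ico_succ_top (by omega), hb.bal_left, sgn_neg hb.mid]
    norm_num
  have hle : j ≤ i0 := not_lt.1 fun hlt => hj.2 i0 hlt hbal0
  rcases hle.lt_or_eq with hlt' | rfl
  · have h1 := hmono hlt'
    have h2 := hb.left (lam j + 1) (by omega)
    have h3 := (hbal j).1 hj.1
    omega
  · rw [← hlam, hi0]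

theorem Listing.firstBalanced_of_order (h : Listing S N pt ε) (hb : Ballot a col N t)
    (hA : ∀ i < N, pt i ∈ A ↔ col i = a) (hC : ∀ i < N, pt i ∈ C ↔ col i ≠ a) {k : ℕ}
    {q : Fin k → Pt} (hq : CCWOrder (pt 0) q (S.erase (pt 0)) ∨ CWOrder (pt 0) q (S.erase (pt 0)))
    {j : Fin k} (hj : FirstBalanced A C q j) : q j = pt t := by
  have i1 := hb.three_le
  have i2 := hb.le
  obtain ⟨him, δ, hδ, hpos⟩ : Finset.univ.image q = S.erase (pt 0) ∧
      ∃ δ : ℝ, (δ = 1 ∨ δ = -1) ∧ ∀ i j, i < j → 0 < δ * det2 (pt 0) (q i) (q j) := by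
    rcases hq with ⟨-, him, hpos⟩ | ⟨-, him, hpos⟩
    · exact ⟨him, 1, Or.inl rfl, fun i j hij => by simpa using hpos i j hij⟩
    · exact ⟨him, -1, Or.inr rfl, fun i j hij => by simpa using hpos i j hij⟩
  by_cases he : δ = ε
  · exact h.firstBalanced hb hA hC him (he ▸ hpos) hj
  · have he' : δ = -ε := by
      rcases h.sign with e | e <;> rcases hδ with e' | e' <;> rw [e, e'] at he ⊢ <;> simp_all
    have hlt : ∀ i < N, _root_.mir N i < N := fun i hi => by
      unfold _root_.mir; split_ifs <;> omega
    have := h.mir.firstBalanced hb.mir (A := A) (C := C) (fun i hi => hA _ (hlt i hi))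
      (fun i hi => hC _ (hlt i hi)) (q := q) him (he' ▸ hpos) hj
    rwa [mir_pos (by omega), show N - (N - t) = t by omega] at this

theorem Ballot.specialConfig (hb : Ballot a col N t) (h : Listing (A ∪ C) N pt ε)
    (hS : ConvexPosition (A ∪ C)) (hA : ∀ i < N, pt i ∈ A ↔ col i = a)
    (hC : ∀ i < N, pt i ∈ C ↔ col i ≠ a) : SpecialConfig A C (pt 0) (pt t) := by
  have i1 := hb.three_le
  have i2 := hb.le
  have h' := h.spin (t := t) (by omega)
  have hlt : ∀ i < N, _root_.spin N t i < N := fun i hi => by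
    unfold _root_.spin; split_ifs <;> omega
  have e0 : _root_.spin N t 0 = t := by unfold _root_.spin; split_ifs <;> omega
  have et : _root_.spin N t (N - t) = 0 := by unfold _root_.spin; split_ifs <;> omega
  have hb' := hb.spin
  have hnot : ∀ c : Bool, c ≠ a ↔ c = !a := fun c => by cases a <;> cases c <;> simp
  have hnot' : ∀ c : Bool, c = a ↔ c ≠ !a := fun c => by cases a <;> cases c <;> simp
  rw [SpecialConfig, hS.hullPts_eq]
  refine ⟨(h.mem _).2 ⟨0, by omega, rfl⟩, (h.mem _).2 ⟨t, by omega, rfl⟩,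
    fun m hm p hp i => ⟨fun hi => ?_, fun hi => ?_⟩, fun k q hq j hj => ?_, fun k q hq j hj => ?_⟩
  · have h1 : pt 1 ∈ A := (hA _ (by omega)).2 hb.one
    have h2 : pt (N - 1) ∈ A := (hA _ (by omega)).2 hb.last
    obtain ⟨h3, h4⟩ := h.neighbors (by omega) hS hm hp hi
    exact ⟨by rcases h3 with e | e <;> rwa [e], by rcases h4 with e | e <;> rwa [e]⟩
  · have h1 : pt (_root_.spin N t 1) ∈ C :=
      (hC _ (hlt _ (by omega))).2 ((hnot _).2 hb'.one)
    have h2 : pt (_root_.spin N t (N - 1)) ∈ C :=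
      (hC _ (hlt _ (by omega))).2 ((hnot _).2 hb'.last)
    obtain ⟨h3, h4⟩ := h'.neighbors (by omega) hS hm hp (i := i) (by rw [e0]; exact hi)
    exact ⟨by rcases h3 with e | e <;> rwa [e], by rcases h4 with e | e <;> rwa [e]⟩
  · exact h.firstBalanced_of_order hb hA hC hq hj
  · have := h'.firstBalanced_of_order hb' (A := C) (C := A)
      (fun i hi => (hC _ (hlt i hi)).trans (hnot _)) (fun i hi => (hA _ (hlt i hi)).trans (hnot' _))
      (q := q) (by rw [e0]; exact hq) hj
    rwa [et] at this

end

theorem SpecialConfig.swap {R B : Finset Pt} {r b : Pt} (h : SpecialConfig R B r b) :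
    SpecialConfig B R b r := by
  rw [SpecialConfig, Finset.union_comm B R]
  obtain ⟨h1, h2, h3, h4, h5⟩ := h
  exact ⟨h2, h1, fun m hm pt hpt i => (h3 m hm pt hpt i).symm, h5, h4⟩

/-- Theorem 3.11: let `S = R ∪ B` be in convex position with `|R| = |B| ≥ 1` or
`|R| = |B| + 1 ≥ 2`, and let `p, q ∈ S` be such that the configuration `(S, p, q)` is
non-special (by convention, a configuration whose two distinguished points have the same
color is non-special).  Then every optimum Hamiltonian alternating path on `S` with
endpoints `p` and `q` is 1-plane. -/
theorem stmt15 (R B : Finset Pt) (hdisj : Disjoint R B)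
    (hconv : ConvexPosition (R ∪ B))
    (hcard : (R.card = B.card ∧ 1 ≤ R.card) ∨ (R.card = B.card + 1 ∧ 2 ≤ R.card))
    (p q : Pt) (hp : p ∈ R ∪ B) (hq : q ∈ R ∪ B)
    (hns : ¬ ((p ∈ R ∧ q ∈ B ∧ SpecialConfig R B p q) ∨
              (q ∈ R ∧ p ∈ B ∧ SpecialConfig R B q p))) :
    ∀ P : HamAltPath R B p q, OptimumPath R B p q P →
      OnePlane (pathEdges P.verts) := by
  intro P hP i hi
  by_contra hcon
  apply hns
  obtain ⟨pt, h⟩ := hconv.exists_listing hp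
  obtain ⟨l, hl, hv⟩ := P.exists_labels hdisj h
  have hopt := hP.opt h hl hv
  have hlt : ∀ x ∈ l, x < (R ∪ B).card := fun x hx => hopt.lt hx
  have hhead := P.head_eq
  have hlast := P.last_eq
  rw [hl] at hi hcon hhead hlast
  rw [Finset.mem_range, length_pathEdges] at hi
  have h3 := h.edgeCrossCount_le hlt hopt.nodup (i := i) (by omega)
  obtain ⟨p', hp'⟩ : ∃ a, l.head? = some a := by
    cases l with
    | nil => simp at hi
    | cons a l => exact ⟨a, rfl⟩
  obtain ⟨q', hq'⟩ : ∃ a, l.getLast? = some a :=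
    ⟨l.getLast (by rintro rfl; simp at hi), List.getLast?_eq_some_getLast _⟩
  have hs1 : Seg (l.take (i + 1)) p' (l.getD i 0) := by
    refine ⟨by rw [List.head?_take, if_neg (by omega), hp'], ?_⟩
    rw [List.getLast?_take, if_neg (by omega), Nat.add_sub_cancel, List.getElem?_eq_getElem (by omega),
      List.getD_eq_getElem _ _ (by omega)]
    rfl
  have hs2 : Seg (l.drop (i + 1)) (l.getD (i + 1) 0) q' := by
    refine ⟨?_, by rw [List.getLast?_drop, if_neg (by omega), hq']⟩
    rw [List.head?_drop, List.getElem?_eq_getElem (by omega), List.getD_eq_getElem _ _ (by omega)]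
  have hsplit := List.take_append_drop (i + 1) l
  obtain ⟨σ, τ, t2, t3, t, hD, hmap, H⟩ := Opt.exists_twoBlocks (by rw [hsplit]; exact hopt) hs1 hs2
    (by rw [hsplit]; omega)
  rw [hsplit] at hmap
  obtain ⟨ε, h'⟩ := hD.listing h
  have hback : l = ([0] ++ t2 ++ t3 ++ [t]).map τ := by
    rw [← hmap, hD.relabel.map_map hlt]
  have ep : pt (τ 0) = p := by
    rw [hback] at hhead; simpa using hhead
  have eq : pt (τ t) = q := by
    rw [hback, List.getLast?_map, List.getLast?_map, List.getLast?_concat] at hlast; simpa using hlast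
  have hb := H.ballot
  have i1 := hb.three_le
  have i2 := hb.le
  have hmem : ∀ x < (R ∪ B).card, pt (τ x) ∈ B ↔ pt (τ x) ∉ R := fun x hx => by
    have h1 := (h'.mem _).2 ⟨x, hx, rfl⟩
    rw [Finset.mem_union] at h1
    exact ⟨fun h2 h3 => Finset.disjoint_left.1 hdisj h3 h2, fun h2 => h1.resolve_left h2⟩
  have h0 := hmem 0 (by omega)
  have ht := hmem t (by omega)
  have hmid := hb.mid
  rw [Ne, decide_eq_decide] at hmid
  by_cases hR : pt (τ 0) ∈ R
  · have hsp := hb.specialConfig h' hconv (A := R) (C := B) (fun x hx => by simp [hR])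
      (fun x hx => by simp [hR, hmem x hx])
    rw [ep, eq] at *
    tauto
  · have hsp := hb.specialConfig (A := B) (C := R) (by rw [Finset.union_comm]; exact h')
      (by rw [Finset.union_comm]; exact hconv) (fun x hx => by simp [hR, hmem x hx])
      (fun x hx => by simp [hR])
    have hsp := hsp.swap
    rw [ep, eq] at *
    tauto

end
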